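/- Let φ be a semiflow on E satisfying (H1), (H2) with j = 2, (H3), (COM) and (S), with nonempty amenable set 𝔄. If a periodic orbit γ ⊆ 𝔄 is both externally stable and internally stable, then γ is amenable stable. -/

import Mathlib

open Set Filter Topology MeasureTheory Bornology

/-- A semiflow on a Banach space `E`. -/
structure Semiflow (E : Type*) [NormedAddCommGroup E] [NormedSpace ℝ E] where
  toFun : ℝ → E → E
  map_zero' : ∀ v : E, toFun 0 v = v
  map_add' : ∀ t s : ℝ, 0 ≤ t → 0 ≤ s → ∀ v : E, toFun (t + s) v = toFun t (toFun s v)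
  continuousOn' : ContinuousOn (fun p : ℝ × E => toFun p.1 p.2) (Set.Ici (0 : ℝ) ×ˢ Set.univ)

/-- The open `r`-neighborhood `O_r(γ)` of a set `γ` in a normed space. -/
def setNbhd {E : Type*} [NormedAddCommGroup E] (γ : Set E) (r : ℝ) : Set E :=
  {v | ∃ w ∈ γ, ‖v - w‖ < r}

/-- `S` is an `ε`-section at `x₀` of the (partial) flow `ξ` on the set `M`. -/
def IsSectionOn {X : Type*} [TopologicalSpace X] (M : Set X) (ξ : ℝ → X → X)
    (ε : ℝ) (x₀ : X) (S : Set X) : Prop :=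
  x₀ ∈ S ∧ S ⊆ M ∧
    (∃ W : Set X, IsOpen W ∧ x₀ ∈ W ∧
      W ∩ M ⊆ ⋃ t ∈ Set.Icc (-ε) ε, ξ t '' S) ∧
    ∀ y ∈ ⋃ t ∈ Set.Icc (-ε) ε, ξ t '' S,
      ∃! p : ℝ × X, p.1 ∈ Set.Icc (-ε) ε ∧ p.2 ∈ S ∧ ξ p.1 p.2 = y

/-- `T` is an `ε`-transversal at `x₀` of the (partial) flow `ξ` on the set `M`:
an `ε`-section which is the image of a topological embedding of `[-1,1]`,
with `x₀` corresponding to an interior point. -/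
def IsTransversalOn {X : Type*} [TopologicalSpace X] (M : Set X) (ξ : ℝ → X → X)
    (ε : ℝ) (x₀ : X) (T : Set X) : Prop :=
  IsSectionOn M ξ ε x₀ T ∧
    ∃ h : ℝ → X, ContinuousOn h (Set.Icc (-1 : ℝ) 1) ∧ Set.InjOn h (Set.Icc (-1 : ℝ) 1) ∧
      h '' Set.Icc (-1 : ℝ) 1 = T ∧ ∃ s₀ ∈ Set.Ioo (-1 : ℝ) 1, h s₀ = x₀

namespace Semiflow

variable {E : Type*} [NormedAddCommGroup E] [NormedSpace ℝ E]
variable {H : Type*} [NormedAddCommGroup H] [InnerProductSpace ℝ H]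

/-- A stationary point of the semiflow. -/
def IsStationary (φ : Semiflow E) (v₀ : E) : Prop :=
  ∀ t : ℝ, 0 ≤ t → φ.toFun t v₀ = v₀

/-- A periodic (non-stationary) point of the semiflow. -/
def IsPeriodicPt (φ : Semiflow E) (v₀ : E) : Prop :=
  ¬ φ.IsStationary v₀ ∧ ∃ σ : ℝ, 0 < σ ∧ φ.toFun σ v₀ = v₀

/-- The positive semi-orbit `γ⁺(v₀)` (which equals the full orbit for periodic points). -/
def orbit (φ : Semiflow E) (v₀ : E) : Set E :=
  {w | ∃ t : ℝ, 0 ≤ t ∧ φ.toFun t v₀ = w}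

/-- `γ` is a periodic orbit of the semiflow. -/
def IsPeriodicOrbit (φ : Semiflow E) (γ : Set E) : Prop :=
  ∃ v₀ : E, φ.IsPeriodicPt v₀ ∧ γ = φ.orbit v₀

/-- The ω-limit set of a point. -/
def omegaLimit (φ : Semiflow E) (v₀ : E) : Set E :=
  ⋂ s ∈ Set.Ici (0 : ℝ), closure {w | ∃ t : ℝ, s ≤ t ∧ φ.toFun t v₀ = w}

/-- A complete trajectory of the semiflow. -/
def IsCompleteTrajectory (φ : Semiflow E) (v : ℝ → E) : Prop :=
  Continuous v ∧ ∀ t : ℝ, 0 ≤ t → ∀ s : ℝ, v (t + s) = φ.toFun t (v s)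

/-- The α-limit set of a complete trajectory. -/
def alphaLimitOf (φ : Semiflow E) (v : ℝ → E) : Set E :=
  ⋂ s ∈ Set.Iic (0 : ℝ), closure {w | ∃ t : ℝ, t ≤ s ∧ v t = w}

/-- Hypothesis (H1): `P` is symmetric and positive on `Eplus`, negative on `Eminus`,
with `E = Eplus ⊕ Eminus`. -/
def IsH1 (P : E →L[ℝ] E →L[ℝ] ℝ) (Eplus Eminus : Submodule ℝ E) : Prop :=
  (∀ v w : E, P v w = P w v) ∧ IsClosed (Eplus : Set E) ∧ IsClosed (Eminus : Set E) ∧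
    IsCompl Eplus Eminus ∧
    (∀ v ∈ Eplus, v ≠ 0 → 0 < P v v) ∧ (∀ v ∈ Eminus, v ≠ 0 → P v v < 0)

/-- Hypothesis (H3): squeezing with respect to `V(v) = ⟨v, Pv⟩`, with parameters
`δ > 0`, `τV ≥ 0`, `ν > 0`; the embedding `E ↪ H` is `ι`. -/
def IsH3 (φ : Semiflow E) (ι : E →L[ℝ] H) (P : E →L[ℝ] E →L[ℝ] ℝ) (δ τV ν : ℝ) : Prop :=
  0 < δ ∧ 0 ≤ τV ∧ 0 < ν ∧
    ∀ v₁ v₂ : E, ∀ l r : ℝ, 0 ≤ l → l ≤ r → τV ≤ r - l →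
      Real.exp (2 * ν * r) *
          P (φ.toFun r v₁ - φ.toFun r v₂) (φ.toFun r v₁ - φ.toFun r v₂) -
        Real.exp (2 * ν * l) *
          P (φ.toFun l v₁ - φ.toFun l v₂) (φ.toFun l v₁ - φ.toFun l v₂) ≤
      -δ * ∫ s in l..r, Real.exp (2 * ν * s) * ‖ι (φ.toFun s v₁) - ι (φ.toFun s v₂)‖ ^ 2

/-- Hypothesis (COM): some time-`τ` map takes bounded sets to precompact sets. -/
def IsCOM (φ : Semiflow E) : Prop :=
  ∃ τ : ℝ, 0 < τ ∧ ∀ B : Set E, IsBounded B → IsCompact (closure (φ.toFun τ '' B))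

/-- Hypothesis (S): a smoothing estimate from `H` to `E`. -/
def IsSmoothing (φ : Semiflow E) (ι : E →L[ℝ] H) : Prop :=
  ∃ τ C : ℝ, 0 ≤ τ ∧ 0 < C ∧
    ∀ v₁ v₂ : E, ‖φ.toFun τ v₁ - φ.toFun τ v₂‖ ≤ C * ‖ι v₁ - ι v₂‖

/-- An amenable trajectory: a complete trajectory with
`∫_{-∞}^0 e^{2νs} |v(s)|²_H ds < ∞`. -/
def IsAmenableTrajectory (φ : Semiflow E) (ι : E →L[ℝ] H) (ν : ℝ) (v : ℝ → E) : Prop :=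
  φ.IsCompleteTrajectory v ∧
    IntegrableOn (fun s : ℝ => Real.exp (2 * ν * s) * ‖ι (v s)‖ ^ 2) (Set.Iic (0 : ℝ))

/-- The amenable set `𝔄`: points through which an amenable trajectory passes. -/
def amenableSet (φ : Semiflow E) (ι : E →L[ℝ] H) (ν : ℝ) : Set E :=
  {v₀ | ∃ v : ℝ → E, φ.IsAmenableTrajectory ι ν v ∧ v 0 = v₀}

/-- Orbital stability of a set `γ`. -/
def IsOrbitallyStable (φ : Semiflow E) (γ : Set E) : Prop :=
  ∀ ε : ℝ, 0 < ε → ∃ δ : ℝ, 0 < δ ∧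
    ∀ v ∈ setNbhd γ δ, ∀ t : ℝ, 0 ≤ t → φ.toFun t v ∈ setNbhd γ ε

/-- Amenable stability: orbital stability with respect to initial data in `𝔄`. -/
def IsAmenableStable (φ : Semiflow E) (ι : E →L[ℝ] H) (ν : ℝ) (γ : Set E) : Prop :=
  ∀ ε : ℝ, 0 < ε → ∃ δ : ℝ, 0 < δ ∧
    ∀ v ∈ setNbhd γ δ ∩ φ.amenableSet ι ν, ∀ t : ℝ, 0 ≤ t → φ.toFun t v ∈ setNbhd γ ε

/-- Lyapunov stability of a stationary point. -/
def IsLyapunovStable (φ : Semiflow E) (v₀ : E) : Prop :=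
  ∀ ε : ℝ, 0 < ε → ∃ δ : ℝ, 0 < δ ∧
    ∀ v : E, ‖v - v₀‖ < δ → ∀ t : ℝ, 0 ≤ t → ‖φ.toFun t v - v₀‖ < ε

/-- `D` is a `k`-dimensional local unstable set for the stationary point `v₀`:
(U1) `D` is a homeomorphic image of an open `k`-cube; (U2) through every point of `D`
there is a unique complete trajectory, converging to `v₀` as `t → -∞`;
(U3) trajectories through points of `D` near `v₀` stay near `v₀` for `t ≤ 0`. -/
def IsLocalUnstableSet (φ : Semiflow E) (k : ℕ) (v₀ : E) (D : Set E) : Prop :=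
  v₀ ∈ D ∧
    Nonempty (↥(Set.pi Set.univ fun _ : Fin k => Set.Ioo (0 : ℝ) 1) ≃ₜ ↥D) ∧
    (∀ w₀ ∈ D, ∃! w : ℝ → E, φ.IsCompleteTrajectory w ∧ w 0 = w₀) ∧
    (∀ w₀ ∈ D, ∀ w : ℝ → E, φ.IsCompleteTrajectory w → w 0 = w₀ →
      Filter.Tendsto w Filter.atBot (nhds v₀)) ∧
    (∀ ε : ℝ, 0 < ε → ∃ δ : ℝ, 0 < δ ∧ ∀ w₀ ∈ D, ‖w₀ - v₀‖ < δ →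
      ∀ w : ℝ → E, φ.IsCompleteTrajectory w → w 0 = w₀ → ∀ t : ℝ, t ≤ 0 → ‖w t - v₀‖ < ε)

/-- An unstable terminal point: a stationary point with a 2-dimensional local unstable set. -/
def IsUnstableTerminal (φ : Semiflow E) (v₀ : E) : Prop :=
  φ.IsStationary v₀ ∧ ∃ D : Set E, φ.IsLocalUnstableSet 2 v₀ D

/-- A terminal point: a stationary point that is Lyapunov stable or has a
2-dimensional local unstable set. -/
def IsTerminal (φ : Semiflow E) (v₀ : E) : Prop :=
  φ.IsStationary v₀ ∧
    (φ.IsLyapunovStable v₀ ∨ ∃ D : Set E, φ.IsLocalUnstableSet 2 v₀ D)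

/-- An attractor: a bounded closed set with an open neighborhood all of whose points have
precompact positive semi-orbits with ω-limit sets inside the set. -/
def IsAttractor (φ : Semiflow E) (A : Set E) : Prop :=
  IsBounded A ∧ IsClosed A ∧
    ∃ U : Set E, IsOpen U ∧ A ⊆ U ∧
      ∀ v₀ ∈ U, IsCompact (closure (φ.orbit v₀)) ∧ φ.omegaLimit v₀ ⊆ A

/-- `Pi` is the `V`-orthogonal projector onto `Eminus`. -/
def IsVProjector (P : E →L[ℝ] E →L[ℝ] ℝ) (Eminus : Submodule ℝ E) (Pi : E → E) : Prop :=
  ∀ v : E, Pi v ∈ Eminus ∧ ∀ w ∈ Eminus, P w v = P w (Pi v)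

/-- The interior region `𝒢_γ ⊆ 𝔄` of a periodic orbit `γ`: the preimage under `Π`
of the bounded connected component of `E⁻ \ Πγ`. -/
def interiorRegion (φ : Semiflow E) (ι : E →L[ℝ] H) (ν : ℝ) (Eminus : Submodule ℝ E)
    (Pi : E → E) (γ : Set E) : Set E :=
  {a | a ∈ φ.amenableSet ι ν ∧ Pi a ∈ (Eminus : Set E) \ (Pi '' γ) ∧
    IsBounded (connectedComponentIn ((Eminus : Set E) \ (Pi '' γ)) (Pi a))}

/-- The partial order `γ₁ ⩽ γ₂` on periodic orbits: `𝒢_{γ₁} ⊆ 𝒢_{γ₂}`. -/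
def orbitLE (φ : Semiflow E) (ι : E →L[ℝ] H) (ν : ℝ) (Eminus : Submodule ℝ E)
    (Pi : E → E) (γ₁ γ₂ : Set E) : Prop :=
  φ.interiorRegion ι ν Eminus Pi γ₁ ⊆ φ.interiorRegion ι ν Eminus Pi γ₂

/-- External stability of a periodic orbit `γ`. -/
def IsExternallyStable (φ : Semiflow E) (ι : E →L[ℝ] H) (ν : ℝ) (Eminus : Submodule ℝ E)
    (Pi : E → E) (γ : Set E) : Prop :=
  (∃ g : ℕ → Set E, (∀ k, φ.IsPeriodicOrbit (g k)) ∧ (∀ k, g k ≠ γ) ∧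
      (∀ k, φ.orbitLE ι ν Eminus Pi γ (g k)) ∧
      Filter.Tendsto (fun k => Metric.hausdorffDist (g k) γ) Filter.atTop (nhds 0)) ∨
    (∃ v₀ ∈ φ.amenableSet ι ν \ closure (φ.interiorRegion ι ν Eminus Pi γ),
      φ.omegaLimit v₀ = γ)

/-- Internal stability of a periodic orbit `γ`. -/
def IsInternallyStable (φ : Semiflow E) (ι : E →L[ℝ] H) (ν : ℝ) (Eminus : Submodule ℝ E)
    (Pi : E → E) (γ : Set E) : Prop :=
  (∃ g : ℕ → Set E, (∀ k, φ.IsPeriodicOrbit (g k)) ∧ (∀ k, g k ≠ γ) ∧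
      (∀ k, φ.orbitLE ι ν Eminus Pi (g k) γ) ∧
      Filter.Tendsto (fun k => Metric.hausdorffDist (g k) γ) Filter.atTop (nhds 0)) ∨
    (∃ v₀ ∈ φ.interiorRegion ι ν Eminus Pi γ, φ.omegaLimit v₀ = γ)

end Semiflow

/-! ### Continuous logarithms -/

theorem exists_log_lift {X : Type*} [NormedAddCommGroup X] [NormedSpace ℝ X] (f : X → ℂ)
    (hf : Continuous f) (h0 : ∀ x, f x ≠ 0) (a : X) (w : ℂ) (hw : Complex.exp w = f a) :
    ∃ L : X → ℂ, Continuous L ∧ (∀ x, Complex.exp (L x) = f x) ∧ L a = w := by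
  haveI : ContractibleSpace X := RealTopologicalVectorSpace.contractibleSpace
  obtain ⟨F, ⟨h1, h2⟩, -⟩ := Complex.isCoveringMapOn_exp.existsUnique_continuousMap_lifts
    (⟨f, hf⟩ : C(X, ℂ)) (a₀ := a) (e₀ := w) hw (fun x => h0 x)
  exact ⟨F, F.continuous, fun x => congrFun h2 x, h1⟩

theorem exists_log_lift' {X : Type*} [NormedAddCommGroup X] [NormedSpace ℝ X] (f : X → ℂ)
    (hf : Continuous f) (h0 : ∀ x, f x ≠ 0) :
    ∃ L : X → ℂ, Continuous L ∧ (∀ x, Complex.exp (L x) = f x) := by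
  obtain ⟨L, h1, h2, -⟩ := exists_log_lift f hf h0 0 (Complex.log (f 0)) (Complex.exp_log (h0 0))
  exact ⟨L, h1, h2⟩

/-- A continuous function with values in `2πiℤ` on a preconnected set is constant. -/
theorem const_of_exp_eq_one {X : Type*} [TopologicalSpace X] {s : Set X} (hs : IsPreconnected s)
    {g : X → ℂ} (hg : ContinuousOn g s) (h1 : ∀ x ∈ s, Complex.exp (g x) = 1)
    {x y : X} (hx : x ∈ s) (hy : y ∈ s) : g x = g y := by
  have hπ := Real.pi_pos
  have hre : ∀ x ∈ s, ∃ n : ℤ, g x = n * (2 * Real.pi * Complex.I) := fun x hx =>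
    Complex.exp_eq_one_iff.1 (h1 x hx)
  have hc : ContinuousOn (fun x => round ((g x).im / (2 * Real.pi))) s := by
    intro z hz
    obtain ⟨n, hn⟩ := hre z hz
    have h2 : ContinuousWithinAt (fun x => (g x).im / (2 * Real.pi)) s z :=
      (Complex.continuous_im.continuousAt.comp_continuousWithinAt (hg z hz)).div_const _
    have h3 : (g z).im / (2 * Real.pi) = n := by
      rw [hn]; simp
    have h4 : ∀ᶠ x in 𝓝[s] z, |(g x).im / (2 * Real.pi) - n| < 1/2 := by
      have := (Metric.tendsto_nhds.1 h2 (1/2) (by norm_num))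
      simpa [h3, Real.dist_eq] using this
    apply ContinuousWithinAt.congr_of_eventuallyEq (continuousWithinAt_const (b := n))
    · filter_upwards [h4] with x hx
      rw [round_eq_iff]
      rw [abs_lt] at hx
      constructor <;> [linarith; linarith]
    · simp only [h3]; exact round_intCast n
  have := hs.constant hc hx hy
  obtain ⟨n, hn⟩ := hre x hx
  obtain ⟨k, hk⟩ := hre y hy
  have e1 : (g x).im / (2 * Real.pi) = n := by rw [hn]; simp
  have e2 : (g y).im / (2 * Real.pi) = k := by rw [hk]; simp
  simp only [e1, e2, round_intCast] at this
  rw [hn, hk, this]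

theorem log_diff_const {X : Type*} [TopologicalSpace X] {s : Set X} (hs : IsPreconnected s)
    {g h : X → ℂ} (hg : ContinuousOn g s) (hh : ContinuousOn h s)
    (h1 : ∀ x ∈ s, Complex.exp (g x) = Complex.exp (h x))
    {x y : X} (hx : x ∈ s) (hy : y ∈ s) : g x - h x = g y - h y := by
  refine const_of_exp_eq_one hs (g := fun x => g x - h x) (hg.sub hh) ?_ hx hy
  intro z hz
  rw [Complex.exp_sub, h1 z hz, div_self (Complex.exp_ne_zero _)]

theorem stay_Ioo {X : Type*} [TopologicalSpace X] {s : Set X} (hs : IsPreconnected s)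
    {θ : X → ℝ} (hθ : ContinuousOn θ s) {α β : ℝ} (hα : ∀ x ∈ s, θ x ≠ α) (hβ : ∀ x ∈ s, θ x ≠ β)
    {x y : X} (hx : x ∈ s) (hy : y ∈ s) (h : θ x ∈ Ioo α β) : θ y ∈ Ioo α β := by
  have hI := (hs.image θ hθ).ordConnected
  by_contra hc
  rw [mem_Ioo, not_and_or, not_lt, not_lt] at hc
  rcases hc with hc | hc
  · obtain ⟨z, hz, hz'⟩ := hI.out (mem_image_of_mem θ hy) (mem_image_of_mem θ hx) ⟨hc, h.1.le⟩
    exact hα z hz hz'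
  · obtain ⟨z, hz, hz'⟩ := hI.out (mem_image_of_mem θ hx) (mem_image_of_mem θ hy) ⟨h.2.le, hc⟩
    exact hβ z hz hz'

theorem exp_re_sign (L : ℂ) : ∃ r : ℝ, 0 < r ∧ (Complex.exp L).re = r * Real.cos L.im ∧
    (Complex.exp L).im = r * Real.sin L.im :=
  ⟨Real.exp L.re, Real.exp_pos _, Complex.exp_re L, Complex.exp_im L⟩

/-- Crossing lemma. -/
theorem crossing (X1 X2 C1 C2 : ℝ → ℝ) (hX1 : Continuous X1) (hX2 : Continuous X2)
    (hC1 : Continuous C1) (hC2 : Continuous C2) (s0 s1 t0 t1 : ℝ) (hs : s0 ≤ s1) (ht : t0 ≤ t1)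
    (hleft : ∀ t ∈ Icc t0 t1, X1 s0 < C1 t) (htop : ∀ s ∈ Icc s0 s1, X1 s < C1 t1)
    (hbot : ∀ s ∈ Icc s0 s1, C1 t0 < X1 s ∨ X2 s < C2 t0)
    (hright : ∀ t ∈ Icc t0 t1, C1 t < X1 s1 ∨ C2 t < X2 s1) :
    ∃ s ∈ Icc s0 s1, ∃ t ∈ Icc t0 t1, X1 s = C1 t ∧ X2 s = C2 t := by
  by_contra hcon
  push Not at hcon
  have hπ := Real.pi_pos
  set F : ℝ × ℝ → ℂ := fun q =>
    ⟨X1 (projIcc s0 s1 hs q.1) - C1 (projIcc t0 t1 ht q.2),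
      X2 (projIcc s0 s1 hs q.1) - C2 (projIcc t0 t1 ht q.2)⟩ with hF
  have hFc : Continuous F := by
    have : F = fun q : ℝ × ℝ =>
      ((X1 (projIcc s0 s1 hs q.1) - C1 (projIcc t0 t1 ht q.2) : ℝ) : ℂ) +
      ((X2 (projIcc s0 s1 hs q.1) - C2 (projIcc t0 t1 ht q.2) : ℝ) : ℂ) * Complex.I := by
      funext q; apply Complex.ext <;> simp [hF]
    rw [this]
    have a1 : Continuous fun q : ℝ × ℝ => (projIcc s0 s1 hs q.1 : ℝ) :=
      continuous_subtype_val.comp (continuous_projIcc.comp continuous_fst)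
    have a2 : Continuous fun q : ℝ × ℝ => (projIcc t0 t1 ht q.2 : ℝ) :=
      continuous_subtype_val.comp (continuous_projIcc.comp continuous_snd)
    have b1 := hX1.comp a1
    have b2 := hX2.comp a1
    have b3 := hC1.comp a2
    have b4 := hC2.comp a2
    simp only [Function.comp_def] at b1 b2 b3 b4
    fun_prop
  have hF0 : ∀ q, F q ≠ 0 := by
    intro q hq
    have e1 := congrArg Complex.re hq
    have e2 := congrArg Complex.im hq
    simp only [hF, Complex.zero_re, Complex.zero_im] at e1 e2
    exact hcon _ (projIcc s0 s1 hs q.1).2 _ (projIcc t0 t1 ht q.2).2 (by linarith) (by linarith)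
  have hFv : ∀ s ∈ Icc s0 s1, ∀ t ∈ Icc t0 t1, F (s, t) = ⟨X1 s - C1 t, X2 s - C2 t⟩ := by
    intro s hs' t ht'
    simp only [hF, projIcc_of_mem hs hs', projIcc_of_mem ht ht']
  have hs0 : s0 ∈ Icc s0 s1 := left_mem_Icc.2 hs
  have hs1 : s1 ∈ Icc s0 s1 := right_mem_Icc.2 hs
  have ht0 : t0 ∈ Icc t0 t1 := left_mem_Icc.2 ht
  have ht1 : t1 ∈ Icc t0 t1 := right_mem_Icc.2 ht
  -- initial corner
  have c0 : (F (s0, t0)).re < 0 ∧ (F (s0, t0)).im < 0 := by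
    rw [hFv _ hs0 _ ht0]
    have := hleft _ ht0
    rcases hbot _ hs0 with h | h
    · linarith
    · exact ⟨by simp only; linarith, by simp only; linarith⟩
  obtain ⟨L, hL, hLe, hL0⟩ := exists_log_lift F hFc hF0 (s0, t0) (Complex.log (F (s0, t0)))
    (Complex.exp_log (hF0 _))
  have hre : ∀ q, ∃ r : ℝ, 0 < r ∧ (F q).re = r * Real.cos (L q).im ∧
    (F q).im = r * Real.sin (L q).im := fun q => by rw [← hLe q]; exact exp_re_sign _
  have im0 : (L (s0, t0)).im ∈ Ioo (-Real.pi) (-(Real.pi / 2)) := by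
    rw [hL0, Complex.log_im]
    refine ⟨Complex.neg_pi_lt_arg _, ?_⟩
    have h1 := Complex.arg_neg_iff.2 c0.2
    by_contra hcc
    push Not at hcc
    have h2 := Complex.abs_arg_le_pi_div_two_iff.1 (abs_le.2 ⟨hcc, by linarith⟩)
    linarith [c0.1]
  have hLi : Continuous fun q => (L q).im := Complex.continuous_im.comp hL
  -- bottom
  have bot : (L (s1, t0)).im ∈ Ioo (-Real.pi) (Real.pi / 2) := by
    refine stay_Ioo (isPreconnected_Icc (a := s0) (b := s1)) (θ := fun s => (L (s, t0)).im)
      (by fun_prop) ?_ ?_ hs0 hs1 ⟨im0.1, by linarith [im0.2]⟩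
    · intro s hs' h
      obtain ⟨r, hr, e1, e2⟩ := hre (s, t0)
      rw [h] at e1 e2
      simp [hFv _ hs' _ ht0] at e1 e2
      rcases hbot _ hs' with h | h <;> linarith
    · intro s hs' h
      obtain ⟨r, hr, e1, e2⟩ := hre (s, t0)
      rw [h] at e1 e2
      simp [hFv _ hs' _ ht0] at e1 e2
      rcases hbot _ hs' with h | h <;> linarith
  have bot' : (L (s1, t0)).im ∈ Ioo (-(Real.pi / 2)) Real.pi := by
    refine ⟨?_, by linarith [bot.2]⟩
    by_contra hcc
    push Not at hcc
    obtain ⟨r, hr, e1, e2⟩ := hre (s1, t0)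
    have k1 : Real.cos (L (s1, t0)).im ≤ 0 := by
      rw [← Real.cos_neg]
      exact Real.cos_nonpos_of_pi_div_two_le_of_le (by linarith) (by linarith [bot.1])
    have k2 : Real.sin (L (s1, t0)).im ≤ 0 :=
      Real.sin_nonpos_of_nonpos_of_neg_pi_le (by linarith) (by linarith [bot.1])
    simp [hFv _ hs1 _ ht0] at e1 e2
    rcases hright _ ht0 with h | h <;> nlinarith
  have rig : (L (s1, t1)).im ∈ Ioo (-(Real.pi / 2)) Real.pi := by
    refine stay_Ioo (isPreconnected_Icc (a := t0) (b := t1)) (θ := fun t => (L (s1, t)).im)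
      (by fun_prop) ?_ ?_ ht0 ht1 bot'
    · intro t ht' h
      obtain ⟨r, hr, e1, e2⟩ := hre (s1, t)
      rw [h] at e1 e2
      simp [hFv _ hs1 _ ht'] at e1 e2
      rcases hright _ ht' with h | h <;> linarith
    · intro t ht' h
      obtain ⟨r, hr, e1, e2⟩ := hre (s1, t)
      rw [h] at e1 e2
      simp [hFv _ hs1 _ ht'] at e1 e2
      rcases hright _ ht' with h | h <;> linarith
  have rig' : (L (s1, t1)).im ∈ Ioo (Real.pi / 2) (3 * Real.pi / 2) := by
    refine ⟨?_, by linarith [rig.2]⟩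
    by_contra hcc
    push Not at hcc
    obtain ⟨r, hr, e1, e2⟩ := hre (s1, t1)
    have k1 : 0 ≤ Real.cos (L (s1, t1)).im :=
      Real.cos_nonneg_of_neg_pi_div_two_le_of_le (by linarith [rig.1]) (by linarith)
    simp [hFv _ hs1 _ ht1] at e1
    have := htop _ hs1
    nlinarith
  have cos32 : Real.cos (3 * Real.pi / 2) = 0 := by
    rw [show 3 * Real.pi / 2 = Real.pi / 2 + Real.pi by ring, Real.cos_add_pi]; simp
  have top : (L (s0, t1)).im ∈ Ioo (Real.pi / 2) (3 * Real.pi / 2) := by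
    refine stay_Ioo (isPreconnected_Icc (a := s0) (b := s1)) (θ := fun s => (L (s, t1)).im)
      (by fun_prop) ?_ ?_ hs1 hs0 rig'
    · intro s hs' h
      obtain ⟨r, hr, e1, e2⟩ := hre (s, t1)
      rw [h] at e1 e2
      simp [hFv _ hs' _ ht1] at e1
      linarith [htop _ hs']
    · intro s hs' h
      obtain ⟨r, hr, e1, e2⟩ := hre (s, t1)
      rw [h, cos32] at e1
      simp [hFv _ hs' _ ht1] at e1
      linarith [htop _ hs']
  have lef : (L (s0, t0)).im ∈ Ioo (Real.pi / 2) (3 * Real.pi / 2) := by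
    refine stay_Ioo (isPreconnected_Icc (a := t0) (b := t1)) (θ := fun t => (L (s0, t)).im)
      (by fun_prop) ?_ ?_ ht1 ht0 top
    · intro t ht' h
      obtain ⟨r, hr, e1, e2⟩ := hre (s0, t)
      rw [h] at e1 e2
      simp [hFv _ hs0 _ ht'] at e1
      linarith [hleft _ ht']
    · intro t ht' h
      obtain ⟨r, hr, e1, e2⟩ := hre (s0, t)
      rw [h, cos32] at e1
      simp [hFv _ hs0 _ ht'] at e1
      linarith [hleft _ ht']
  linarith [lef.1, im0.2]

/-- Winding property used to transport arguments along a path. -/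
def ArcTurn (B : ℝ → ℂ) (z : ℂ) : Prop :=
  ∀ L : ℝ → ℂ, Continuous L → (∀ u ∈ Icc (0:ℝ) 1, Complex.exp (L u) = B u - z) →
    (L 0).im ∈ Ioo 0 (2 * Real.pi) → (L 1).im ∈ Ioo Real.pi (3 * Real.pi)

theorem cos_three_pi : Real.cos (3 * Real.pi) = -1 := by
  rw [show 3 * Real.pi = Real.pi + 2 * Real.pi by ring, Real.cos_add_two_pi, Real.cos_pi]

theorem ArcTurn.trans {B Z : ℝ → ℂ} (hB : Continuous B) (hZ : Continuous Z)
    (hne : ∀ u ∈ Icc (0:ℝ) 1, ∀ v ∈ Icc (0:ℝ) 1, B u ≠ Z v)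
    (ha : ∀ v ∈ Icc (0:ℝ) 1, (B 0).re ≤ (Z v).re) (hb : ∀ v ∈ Icc (0:ℝ) 1, (Z v).re ≤ (B 1).re)
    (h1 : ArcTurn B (Z 1)) : ArcTurn B (Z 0) := by
  intro L hL hLe hL0
  have hπ := Real.pi_pos
  have h01 : (0:ℝ) ≤ 1 := zero_le_one
  have m0 : (0:ℝ) ∈ Icc (0:ℝ) 1 := left_mem_Icc.2 h01
  have m1 : (1:ℝ) ∈ Icc (0:ℝ) 1 := right_mem_Icc.2 h01
  set F : ℝ × ℝ → ℂ := fun q => B (projIcc 0 1 h01 q.1) - Z (projIcc 0 1 h01 q.2) with hF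
  have hFc : Continuous F := by
    have a1 : Continuous fun q : ℝ × ℝ => (projIcc (0:ℝ) 1 h01 q.1 : ℝ) :=
      continuous_subtype_val.comp (continuous_projIcc.comp continuous_fst)
    have a2 : Continuous fun q : ℝ × ℝ => (projIcc (0:ℝ) 1 h01 q.2 : ℝ) :=
      continuous_subtype_val.comp (continuous_projIcc.comp continuous_snd)
    exact (hB.comp a1).sub (hZ.comp a2)
  have hFv : ∀ u ∈ Icc (0:ℝ) 1, ∀ v ∈ Icc (0:ℝ) 1, F (u, v) = B u - Z v := by
    intro s hs' t ht'
    simp only [hF, projIcc_of_mem h01 hs', projIcc_of_mem h01 ht']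
  have hF0 : ∀ q, F q ≠ 0 := fun q hq =>
    hne _ (projIcc 0 1 h01 q.1).2 _ (projIcc 0 1 h01 q.2).2 (sub_eq_zero.1 hq)
  obtain ⟨M, hM, hMe, hM0⟩ := exists_log_lift F hFc hF0 (0, 0) (L 0)
    (by rw [hLe 0 m0, hFv 0 m0 0 m0])
  have hMi : Continuous fun q => (M q).im := Complex.continuous_im.comp hM
  have hre : ∀ q, ∃ r : ℝ, 0 < r ∧ (F q).re = r * Real.cos (M q).im ∧
    (F q).im = r * Real.sin (M q).im := fun q => by rw [← hMe q]; exact exp_re_sign _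
  have e1 : M (1, 0) = L 1 := by
    have := log_diff_const (isPreconnected_Icc (a := (0:ℝ)) (b := 1)) (g := fun u => M (u, 0))
      (h := L) (by fun_prop) hL.continuousOn (fun u hu => by
        rw [hMe, hLe u hu, hFv u hu 0 m0]) m1 m0
    simp only [hM0, sub_self] at this
    exact sub_eq_zero.1 this
  have l1 : (M (0, 1)).im ∈ Ioo 0 (2 * Real.pi) := by
    refine stay_Ioo (isPreconnected_Icc (a := (0:ℝ)) (b := 1)) (θ := fun t => (M (0, t)).im)
      (by fun_prop) ?_ ?_ m0 m1 (by rw [hM0]; exact hL0)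
    · intro t ht' h
      obtain ⟨r, hr, e1, e2⟩ := hre (0, t)
      rw [h] at e1 e2
      simp [hFv _ m0 _ ht'] at e1 e2
      linarith [ha _ ht']
    · intro t ht' h
      obtain ⟨r, hr, e1, e2⟩ := hre (0, t)
      rw [h] at e1 e2
      simp [hFv _ m0 _ ht'] at e1 e2
      linarith [ha _ ht']
  have l2 := h1 (fun u => M (u, 1)) (by fun_prop) (fun u hu => by
        rw [hMe, hFv u hu 1 m1]) l1
  rw [← e1]
  refine stay_Ioo (isPreconnected_Icc (a := (0:ℝ)) (b := 1)) (θ := fun t => (M (1, t)).im)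
      (by fun_prop) ?_ ?_ m1 m0 l2
  · intro t ht' h
    obtain ⟨r, hr, e1, e2⟩ := hre (1, t)
    rw [h] at e1 e2
    simp [hFv _ m1 _ ht'] at e1 e2
    linarith [hb _ ht']
  · intro t ht' h
    obtain ⟨r, hr, e1, e2⟩ := hre (1, t)
    rw [h, cos_three_pi] at e1
    simp [hFv _ m1 _ ht'] at e1
    linarith [hb _ ht']

theorem ArcTurn.base {B : ℝ → ℂ} {n : ℂ} (h : ∀ u ∈ Icc (0:ℝ) 1, (B u).im < n.im) :
    ArcTurn B n := by
  intro L hL hLe hL0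
  have hπ := Real.pi_pos
  have h01 : (0:ℝ) ≤ 1 := zero_le_one
  have m0 : (0:ℝ) ∈ Icc (0:ℝ) 1 := left_mem_Icc.2 h01
  have m1 : (1:ℝ) ∈ Icc (0:ℝ) 1 := right_mem_Icc.2 h01
  have hneg : ∀ u ∈ Icc (0:ℝ) 1, Real.sin (L u).im < 0 := by
    intro u hu
    obtain ⟨r, hr, e1, e2⟩ := exp_re_sign (L u)
    rw [hLe u hu, Complex.sub_im] at e2
    have := h u hu
    by_contra hc
    push Not at hc
    nlinarith
  have h0 : (L 0).im ∈ Ioo Real.pi (2 * Real.pi) := by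
    refine ⟨?_, hL0.2⟩
    by_contra hc
    push Not at hc
    linarith [hneg 0 m0, Real.sin_nonneg_of_nonneg_of_le_pi hL0.1.le hc]
  have : (L 1).im ∈ Ioo Real.pi (2 * Real.pi) := by
    refine stay_Ioo (isPreconnected_Icc (a := (0:ℝ)) (b := 1)) (θ := fun t => (L t).im)
      (by fun_prop) ?_ ?_ m0 m1 h0
    · intro u hu h
      have := hneg u hu
      rw [h] at this
      simp at this
    · intro u hu h
      have := hneg u hu
      rw [h] at this
      simp at this
  exact ⟨this.1, by linarith [this.2]⟩

theorem two_arcs {A B : ℝ → ℂ} (hA : Continuous A) (hB : Continuous B)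
    (h0 : A 0 = B 0) (h1 : A 1 = B 1) (hlt : (A 0).re < (A 1).re)
    (hAl : ∀ u ∈ Icc (0:ℝ) 1, (A 0).re ≤ (A u).re) (hAr : ∀ u ∈ Icc (0:ℝ) 1, (A u).re ≤ (A 1).re)
    (hd : ∀ u ∈ Ioo (0:ℝ) 1, ∀ v ∈ Icc (0:ℝ) 1, A u ≠ B v)
    {x0 : ℝ} (hx : x0 ∈ Ioo (A 0).re (A 1).re) {ul : ℝ} (hul : ul ∈ Icc (0:ℝ) 1)
    (hulx : (A ul).re = x0)
    (hBl : ∀ v ∈ Icc (0:ℝ) 1, (B v).re = x0 → (B v).im ≤ (A ul).im) :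
    ∃ z0 : ℂ, (∀ u ∈ Icc (0:ℝ) 1, A u ≠ z0) ∧ (∀ u ∈ Icc (0:ℝ) 1, B u ≠ z0) ∧
      ∀ LA LB : ℝ → ℂ, Continuous LA → Continuous LB →
        (∀ u ∈ Icc (0:ℝ) 1, Complex.exp (LA u) = A u - z0) →
        (∀ u ∈ Icc (0:ℝ) 1, Complex.exp (LB u) = B u - z0) → LA 0 = LB 0 → LA 1 ≠ LB 1 := by
  have hπ := Real.pi_pos
  have h01 : (0:ℝ) ≤ 1 := zero_le_one
  have m0 : (0:ℝ) ∈ Icc (0:ℝ) 1 := left_mem_Icc.2 h01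
  have m1 : (1:ℝ) ∈ Icc (0:ℝ) 1 := right_mem_Icc.2 h01
  -- interior parameters
  have hint : ∀ u ∈ Icc (0:ℝ) 1, (A u).re = x0 → u ∈ Ioo (0:ℝ) 1 := by
    intro u hu hux
    refine ⟨lt_of_le_of_ne hu.1 ?_, lt_of_le_of_ne hu.2 ?_⟩
    · rintro rfl; linarith [hx.1]
    · rintro rfl; linarith [hx.2]
  -- lowest point
  have hcomp : IsCompact (Icc (0:ℝ) 1 ∩ {u | (A u).re = x0}) :=
    isCompact_Icc.inter_right (isClosed_eq (Complex.continuous_re.comp hA) continuous_const)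
  obtain ⟨um, ⟨hum, humx⟩, hummin⟩ := hcomp.exists_isMinOn ⟨ul, hul, hulx⟩
    (f := fun u => (A u).im) (Complex.continuous_im.comp hA).continuousOn
  simp only [mem_setOf_eq] at humx
  have humI := hint um hum humx
  have hulI := hint ul hul hulx
  -- distance from B
  have hBc : IsClosed (B '' Icc (0:ℝ) 1) := (isCompact_Icc.image hB).isClosed
  have hmuB : A um ∈ (B '' Icc (0:ℝ) 1)ᶜ := by
    rintro ⟨v, hv, hv'⟩
    exact hd um humI v hv hv'.symm
  obtain ⟨η, hη, hηB⟩ := Metric.isOpen_iff.1 hBc.isOpen_compl _ hmuB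
  set z0 : ℂ := A um - ((η / 2 : ℝ) : ℂ) * Complex.I with hz0
  have hz0re : z0.re = x0 := by simp [hz0, humx]
  have hz0im : z0.im = (A um).im - η / 2 := by simp [hz0]
  -- the vertical segment below misses B
  have hseg : ∀ t : ℝ, 0 ≤ t → t ≤ η / 2 → ∀ v ∈ Icc (0:ℝ) 1,
      B v ≠ A um - (t : ℂ) * Complex.I := by
    intro t ht ht' v hv hc
    have : A um - (t : ℂ) * Complex.I ∈ Metric.ball (A um) η := by
      rw [Metric.mem_ball, dist_eq_norm]
      simp [abs_of_nonneg ht]; linarith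
    exact hηB this ⟨v, hv, hc⟩
  have hAz : ∀ u ∈ Icc (0:ℝ) 1, (A u).re = x0 → z0.im < (A u).im := by
    intro u hu hux
    have := hummin ⟨hu, hux⟩
    simp only [mem_setOf_eq] at this
    rw [hz0im]; linarith
  refine ⟨z0, ?_, ?_, ?_⟩
  · intro u hu hc
    have := hAz u hu (by rw [hc, hz0re])
    rw [hc] at this
    exact lt_irrefl _ this
  · intro v hv hc
    exact hseg (η / 2) (by linarith) le_rfl v hv hc
  intro LA LB hLA hLB hLAe hLBe hL0 hL1
  -- turning of B
  have hturn : ArcTurn B z0 := by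
    obtain ⟨R, hR⟩ := (isCompact_Icc (a := (0:ℝ)) (b := 1)).bddAbove_image
      (f := fun u => (B u).im) (Complex.continuous_im.comp hB).continuousOn
    have hR' : ∀ u ∈ Icc (0:ℝ) 1, (B u).im ≤ R := fun u hu => hR ⟨u, hu, rfl⟩
    have hre0 : ∀ {z : ℂ}, z.re = x0 → (B 0).re ≤ z.re ∧ z.re ≤ (B 1).re := by
      intro z hz; rw [hz, ← h0, ← h1]; exact ⟨hx.1.le, hx.2.le⟩
    have t3 : ArcTurn B (A ul) := by
      have := ArcTurn.trans (B := B) (Z := fun v => A ul + ((v * (|R| + |(A ul).im| + 1) : ℝ) : ℂ) *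
        Complex.I) hB (by fun_prop) ?_ ?_ ?_ (ArcTurn.base ?_)
      · simpa using this
      · intro u hu v hv hc
        have hcre := congrArg Complex.re hc
        have hcim := congrArg Complex.im hc
        simp [-Complex.ofReal_mul, -Complex.ofReal_add] at hcre hcim
        have k := hBl u hu (by rw [hcre, hulx])
        have hp : 0 < |R| + |(A ul).im| + 1 := by positivity
        have hv0 : v = 0 := by
          by_contra hvne
          have : 0 < v := lt_of_le_of_ne hv.1 (Ne.symm hvne)
          nlinarith
        subst hv0
        simp at hc
        exact hd ul hulI u hu hc.symm
      · intro v hv; refine (hre0 ?_).1; simp [-Complex.ofReal_mul, -Complex.ofReal_add, hulx]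
      · intro v hv; refine (hre0 ?_).2; simp [-Complex.ofReal_mul, -Complex.ofReal_add, hulx]
      · intro u hu
        simp [-Complex.ofReal_mul, -Complex.ofReal_add]
        linarith [hR' u hu, le_abs_self R, neg_abs_le (A ul).im]
    have hco : ∀ v ∈ Icc (0:ℝ) 1, um + v * (ul - um) ∈ Ioo (0:ℝ) 1 := by
      intro v hv
      constructor <;> nlinarith [hv.1, hv.2, humI.1, humI.2, hulI.1, hulI.2,
        mul_nonneg hv.1 hulI.1.le, mul_nonneg (sub_nonneg.2 hv.2) humI.1.le,
        mul_nonneg hv.1 (sub_nonneg.2 hulI.2.le), mul_nonneg (sub_nonneg.2 hv.2) (sub_nonneg.2 humI.2.le)]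
    have t2 : ArcTurn B (A um) := by
      have := ArcTurn.trans (B := B) (Z := fun v => A (um + v * (ul - um))) hB (by fun_prop) ?_ ?_ ?_
        (by simpa using t3)
      · simpa using this
      · intro u hu v hv hc
        exact hd _ (hco v hv) u hu hc.symm
      · intro v hv
        have := hco v hv
        rw [← h0]; exact hAl _ ⟨this.1.le, this.2.le⟩
      · intro v hv
        have := hco v hv
        rw [← h1]; exact hAr _ ⟨this.1.le, this.2.le⟩
    have := ArcTurn.trans (B := B) (Z := fun v => A um - (((1 - v) * (η / 2) : ℝ) : ℂ) * Complex.I)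
        hB (by fun_prop) ?_ ?_ ?_ (by simpa using t2)
    · simpa [hz0] using this
    · intro u hu v hv
      exact hseg _ (mul_nonneg (by linarith [hv.2]) (by linarith)) (by nlinarith [hv.1]) u hu
    · intro v hv; refine (hre0 ?_).1; simp [-Complex.ofReal_mul, -Complex.ofReal_sub, humx]
    · intro v hv; refine (hre0 ?_).2; simp [-Complex.ofReal_mul, -Complex.ofReal_sub, humx]
  -- arguments along A
  set G : ℝ → ℂ := fun u => Complex.log (-Complex.I * (A u - z0)) + (Real.pi / 2 : ℝ) * Complex.I
    with hG
  have hslit : ∀ u ∈ Icc (0:ℝ) 1, -Complex.I * (A u - z0) ∈ Complex.slitPlane := by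
    intro u hu
    rw [Complex.mem_slitPlane_iff]
    by_cases hux : (A u).re = x0
    · left; have := hAz u hu hux; simp; exact this
    · right; simp only [neg_mul, Complex.neg_im, Complex.mul_im, Complex.I_re, Complex.I_im,
        Complex.sub_re, hz0re]
      intro hc
      apply hux; simp at hc; linarith
  have hGe : ∀ u ∈ Icc (0:ℝ) 1, Complex.exp (G u) = A u - z0 := by
    intro u hu
    have e : Complex.exp (((Real.pi / 2 : ℝ) : ℂ) * Complex.I) = Complex.I := by
      simpa using Complex.exp_pi_div_two_mul_I
    rw [hG]; simp only
    rw [Complex.exp_add, Complex.exp_log (Complex.slitPlane_ne_zero (hslit u hu)), e]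
    ring_nf; simp; ring
  have hGc : ContinuousOn G (Icc 0 1) := by
    apply ContinuousOn.add _ continuousOn_const
    apply ContinuousOn.clog _ hslit
    fun_prop
  have hdiff := log_diff_const (isPreconnected_Icc (a := (0:ℝ)) (b := 1)) hLA.continuousOn hGc
    (fun u hu => by rw [hLAe u hu, hGe u hu]) m0 m1
  have hGim : ∀ u, (G u).im ∈ Ioc (-(Real.pi/2)) (3 * Real.pi / 2) := by
    intro u
    have e : (G u).im = Complex.arg (-Complex.I * (A u - z0)) + Real.pi / 2 := by
      rw [hG]; simp only [Complex.add_im, Complex.log_im]; simp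
    rw [e]
    have k1 := Complex.neg_pi_lt_arg (-Complex.I * (A u - z0))
    have k2 := Complex.arg_le_pi (-Complex.I * (A u - z0))
    constructor <;> linarith
  have g0 : (G 0).im ∈ Ioo 0 (2 * Real.pi) := by
    have h := hGim 0
    refine ⟨?_, by linarith [h.2]⟩
    by_contra hc
    push Not at hc
    obtain ⟨r, hr, e1, e2⟩ := exp_re_sign (G 0)
    rw [hGe 0 m0, Complex.sub_re, hz0re] at e1
    have := Real.cos_nonneg_of_neg_pi_div_two_le_of_le h.1.le (by linarith)
    nlinarith [hx.1]
  have g1 : (G 1).im ≤ Real.pi := by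
    by_contra hc
    push Not at hc
    have h := hGim 1
    obtain ⟨r, hr, e1, e2⟩ := exp_re_sign (G 1)
    rw [hGe 1 m1, Complex.sub_re, hz0re] at e1
    have := Real.cos_nonpos_of_pi_div_two_le_of_le (x := (G 1).im) (by linarith) (by linarith [h.2])
    nlinarith [hx.2]
  have key := hturn (fun u => LB u - (LA 0 - G 0)) (by fun_prop) (fun u hu => by
    have e : Complex.exp (LA 0 - G 0) = 1 := by
      rw [Complex.exp_sub, hLAe 0 m0, hGe 0 m0, div_self]
      rw [← hGe 0 m0]; exact Complex.exp_ne_zero _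
    rw [Complex.exp_sub, e, hLBe u hu, div_one]) (by rw [← hL0]; simpa using g0)
  rw [← hL1, hdiff] at key
  simp at key
  linarith [key.1]

/-- A simple closed curve parametrised by `ℝ / σℤ`. -/
structure IsLoop (Γ : ℝ → ℂ) (σ : ℝ) : Prop where
  cont : Continuous Γ
  pos : 0 < σ
  per : ∀ t, Γ (t + σ) = Γ t
  inj : ∀ s t, Γ s = Γ t → ∃ n : ℤ, s = t + n * σ

theorem IsLoop.per_int {Γ : ℝ → ℂ} {σ : ℝ} (h : IsLoop Γ σ) (t : ℝ) (n : ℤ) :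
    Γ (t + n * σ) = Γ t :=
  (show Function.Periodic Γ σ from h.per).int_mul n t

theorem exists_mod {σ : ℝ} (hσ : 0 < σ) (t : ℝ) : ∃ r ∈ Ico 0 σ, ∃ n : ℤ, t = r + n * σ := by
  refine ⟨t - ⌊t / σ⌋ * σ, ⟨?_, ?_⟩, ⌊t / σ⌋, by ring⟩
  · have := Int.floor_le (t / σ)
    rw [le_div_iff₀ hσ] at this; linarith
  · have := Int.lt_floor_add_one (t / σ)
    rw [div_lt_iff₀ hσ] at this; nlinarith

theorem IsLoop.range_eq {Γ : ℝ → ℂ} {σ : ℝ} (h : IsLoop Γ σ) : range Γ = Γ '' Icc 0 σ := by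
  apply Subset.antisymm _ (image_subset_range _ _)
  rintro _ ⟨t, rfl⟩
  obtain ⟨r, hr, n, rfl⟩ := exists_mod h.pos t
  exact ⟨r, ⟨hr.1, hr.2.le⟩, (h.per_int r n).symm⟩

theorem IsLoop.isCompact {Γ : ℝ → ℂ} {σ : ℝ} (h : IsLoop Γ σ) : IsCompact (range Γ) := by
  rw [h.range_eq]; exact isCompact_Icc.image h.cont

theorem IsLoop.log_per {Γ : ℝ → ℂ} {σ : ℝ} (h : IsLoop Γ σ) {z : ℂ} {L : ℝ → ℂ}
    (hL : Continuous L) (hLe : ∀ t, Complex.exp (L t) = Γ t - z) (s t : ℝ) :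
    L (s + σ) - L s = L (t + σ) - L t :=
  log_diff_const isPreconnected_univ (g := fun t => L (t + σ)) (h := L)
    (by fun_prop) hL.continuousOn (fun u _ => by rw [hLe, hLe, h.per]) (mem_univ s) (mem_univ t)

theorem IsLoop.exists_winding_aux {Γ : ℝ → ℂ} {σ : ℝ} (h : IsLoop Γ σ)
    (hne : ∃ s t, (Γ s).re ≠ (Γ t).re) :
    ∃ z0 : ℂ, (∀ t, Γ t ≠ z0) ∧ ∀ L : ℝ → ℂ, Continuous L →
      (∀ t, Complex.exp (L t) = Γ t - z0) → L σ ≠ L 0 := by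
  have hσ := h.pos
  have hne' : (range Γ).Nonempty := ⟨Γ 0, 0, rfl⟩
  obtain ⟨_, ⟨ta, rfl⟩, hta⟩ := h.isCompact.exists_isMinOn hne' Complex.continuous_re.continuousOn
  obtain ⟨_, ⟨tb, rfl⟩, htb⟩ := h.isCompact.exists_isMaxOn hne' Complex.continuous_re.continuousOn
  have hmin : ∀ t, (Γ ta).re ≤ (Γ t).re := fun t => hta ⟨t, rfl⟩
  have hmax : ∀ t, (Γ t).re ≤ (Γ tb).re := fun t => htb ⟨t, rfl⟩
  have hlt : (Γ ta).re < (Γ tb).re := by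
    obtain ⟨s, t, hst⟩ := hne
    by_contra hc
    push Not at hc
    apply hst
    linarith [hmin s, hmin t, hmax s, hmax t]
  obtain ⟨β, hβ, n, hn⟩ := exists_mod hσ (tb - ta)
  have hΓb : Γ (ta + β) = Γ tb := by
    rw [show tb = (ta + β) + n * σ by linarith, h.per_int]
  have hβ0 : 0 < β := by
    refine lt_of_le_of_ne hβ.1 ?_
    rintro rfl
    rw [add_zero] at hΓb
    rw [hΓb] at hlt
    exact lt_irrefl _ hlt
  set A : ℝ → ℂ := fun u => Γ (ta + β * u) with hA
  set B : ℝ → ℂ := fun u => Γ (ta - (σ - β) * u) with hB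
  have cΓ := h.cont
  have cA : Continuous A := by fun_prop
  have cB : Continuous B := by fun_prop
  have a0 : A 0 = Γ ta := by simp [hA]
  have b0 : B 0 = Γ ta := by simp [hB]
  have a1 : A 1 = Γ tb := by simp [hA, hΓb]
  have b1 : B 1 = Γ tb := by
    rw [← hΓb]; simp only [hB]; rw [← h.per]; congr 1; ring
  have hd : ∀ u ∈ Icc (0:ℝ) 1, ∀ v ∈ Icc (0:ℝ) 1, (u ∈ Ioo (0:ℝ) 1 ∨ v ∈ Ioo (0:ℝ) 1) →
      A u ≠ B v := by
    intro u hu v hv huv hc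
    obtain ⟨n, hn⟩ := h.inj _ _ hc
    have e : β * u + (σ - β) * v = n * σ := by linarith
    have p1 : 0 < β * u + (σ - β) * v := by
      have q1 := mul_nonneg hβ0.le hu.1
      have q2 := mul_nonneg (sub_nonneg.2 hβ.2.le) hv.1
      rcases huv with k | k
      · linarith [mul_pos hβ0 k.1]
      · linarith [mul_pos (sub_pos.2 hβ.2) k.1]
    have p2 : β * u + (σ - β) * v < σ := by
      have q1 := mul_nonneg hβ0.le (sub_nonneg.2 hu.2)
      have q2 := mul_nonneg (sub_nonneg.2 hβ.2.le) (sub_nonneg.2 hv.2)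
      rcases huv with k | k
      · linarith [mul_pos hβ0 (sub_pos.2 k.2)]
      · linarith [mul_pos (sub_pos.2 hβ.2) (sub_pos.2 k.2)]
    rw [e] at p1 p2
    have i1 : (0:ℝ) < n := by
      by_contra hc; push Not at hc; nlinarith
    have i2 : (n:ℝ) < 1 := by
      by_contra hc; push Not at hc; nlinarith
    have j1 : 0 < n := by exact_mod_cast i1
    have j2 : n < 1 := by exact_mod_cast i2
    omega
  have hcover : ∀ t, (∃ u ∈ Icc (0:ℝ) 1, A u = Γ t) ∨ (∃ u ∈ Icc (0:ℝ) 1, B u = Γ t) := by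
    intro t
    obtain ⟨r, hr, n, hn⟩ := exists_mod hσ (t - ta)
    have et : t = (ta + r) + n * σ := by linarith
    rw [et, h.per_int]
    rcases le_total r β with k | k
    · left
      refine ⟨r / β, ⟨div_nonneg hr.1 hβ0.le, (div_le_one hβ0).2 k⟩, ?_⟩
      simp only [hA]; congr 1; field_simp
    · right
      have hp : 0 < σ - β := sub_pos.2 hβ.2
      refine ⟨(σ - r) / (σ - β), ⟨div_nonneg (sub_nonneg.2 hr.2.le) hp.le,
        (div_le_one hp).2 (by linarith)⟩, ?_⟩
      simp only [hB]
      rw [mul_div_cancel₀ _ hp.ne', ← h.per]; congr 1; ring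
  -- the middle line
  set x0 : ℝ := ((Γ ta).re + (Γ tb).re) / 2 with hx0
  have hx0m : x0 ∈ Ioo (Γ ta).re (Γ tb).re := ⟨by linarith, by linarith⟩
  have top : ∀ C : ℝ → ℂ, Continuous C → C 0 = Γ ta → C 1 = Γ tb →
      ∃ u ∈ Icc (0:ℝ) 1, (C u).re = x0 ∧ ∀ v ∈ Icc (0:ℝ) 1, (C v).re = x0 → (C v).im ≤ (C u).im := by
    intro C hC c0 c1
    have ivt := intermediate_value_Icc (zero_le_one (α := ℝ)) (f := fun u => (C u).re)
      (Complex.continuous_re.comp hC).continuousOn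
    obtain ⟨u0, hu0, hu0'⟩ := ivt (show x0 ∈ Icc (C 0).re (C 1).re by
      rw [c0, c1]; exact ⟨hx0m.1.le, hx0m.2.le⟩)
    have hcomp : IsCompact (Icc (0:ℝ) 1 ∩ {u | (C u).re = x0}) :=
      isCompact_Icc.inter_right (isClosed_eq (Complex.continuous_re.comp hC) continuous_const)
    obtain ⟨u, ⟨hu, hux⟩, humax⟩ := hcomp.exists_isMaxOn ⟨u0, hu0, hu0'⟩
      (f := fun u => (C u).im) (Complex.continuous_im.comp hC).continuousOn
    exact ⟨u, hu, hux, fun v hv hvx => humax ⟨hv, hvx⟩⟩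
  obtain ⟨uA, huA, huAx, huAm⟩ := top A cA a0 a1
  obtain ⟨uB, huB, huBx, huBm⟩ := top B cB b0 b1
  have fin : ∀ z0 : ℂ, (∀ u ∈ Icc (0:ℝ) 1, A u ≠ z0) → (∀ u ∈ Icc (0:ℝ) 1, B u ≠ z0) →
      (∀ LA LB : ℝ → ℂ, Continuous LA → Continuous LB →
        (∀ u ∈ Icc (0:ℝ) 1, Complex.exp (LA u) = A u - z0) →
        (∀ u ∈ Icc (0:ℝ) 1, Complex.exp (LB u) = B u - z0) → LA 0 = LB 0 → LA 1 ≠ LB 1) →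
      ∃ z0 : ℂ, (∀ t, Γ t ≠ z0) ∧ ∀ L : ℝ → ℂ, Continuous L →
      (∀ t, Complex.exp (L t) = Γ t - z0) → L σ ≠ L 0 := by
    intro z0 k1 k2 k3
    refine ⟨z0, ?_, ?_⟩
    · intro t
      rcases hcover t with ⟨u, hu, e⟩ | ⟨u, hu, e⟩
      · rw [← e]; exact k1 u hu
      · rw [← e]; exact k2 u hu
    · intro L hL hLe hc
      have := k3 (fun u => L (ta + β * u)) (fun u => L (ta - (σ - β) * u)) (by fun_prop)
        (by fun_prop) (fun u _ => hLe _) (fun u _ => hLe _) (by simp)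
      apply this
      have e := h.log_per hL hLe 0 (ta - (σ - β))
      rw [zero_add, hc, sub_self] at e
      simp only [mul_one]
      rw [← sub_eq_zero.1 e.symm]; congr 1; ring
  rcases le_total (B uB).im (A uA).im with k | k
  · obtain ⟨z0, k1, k2, k3⟩ := two_arcs cA cB (by rw [a0, b0]) (by rw [a1, b1]) (by rw [a0, a1]; exact hlt)
      (fun u _ => by rw [a0]; exact hmin _) (fun u _ => by rw [a1]; exact hmax _)
      (fun u hu v hv => hd u ⟨hu.1.le, hu.2.le⟩ v hv (Or.inl hu)) (x0 := x0)
      (by rw [a0, a1]; exact hx0m) huA huAx (fun v hv hvx => (huBm v hv hvx).trans k)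
    exact fin z0 k1 k2 k3
  · obtain ⟨z0, k1, k2, k3⟩ := two_arcs cB cA (by rw [a0, b0]) (by rw [a1, b1]) (by rw [b0, b1]; exact hlt)
      (fun u _ => by rw [b0]; exact hmin _) (fun u _ => by rw [b1]; exact hmax _)
      (fun u hu v hv hc => hd v hv u ⟨hu.1.le, hu.2.le⟩ (Or.inr hu) hc.symm) (x0 := x0)
      (by rw [b0, b1]; exact hx0m) huB huBx (fun v hv hvx => (huAm v hv hvx).trans k)
    exact fin z0 k2 k1 (fun LA LB c1 c2 e1 e2 e3 e4 => k3 LB LA c2 c1 e2 e1 e3.symm e4.symm)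

theorem IsLoop.exists_winding {Γ : ℝ → ℂ} {σ : ℝ} (h : IsLoop Γ σ) :
    ∃ z0 : ℂ, (∀ t, Γ t ≠ z0) ∧ ∀ L : ℝ → ℂ, Continuous L →
      (∀ t, Complex.exp (L t) = Γ t - z0) → L σ ≠ L 0 := by
  by_cases hne : ∃ s t, (Γ s).re ≠ (Γ t).re
  · exact h.exists_winding_aux hne
  · push Not at hne
    have h2 : IsLoop (fun t => Complex.I * Γ t) σ :=
      ⟨by have := h.cont; fun_prop, h.pos, fun t => by simp only [h.per],
        fun s t e => h.inj s t (mul_left_cancel₀ Complex.I_ne_zero e)⟩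
    obtain ⟨z1, k1, k2⟩ := h2.exists_winding_aux (by
      by_contra hc
      push Not at hc
      have e : Γ (σ / 2) = Γ 0 := by
        apply Complex.ext (hne _ _)
        have := hc (σ / 2) 0
        simp at this; exact this
      obtain ⟨n, hn⟩ := h.inj _ _ e
      have hσ := h.pos
      have : (2 * n : ℝ) = 1 := by
        have : σ * (2 * n) = σ * 1 := by linarith
        exact mul_left_cancel₀ hσ.ne' this
      have : (2 * n : ℤ) = 1 := by exact_mod_cast this
      omega)
    have e1 : Complex.I * (-Complex.I * z1) = z1 := by
      rw [← mul_assoc]; simp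
    refine ⟨-Complex.I * z1, fun t ht => k1 t (by rw [ht, e1]), fun L hL hLe hc => ?_⟩
    refine k2 (fun t => L t + (Real.pi / 2 : ℝ) * Complex.I) (by fun_prop) (fun t => ?_) (by rw [hc])
    have e : Complex.exp (((Real.pi / 2 : ℝ) : ℂ) * Complex.I) = Complex.I := by
      simpa using Complex.exp_pi_div_two_mul_I
    rw [Complex.exp_add, e, hLe]
    ring_nf; simp; ring

/-- Points of the bounded components of the complement. -/
def intC (K : Set ℂ) : Set ℂ := {z | z ∈ Kᶜ ∧ IsBounded (connectedComponentIn Kᶜ z)}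

/-- Points of the unbounded components of the complement. -/
def extC (K : Set ℂ) : Set ℂ := {z | z ∈ Kᶜ ∧ ¬ IsBounded (connectedComponentIn Kᶜ z)}

theorem IsLoop.descend {Γ : ℝ → ℂ} {σ : ℝ} (h : IsLoop Γ σ) {g : ℝ → ℂ} (hg : Continuous g)
    (hper : ∀ t, g (t + σ) = g t) : ∃ f : ℂ → ℂ, Continuous f ∧ ∀ t, f (Γ t) = g t := by
  have hσ := h.pos
  let G : Icc (0:ℝ) σ → range Γ := fun t => ⟨Γ t, t, rfl⟩
  have hG : Continuous G := Continuous.subtype_mk (h.cont.comp continuous_subtype_val) _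
  have hGs : Function.Surjective G := by
    rintro ⟨y, hy⟩
    rw [h.range_eq] at hy
    obtain ⟨t, ht, rfl⟩ := hy
    exact ⟨⟨t, ht⟩, rfl⟩
  have hq : IsQuotientMap G := hG.isClosedMap.isQuotientMap hG hGs
  have gint : ∀ t (n : ℤ), g (t + n * σ) = g t := fun t n =>
    (show Function.Periodic g σ from hper).int_mul n t
  have hgc : ∀ s t, Γ s = Γ t → g s = g t := by
    intro s t e
    obtain ⟨n, rfl⟩ := h.inj s t e
    exact gint t n
  let f0 : range Γ → ℂ := fun y => g y.2.choose
  have hf0 : ∀ t (ht : Γ t ∈ range Γ), f0 ⟨Γ t, ht⟩ = g t := by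
    intro t ht
    exact hgc _ _ ht.choose_spec
  have hf0c : Continuous f0 := by
    rw [hq.continuous_iff]
    have : f0 ∘ G = fun t : Icc (0:ℝ) σ => g t := by
      funext t; exact hf0 _ _
    rw [this]; exact hg.comp continuous_subtype_val
  obtain ⟨F, hF⟩ := ContinuousMap.exists_restrict_eq (h.isCompact.isClosed) (⟨f0, hf0c⟩ : C(range Γ, ℂ))
  refine ⟨F, F.continuous, fun t => ?_⟩
  have := DFunLike.congr_fun hF ⟨Γ t, t, rfl⟩
  rw [← hf0 t ⟨t, rfl⟩]
  exact this

theorem component_frontier {K : Set ℂ} (hK : IsClosed K) (z : ℂ) :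
    frontier (connectedComponentIn Kᶜ z) ⊆ K := by
  intro x hx
  by_contra hxK
  have hop : ∀ y, IsOpen (connectedComponentIn Kᶜ y) := fun y => hK.isOpen_compl.connectedComponentIn
  have hxm : x ∈ connectedComponentIn Kᶜ x := mem_connectedComponentIn hxK
  have hcl : x ∈ closure (connectedComponentIn Kᶜ z) := frontier_subset_closure hx
  obtain ⟨y, hy1, hy2⟩ := mem_closure_iff.1 hcl _ (hop x) hxm
  have e1 := connectedComponentIn_eq hy1
  have e2 := connectedComponentIn_eq hy2
  rw [← e2] at e1
  rw [e1] at hxm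
  rw [frontier, (hop z).interior_eq] at hx
  exact hx.2 hxm

theorem component_union_closed {K : Set ℂ} (hK : IsClosed K) (z : ℂ) :
    IsClosed (connectedComponentIn Kᶜ z ∪ K) := by
  have : connectedComponentIn Kᶜ z ∪ K = closure (connectedComponentIn Kᶜ z) ∪ K := by
    apply Subset.antisymm
    · exact union_subset_union_left _ subset_closure
    · rintro x (hx | hx)
      · rw [closure_eq_self_union_frontier] at hx
        rcases hx with hx | hx
        · exact Or.inl hx
        · exact Or.inr (component_frontier hK z hx)
      · exact Or.inr hx
  rw [this]
  exact isClosed_closure.union hK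

theorem eilenberg {K : Set ℂ} (hK : IsCompact K) {z1 z2 : ℂ} (h1 : z1 ∈ intC K)
    (h2 : z2 ∉ connectedComponentIn Kᶜ z1) (h2K : z2 ∉ K) (a b : ℤ) {f : ℂ → ℂ}
    (hf : Continuous f) (hfe : ∀ y ∈ K, Complex.exp (f y) = (y - z1) ^ a * (y - z2) ^ b) : a = 0 := by
  classical
  set U := connectedComponentIn Kᶜ z1 with hU
  have hUo : IsOpen U := hK.isClosed.isOpen_compl.connectedComponentIn
  have hz1U : z1 ∈ U := mem_connectedComponentIn h1.1
  set F : ℂ → ℂ := fun y => (y - z1) ^ a * (y - z2) ^ b with hF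
  set h : ℂ → ℂ := U.piecewise (fun y => Complex.exp (f y)) F with hh
  have hc2 : z2 - z1 ≠ 0 := by
    intro e; rw [sub_eq_zero] at e; rw [e] at h2; exact h2 hz1U
  have hhc : ContinuousOn h {z2}ᶜ := by
    apply ContinuousOn.piecewise
    · rintro y ⟨-, hy⟩
      exact hfe y (component_frontier hK.isClosed z1 hy)
    · exact (Complex.continuous_exp.comp hf).continuousOn
    · intro y ⟨hy1, hy2⟩
      rw [hUo.isClosed_compl.closure_eq] at hy2
      have n1 : y - z1 ≠ 0 := by
        intro e; rw [sub_eq_zero] at e; rw [e] at hy2; exact hy2 hz1U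
      have n2 : y - z2 ≠ 0 := fun e => hy1 (sub_eq_zero.1 e)
      have c1 : ContinuousAt (fun y => (y - z1) ^ a) y :=
        ContinuousAt.zpow₀ (by fun_prop) a (Or.inl n1)
      have c2 : ContinuousAt (fun y => (y - z2) ^ b) y :=
        ContinuousAt.zpow₀ (by fun_prop) b (Or.inl n2)
      exact (c1.mul c2).continuousWithinAt
  have hh0 : ∀ y, y ≠ z2 → h y ≠ 0 := by
    intro y hy
    by_cases hyU : y ∈ U
    · rw [hh, piecewise_eq_of_mem _ _ _ hyU]; exact Complex.exp_ne_zero _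
    · rw [hh, piecewise_eq_of_notMem _ _ _ hyU]
      have n1 : y - z1 ≠ 0 := by
        intro e; rw [sub_eq_zero] at e; rw [e] at hyU; exact hyU hz1U
      exact mul_ne_zero (zpow_ne_zero _ n1) (zpow_ne_zero _ (sub_ne_zero.2 hy))
  have hne : ∀ ζ : ℂ, z2 + Complex.exp ζ ≠ z2 := by
    intro ζ e; exact Complex.exp_ne_zero ζ (by simpa using e)
  obtain ⟨M, hM, hMe⟩ := exists_log_lift' (fun ζ : ℂ => h (z2 + Complex.exp ζ))
    (hhc.comp_continuous (by fun_prop) (fun ζ => hne ζ)) (fun ζ => hh0 _ (hne ζ))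
  set p : ℂ := 2 * Real.pi * Complex.I with hp
  have hexp : ∀ ζ, Complex.exp (ζ + p) = Complex.exp ζ := fun ζ => Complex.exp_periodic ζ
  have hconst : ∀ ζ ζ' : ℂ, M (ζ + p) - M ζ = M (ζ' + p) - M ζ' := fun ζ ζ' =>
    log_diff_const isPreconnected_univ (g := fun ζ => M (ζ + p)) (h := M) (by fun_prop)
      hM.continuousOn (fun u _ => by rw [hMe, hMe, hexp]) (mem_univ _) (mem_univ _)
  set c := z2 - z1 with hc
  have hline : ∀ x : ℝ, ∀ N : ℂ → ℂ, (∀ θ : ℝ, ContinuousAt N (x + θ * Complex.I)) →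
      (∀ θ : ℝ, Complex.exp (M (x + θ * Complex.I)) = Complex.exp (N (x + θ * Complex.I))) →
      M (x + p) - M x = N (x + p) - N x := by
    intro x N hN he
    have cN : Continuous fun θ : ℝ => N (x + θ * Complex.I) := by
      rw [continuous_iff_continuousAt]
      intro θ
      exact ContinuousAt.comp (f := fun θ : ℝ => (x + θ * Complex.I : ℂ)) (hN θ) (by fun_prop)
    have := log_diff_const isPreconnected_univ (g := fun θ : ℝ => M (x + θ * Complex.I))
      (h := fun θ : ℝ => N (x + θ * Complex.I)) (by fun_prop)
      cN.continuousOn (fun u _ => he u) (mem_univ (2 * Real.pi)) (mem_univ 0)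
    simp at this
    rw [hp]; linear_combination this
  have slit : ∀ w : ℂ, ‖w‖ < 1 → 1 + w ∈ Complex.slitPlane := fun w hw =>
    Complex.mem_slitPlane_of_norm_lt_one hw
  have hval : ∀ ζ, z2 + Complex.exp ζ ∉ U → Complex.exp (M ζ) =
      (Complex.exp ζ + c) ^ a * Complex.exp ζ ^ b := by
    intro ζ hζ
    rw [hMe, hh, piecewise_eq_of_notMem _ _ _ hζ, hF]
    simp only
    congr 2
    · rw [hc]; ring
    · ring
  have hnorm : ∀ x θ : ℝ, ‖Complex.exp (x + θ * Complex.I)‖ = Real.exp x := by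
    intro x θ; rw [Complex.norm_exp]; simp
  -- small circle
  have hsmall : M (0 + p) - M 0 = b * p := by
    have hop : IsOpen (U ∪ K)ᶜ := (component_union_closed hK.isClosed z1).isOpen_compl
    obtain ⟨r, hr, hrU⟩ := Metric.isOpen_iff.1 hop z2 (by simp [h2, h2K])
    obtain ⟨x, hx⟩ : ∃ x : ℝ, Real.exp x < min r ‖c‖ := by
      have := Real.tendsto_exp_atBot.eventually (gt_mem_nhds (lt_min hr (norm_pos_iff.2 hc2)))
      exact this.exists
    rw [hconst 0 x]
    have sm : ∀ θ : ℝ, ‖Complex.exp (x + θ * Complex.I) / c‖ < 1 := by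
      intro θ
      rw [norm_div, hnorm, div_lt_one (norm_pos_iff.2 hc2)]
      exact hx.trans_le (min_le_right _ _)
    rw [hline x (fun ζ => a * (Complex.log (1 + Complex.exp ζ / c) + Complex.log c) + b * ζ)]
    · rw [hexp]; ring
    · intro θ
      have := slit _ (sm θ)
      have : ContinuousAt (fun ζ : ℂ => Complex.log (1 + Complex.exp ζ / c)) (x + θ * Complex.I) :=
        ContinuousAt.clog (by fun_prop) this
      fun_prop
    · intro θ
      rw [hval _ ?_]
      · have smθ := sm θ
        generalize ((x:ℂ) + θ * Complex.I) = ζ at smθ ⊢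
        rw [Complex.exp_add, Complex.exp_int_mul, Complex.exp_int_mul, Complex.exp_add,
          Complex.exp_log (Complex.slitPlane_ne_zero (slit _ smθ)), Complex.exp_log hc2]
        congr 2
        field_simp; ring
      · intro hmem
        have : z2 + Complex.exp (x + θ * Complex.I) ∈ Metric.ball z2 r := by
          rw [Metric.mem_ball, dist_eq_norm]
          rw [add_sub_cancel_left, hnorm]
          exact hx.trans_le (min_le_left _ _)
        exact hrU this (Or.inl hmem)
  -- large circle
  have hlarge : M (0 + p) - M 0 = (a + b) * p := by
    obtain ⟨R, hR⟩ := h1.2.subset_closedBall z2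
    obtain ⟨x, hx⟩ : ∃ x : ℝ, max R ‖c‖ < Real.exp x :=
      (Real.tendsto_exp_atTop.eventually (eventually_gt_atTop _)).exists
    rw [hconst 0 x]
    have sm : ∀ θ : ℝ, ‖c * Complex.exp (-(x + θ * Complex.I))‖ < 1 := by
      intro θ
      rw [Complex.exp_neg, norm_mul, norm_inv, hnorm, ← div_eq_mul_inv, div_lt_one (Real.exp_pos _)]
      exact (le_max_right _ _).trans_lt hx
    rw [hline x (fun ζ => a * (Complex.log (1 + c * Complex.exp (-ζ))) + (a + b) * ζ)]
    · have : Complex.exp (-((x:ℂ) + p)) = Complex.exp (-(x:ℂ)) := by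
        rw [Complex.exp_neg, hexp, Complex.exp_neg]
      rw [this]; ring
    · intro θ
      have := slit _ (sm θ)
      have : ContinuousAt (fun ζ : ℂ => Complex.log (1 + c * Complex.exp (-ζ))) (x + θ * Complex.I) :=
        ContinuousAt.clog (by fun_prop) this
      fun_prop
    · intro θ
      rw [hval _ ?_]
      · have smθ := sm θ
        generalize ((x:ℂ) + θ * Complex.I) = ζ at smθ ⊢
        rw [show ∀ w ζ : ℂ, (a:ℂ) * w + (a + b) * ζ = a * (w + ζ) + b * ζ by intros; ring]
        rw [Complex.exp_add, Complex.exp_int_mul, Complex.exp_int_mul, Complex.exp_add,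
          Complex.exp_log (Complex.slitPlane_ne_zero (slit _ smθ))]
        congr 2
        rw [Complex.exp_neg, add_mul, mul_assoc, inv_mul_cancel₀ (Complex.exp_ne_zero _)]; ring
      · intro hmem
        have := hR hmem
        rw [Metric.mem_closedBall, dist_eq_norm, add_sub_cancel_left, hnorm] at this
        linarith [le_max_left R ‖c‖]
  have hp0 : p ≠ 0 := Complex.two_pi_I_ne_zero
  have : (a : ℂ) * p = 0 := by
    rw [hsmall] at hlarge
    linear_combination -hlarge
  rcases mul_eq_zero.1 this with h | h
  · exact_mod_cast h
  · exact absurd h hp0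

theorem far_notMem {K : Set ℂ} (hK : IsCompact K) (z : ℂ) (hz : z ∈ intC K) :
    ∃ z2, z2 ∉ connectedComponentIn Kᶜ z ∧ z2 ∉ K := by
  have hb := hz.2.union hK.isBounded
  obtain ⟨R, hR⟩ := hb.subset_closedBall 0
  refine ⟨((|R| + 1 : ℝ) : ℂ), ?_⟩
  have : ((|R| + 1 : ℝ) : ℂ) ∉ connectedComponentIn Kᶜ z ∪ K := by
    intro hm
    have := hR hm
    rw [Metric.mem_closedBall, dist_zero_right, Complex.norm_real, Real.norm_eq_abs,
      abs_of_pos (by positivity)] at this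
    linarith [le_abs_self R]
  exact ⟨fun h => this (Or.inl h), fun h => this (Or.inr h)⟩

/-- Paths inside a connected component. -/
theorem component_path {K : Set ℂ} (hK : IsClosed K) {z z' : ℂ}
    (h : z' ∈ connectedComponentIn Kᶜ z) : ∃ Z : ℝ → ℂ, Continuous Z ∧ Z 0 = z ∧ Z 1 = z' ∧
      ∀ v, Z v ∈ connectedComponentIn Kᶜ z := by
  have hz : z ∈ Kᶜ := connectedComponentIn_nonempty_iff.1 ⟨z', h⟩
  have hc : IsConnected (connectedComponentIn Kᶜ z) := isConnected_connectedComponentIn_iff.2 hz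
  have hp := (hK.isOpen_compl.connectedComponentIn (x := z)).isConnected_iff_isPathConnected.1 hc
  obtain ⟨P, hP⟩ := hp.joinedIn z (mem_connectedComponentIn hz) z' h
  refine ⟨P.extend, P.continuous_extend, by simp, by simp, fun v => ?_⟩
  exact hP (projIcc 0 1 zero_le_one v)

theorem IsLoop.wind_invariant {Γ : ℝ → ℂ} {σ : ℝ} (h : IsLoop Γ σ) {z z' : ℂ}
    (hzz : z' ∈ connectedComponentIn (range Γ)ᶜ z) {L L' : ℝ → ℂ} (hL : Continuous L)
    (hL' : Continuous L') (hLe : ∀ t, Complex.exp (L t) = Γ t - z)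
    (hLe' : ∀ t, Complex.exp (L' t) = Γ t - z') : L σ - L 0 = L' σ - L' 0 := by
  obtain ⟨Z, hZ, Z0, Z1, hZm⟩ := component_path h.isCompact.isClosed hzz
  have cΓ := h.cont
  have hne : ∀ t v, Γ t - Z v ≠ 0 := fun t v e =>
    connectedComponentIn_subset _ _ (hZm v) ⟨t, sub_eq_zero.1 e⟩
  obtain ⟨M, hM, hMe⟩ := exists_log_lift' (fun q : ℝ × ℝ => Γ q.1 - Z q.2) (by fun_prop)
    (fun q => hne q.1 q.2)
  have e1 := log_diff_const isPreconnected_univ (g := fun v : ℝ => M (σ, v))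
    (h := fun v : ℝ => M (0, v)) (by fun_prop) (by fun_prop)
    (fun v _ => by rw [hMe, hMe]; simp only; rw [← zero_add σ, h.per]) (mem_univ (0:ℝ)) (mem_univ (1:ℝ))
  have e2 := log_diff_const isPreconnected_univ (g := fun t : ℝ => M (t, 0))
    (h := L) (by fun_prop) (by fun_prop)
    (fun v _ => by rw [hMe, hLe]; simp only [Z0]) (mem_univ (0:ℝ)) (mem_univ σ)
  have e3 := log_diff_const isPreconnected_univ (g := fun t : ℝ => M (t, 1))
    (h := L') (by fun_prop) (by fun_prop)
    (fun v _ => by rw [hMe, hLe']; simp only [Z1]) (mem_univ (0:ℝ)) (mem_univ σ)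
  linear_combination e1 + e2 - e3

theorem wind_int {Γ : ℝ → ℂ} {σ : ℝ} (h : IsLoop Γ σ) {z : ℂ} {L : ℝ → ℂ}
    (hLe : ∀ t, Complex.exp (L t) = Γ t - z) : ∃ n : ℤ, L σ - L 0 = n * (2 * Real.pi * Complex.I) := by
  rw [← Complex.exp_eq_one_iff, Complex.exp_sub, hLe, hLe, ← zero_add σ, h.per, div_self]
  rw [← hLe]; exact Complex.exp_ne_zero _

theorem IsLoop.exists_log {Γ : ℝ → ℂ} {σ : ℝ} (h : IsLoop Γ σ) {z : ℂ} (hz : z ∉ range Γ) :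
    ∃ L : ℝ → ℂ, Continuous L ∧ (∀ t, Complex.exp (L t) = Γ t - z) :=
  exists_log_lift' (fun t => Γ t - z) (by have := h.cont; fun_prop)
    (fun t e => hz ⟨t, sub_eq_zero.1 e⟩)

theorem IsLoop.wind_ne {Γ : ℝ → ℂ} {σ : ℝ} (h : IsLoop Γ σ) {z : ℂ} (hz : z ∈ intC (range Γ))
    {L : ℝ → ℂ} (hL : Continuous L) (hLe : ∀ t, Complex.exp (L t) = Γ t - z) : L σ ≠ L 0 := by
  intro e
  obtain ⟨f, hf, hfe⟩ := h.descend hL (fun t => by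
    have := h.log_per hL hLe t 0
    rw [zero_add, e, sub_self] at this
    exact sub_eq_zero.1 this)
  obtain ⟨z2, k1, k2⟩ := far_notMem h.isCompact z hz
  have := eilenberg h.isCompact hz k1 k2 1 0 hf (by
    rintro _ ⟨t, rfl⟩
    rw [hfe, hLe]; simp)
  omega

theorem IsLoop.int_connected {Γ : ℝ → ℂ} {σ : ℝ} (h : IsLoop Γ σ) {z1 z2 : ℂ}
    (h1 : z1 ∈ intC (range Γ)) (h2 : z2 ∈ intC (range Γ)) :
    z2 ∈ connectedComponentIn (range Γ)ᶜ z1 := by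
  by_contra hc
  obtain ⟨L1, c1, e1⟩ := h.exists_log h1.1
  obtain ⟨L2, c2, e2⟩ := h.exists_log h2.1
  obtain ⟨n1, w1⟩ := wind_int h e1
  obtain ⟨n2, w2⟩ := wind_int h e2
  have ne2 := h.wind_ne h2 c2 e2
  obtain ⟨f, hf, hfe⟩ := h.descend (g := fun t => n2 * L1 t + (-n1 : ℤ) * L2 t) (by fun_prop) (fun t => by
    have p1 := h.log_per c1 e1 t 0
    have p2 := h.log_per c2 e2 t 0
    rw [zero_add, w1] at p1
    rw [zero_add, w2] at p2
    push_cast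
    linear_combination (n2:ℂ) * p1 - n1 * p2)
  have := eilenberg h.isCompact h1 hc h2.1 n2 (-n1) hf (by
    rintro _ ⟨t, rfl⟩
    rw [hfe, Complex.exp_add, Complex.exp_int_mul, Complex.exp_int_mul, e1, e2])
  rw [this] at w2
  simp at w2
  exact ne2 (sub_eq_zero.1 w2)

theorem IsLoop.exists_int {Γ : ℝ → ℂ} {σ : ℝ} (h : IsLoop Γ σ) : ∃ z0, z0 ∈ intC (range Γ) := by
  obtain ⟨z0, k1, k2⟩ := h.exists_winding
  have hz0 : z0 ∉ range Γ := fun ⟨t, ht⟩ => k1 t ht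
  refine ⟨z0, hz0, ?_⟩
  by_contra hb
  obtain ⟨L, hL, hLe⟩ := h.exists_log hz0
  obtain ⟨R, hR⟩ := h.isCompact.isBounded.subset_closedBall 0
  obtain ⟨z, hz, hzR⟩ : ∃ z ∈ connectedComponentIn (range Γ)ᶜ z0, |R| < ‖z‖ := by
    by_contra hc
    push Not at hc
    apply hb
    refine (Metric.isBounded_closedBall (x := (0:ℂ)) (r := |R|)).subset fun z hz => ?_
    simpa using hc z hz
  have hz0' : z ≠ 0 := by
    rintro rfl; simp at hzR; linarith [abs_nonneg R]
  have sl : ∀ t, 1 + -(Γ t / z) ∈ Complex.slitPlane := by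
    intro t
    apply Complex.mem_slitPlane_of_norm_lt_one
    rw [norm_neg, norm_div, div_lt_one (norm_pos_iff.2 hz0')]
    have := hR ⟨t, rfl⟩
    rw [Metric.mem_closedBall, dist_zero_right] at this
    exact (this.trans (le_abs_self R)).trans_lt hzR
  have cΓ := h.cont
  have := h.wind_invariant hz hL (L' := fun t => Complex.log (1 + -(Γ t / z)) + Complex.log (-z))
    (by
      refine Continuous.add (Continuous.clog (by fun_prop) sl) continuous_const) hLe (fun t => by
      rw [Complex.exp_add, Complex.exp_log (Complex.slitPlane_ne_zero (sl t)),
        Complex.exp_log (neg_ne_zero.2 hz0')]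
      field_simp; ring)
  rw [← zero_add σ, h.per, sub_self, zero_add] at this
  exact k2 L hL hLe (sub_eq_zero.1 this)

/-- An injective semiflow on the plane. -/
structure IsPlaneFlow (ψ : ℝ → ℂ → ℂ) : Prop where
  zero : ∀ z, ψ 0 z = z
  add : ∀ t s, 0 ≤ t → 0 ≤ s → ∀ z, ψ (t + s) z = ψ t (ψ s z)
  cont : Continuous fun q : ℝ × ℂ => ψ q.1 q.2
  inj : ∀ t, 0 ≤ t → Function.Injective (ψ t)

/-- A periodic orbit of a plane flow with a reference point inside and a logarithm. -/
structure IsSetup (ψ : ℝ → ℂ → ℂ) (Γ : ℝ → ℂ) (σ : ℝ) (z0 : ℂ) (LΓ : ℝ → ℂ) (n : ℤ) : Prop where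
  flow : IsPlaneFlow ψ
  loop : IsLoop Γ σ
  inv : ∀ t, 0 ≤ t → ∀ s, ψ t (Γ s) = Γ (s + t)
  hz0 : z0 ∉ range Γ
  contL : Continuous LΓ
  expL : ∀ t, Complex.exp (LΓ t) = Γ t - z0
  hn : n ≠ 0
  perL : ∀ t, LΓ (t + σ) = LΓ t + n * (2 * Real.pi * Complex.I)

theorem IsPlaneFlow.tube {ψ : ℝ → ℂ → ℂ} (hψ : IsPlaneFlow ψ) {K : Set ℂ} (hK : IsCompact K)
    (T : ℝ) {r : ℝ} (hr : 0 < r) : ∃ η > 0, ∀ k ∈ K, ∀ z, dist z k < η → ∀ a ∈ Icc 0 T,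
      dist (ψ a z) (ψ a k) < r := by
  have := (isCompact_Icc (a := (0:ℝ)) (b := T)).prod hK |>.uniformContinuousAt_of_continuousAt
    (fun q : ℝ × ℂ => ψ q.1 q.2) (fun a _ => hψ.cont.continuousAt) (Metric.dist_mem_uniformity hr)
  obtain ⟨η, hη, h⟩ := Metric.mem_uniformity_dist.1 this
  refine ⟨η, hη, fun k hk z hz a ha => ?_⟩
  have := @h (a, k) (a, z) (by
    rw [Prod.dist_eq]; simp only [dist_self]; rw [dist_comm]; exact max_lt hη hz)
  have h2 := this ⟨ha, hk⟩
  rw [dist_comm]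
  exact h2

section PlaneSetup
variable {ψ : ℝ → ℂ → ℂ} {Γ : ℝ → ℂ} {σ : ℝ} {z0 : ℂ} {LΓ : ℝ → ℂ} {n : ℤ}

theorem IsSetup.infDist_pos (S : IsSetup ψ Γ σ z0 LΓ n) : 0 < Metric.infDist z0 (range Γ) :=
  (S.loop.isCompact.isClosed.notMem_iff_infDist_pos ⟨Γ 0, 0, rfl⟩).1 S.hz0

theorem IsSetup.near (S : IsSetup ψ Γ σ z0 LΓ n) {z : ℂ} {r : ℝ}
    (h : Metric.infDist z (range Γ) < r) : ∃ θ ∈ Icc 0 σ, dist z (Γ θ) < r := by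
  obtain ⟨y, hy, hd⟩ := (Metric.infDist_lt_iff (range_nonempty Γ)).1 h
  rw [S.loop.range_eq] at hy
  obtain ⟨θ, hθ, rfl⟩ := hy
  exact ⟨θ, hθ, hd⟩

/-- If `‖z - w‖ < r0/2` then the quotient has small argument. -/
theorem ratio_slit {z w z0 : ℂ} {r0 : ℝ} (hw : r0 ≤ dist z0 w) (hr : 0 < r0)
    (h : dist z w < r0) : (z - z0) / (w - z0) ∈ ({ζ : ℂ | 0 < ζ.re} : Set ℂ) := by
  have hne : w - z0 ≠ 0 := by
    rw [sub_ne_zero]; rintro rfl; simp at hw; linarith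
  have e : (z - z0) / (w - z0) = 1 + (z - w) / (w - z0) := by field_simp; ring
  rw [mem_setOf_eq, e]
  have : ‖(z - w) / (w - z0)‖ < 1 := by
    rw [norm_div, div_lt_one (norm_pos_iff.2 hne), ← dist_eq_norm, ← dist_eq_norm, dist_comm w]
    exact h.trans_le hw
  have h2 := (abs_le.1 (Complex.abs_re_le_norm ((z - w) / (w - z0)))).1
  simp only [Complex.add_re, Complex.one_re]; linarith

theorem IsSetup.growth (S : IsSetup ψ Γ σ z0 LΓ n) : ∃ η0 > 0, ∃ B1 : ℝ, ∀ k : ℕ, ∀ z : ℂ, ∀ T : ℝ,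
    T ≤ (k + 1) * σ → (∀ t ∈ Icc 0 T, Metric.infDist (ψ t z) (range Γ) < η0) →
    ∀ Ly : ℝ → ℂ, ContinuousOn Ly (Icc 0 T) → (∀ t ∈ Icc 0 T, Complex.exp (Ly t) = ψ t z - z0) →
    0 ≤ T →
      (Real.pi * n ^ 2) * (T / σ - 1) - B1 ≤ n * (Ly T - Ly 0).im := by
  have hσ := S.loop.pos
  have hπ := Real.pi_pos
  set r0 := Metric.infDist z0 (range Γ) with hr0
  have hr0p : 0 < r0 := S.infDist_pos
  obtain ⟨η0, hη0, htube⟩ := S.flow.tube S.loop.isCompact σ hr0p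
  have cL := S.contL
  obtain ⟨B0, hB0⟩ := ((isCompact_Icc (a := (0:ℝ)) (b := σ)).prod
    (isCompact_Icc (a := (0:ℝ)) (b := σ))).bddBelow_image
    (f := fun q : ℝ × ℝ => (n:ℝ) * (LΓ (q.1 + q.2) - LΓ q.1).im)
    (by apply Continuous.continuousOn; fun_prop)
  have hn1 : (1:ℝ) ≤ |(n:ℝ)| := by
    have := Int.one_le_abs S.hn
    have h2 : ((1:ℤ):ℝ) ≤ ((|n| : ℤ) : ℝ) := by exact_mod_cast this
    simpa using h2
  have hsq : (n:ℝ)^2 = |(n:ℝ)| ^ 2 := (sq_abs _).symm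
  have hg : ∀ (w : ℂ), 0 < w.re → |Complex.arg w| < Real.pi / 2 := fun w hw =>
    Complex.abs_arg_lt_pi_div_two_iff.2 (Or.inl hw)
  -- one period comparison
  have one : ∀ z : ℂ, Metric.infDist z (range Γ) < η0 → ∃ θ ∈ Icc 0 σ, ∀ a ∈ Icc 0 σ,
      ∀ Ly : ℝ → ℂ, ContinuousOn Ly (Icc 0 a) →
      (∀ t ∈ Icc 0 a, Complex.exp (Ly t) = ψ t z - z0) →
      n * (LΓ (θ + a) - LΓ θ).im - |(n:ℝ)| * Real.pi ≤ n * (Ly a - Ly 0).im := by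
    intro z hz
    obtain ⟨θ, hθ, hd⟩ := S.near hz
    refine ⟨θ, hθ, fun a ha Ly hLy hLe => ?_⟩
    have cΓ := S.loop.cont
    have hrat : ∀ t ∈ Icc 0 a, 0 < ((ψ t z - z0) / (Γ (θ + t) - z0)).re := by
      intro t ht
      have := htube _ ⟨θ, rfl⟩ z hd t ⟨ht.1, ht.2.trans ha.2⟩
      rw [S.inv t ht.1] at this
      exact ratio_slit (Metric.infDist_le_dist_of_mem (mem_range_self (θ + t))) hr0p this
    have hne : ∀ t, Γ (θ + t) - z0 ≠ 0 := fun t e => S.hz0 ⟨_, sub_eq_zero.1 e⟩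
    have ψc : Continuous fun t => ψ t z := S.flow.cont.comp (by fun_prop : Continuous fun t : ℝ => (t, z))
    have m0 : (0:ℝ) ∈ Icc 0 a := ⟨le_rfl, ha.1⟩
    have m1 : a ∈ Icc 0 a := ⟨ha.1, le_rfl⟩
    have key := log_diff_const (isPreconnected_Icc (a := (0:ℝ)) (b := a)) hLy
      (h := fun t => LΓ (θ + t) + Complex.log ((ψ t z - z0) / (Γ (θ + t) - z0)))
      (by
        refine ContinuousOn.add (by fun_prop) (ContinuousOn.clog ?_ fun t ht => Or.inl (hrat t ht))
        exact ContinuousOn.div (by fun_prop) (by fun_prop) (fun t _ => hne t))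
      (fun t ht => by
        rw [hLe t ht, Complex.exp_add, S.expL, Complex.exp_log, mul_div_cancel₀ _ (hne t)]
        intro e
        have := hrat t ht
        rw [e] at this; simp at this) m0 m1
    have k0 := abs_lt.1 (hg _ (hrat 0 m0))
    have k1 := abs_lt.1 (hg _ (hrat a m1))
    rw [← Complex.log_im] at k0 k1
    have e := congrArg Complex.im key
    simp only [Complex.sub_im, Complex.add_im, add_zero] at e
    set u0 := (Complex.log ((ψ 0 z - z0) / (Γ θ - z0))).im
    set u1 := (Complex.log ((ψ a z - z0) / (Γ (θ + a) - z0))).im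
    simp only [add_zero] at k0
    have e2 : (Ly a - Ly 0).im = (LΓ (θ + a) - LΓ θ).im + (u1 - u0) := by
      simp only [Complex.sub_im]; linarith
    have h3 : |u1 - u0| ≤ Real.pi := abs_le.2 ⟨by linarith [k0.2, k1.1], by linarith [k0.1, k1.2]⟩
    have h4 : |(n:ℝ) * (u1 - u0)| ≤ |(n:ℝ)| * Real.pi := by
      rw [abs_mul]; exact mul_le_mul_of_nonneg_left h3 (abs_nonneg _)
    rw [e2, mul_add]
    linarith [(abs_le.1 h4).1]
  refine ⟨η0, hη0, |B0| + |(n:ℝ)| * Real.pi, ?_⟩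
  have base : ∀ z : ℂ, ∀ T : ℝ, T ≤ σ →
      (∀ t ∈ Icc 0 T, Metric.infDist (ψ t z) (range Γ) < η0) →
    ∀ Ly : ℝ → ℂ, ContinuousOn Ly (Icc 0 T) → (∀ t ∈ Icc 0 T, Complex.exp (Ly t) = ψ t z - z0) →
    0 ≤ T → (Real.pi * n ^ 2) * (T / σ - 1) - (|B0| + |(n:ℝ)| * Real.pi) ≤ n * (Ly T - Ly 0).im := by
    intro z T hT hd Ly hLy hLe hT0
    have hd0 := hd 0 ⟨le_rfl, hT0⟩
    rw [S.flow.zero] at hd0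
    obtain ⟨θ, hθ, hθa⟩ := one z hd0
    have h1 := hθa T ⟨hT0, hT⟩ Ly hLy hLe
    have h2 : B0 ≤ n * (LΓ (θ + T) - LΓ θ).im := hB0 ⟨(θ, T), ⟨hθ, hT0, hT⟩, rfl⟩
    have h3 : (Real.pi * n ^ 2) * (T / σ - 1) ≤ 0 := by
      apply mul_nonpos_of_nonneg_of_nonpos (by positivity)
      rw [sub_nonpos, div_le_one hσ]; exact hT
    linarith [neg_abs_le B0]
  intro k
  induction k with
  | zero =>
    intro z T hT
    exact base z T (by simpa using hT)
  | succ k ih =>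
    intro z T hT hd Ly hLy hLe hT0
    rcases le_total T σ with hTσ | hTσ
    · exact base z T hTσ hd Ly hLy hLe hT0
    have hd0 := hd 0 ⟨le_rfl, hT0⟩
    rw [S.flow.zero] at hd0
    obtain ⟨θ, hθ, hθa⟩ := one z hd0
    have h1 := hθa σ ⟨hσ.le, le_rfl⟩ Ly (hLy.mono (Icc_subset_Icc_right hTσ))
      (fun t ht => hLe t ⟨ht.1, ht.2.trans hTσ⟩)
    have hsh : ∀ t ∈ Icc 0 (T - σ), ψ t (ψ σ z) = ψ (t + σ) z := fun t ht =>
      (S.flow.add t σ ht.1 hσ.le z).symm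
    have hmem : ∀ t ∈ Icc 0 (T - σ), t + σ ∈ Icc 0 T := fun t ht =>
      ⟨by linarith [ht.1], by linarith [ht.2]⟩
    have h2 := ih (ψ σ z) (T - σ) (by push_cast at hT; linarith)
      (fun t ht => by rw [hsh t ht]; exact hd _ (hmem t ht))
      (fun t => Ly (t + σ)) (hLy.comp (by fun_prop) hmem)
      (fun t ht => by rw [hsh t ht]; exact hLe _ (hmem t ht)) (by linarith)
    simp only [sub_add_cancel, zero_add] at h2
    rw [S.perL, add_sub_cancel_left] at h1
    have e1 : ((n:ℂ) * (2 * Real.pi * Complex.I)).im = n * (2 * Real.pi) := by simp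
    rw [e1] at h1
    have e2 : (T - σ) / σ - 1 = (T / σ - 1) - 1 := by field_simp
    rw [e2] at h2
    have e3 : (Ly T - Ly 0).im = (Ly T - Ly σ).im + (Ly σ - Ly 0).im := by
      simp only [Complex.sub_im]; ring
    rw [e3, mul_add]
    have h5 : |(n:ℝ)| * Real.pi ≤ Real.pi * n ^ 2 := by
      rw [hsq]; nlinarith [mul_nonneg (mul_nonneg hπ.le (abs_nonneg (n:ℝ))) (sub_nonneg.2 hn1)]
    nlinarith

theorem IsSetup.growth' (S : IsSetup ψ Γ σ z0 LΓ n) : ∃ η0 > 0, ∃ B1 : ℝ, ∀ z : ℂ, ∀ T : ℝ,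
    (∀ t ∈ Icc 0 T, Metric.infDist (ψ t z) (range Γ) < η0) →
    ∀ Ly : ℝ → ℂ, ContinuousOn Ly (Icc 0 T) → (∀ t ∈ Icc 0 T, Complex.exp (Ly t) = ψ t z - z0) →
    0 ≤ T →
      (Real.pi * n ^ 2) * (T / σ - 1) - B1 ≤ n * (Ly T - Ly 0).im := by
  obtain ⟨η0, hη0, B1, h⟩ := S.growth
  refine ⟨η0, hη0, B1, fun z T => ?_⟩
  obtain ⟨k, hk⟩ := exists_nat_ge (T / σ)
  refine h k z T ?_
  rw [div_le_iff₀ S.loop.pos] at hk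
  nlinarith [S.loop.pos]

/-- Crossing of two curves in the logarithmic plane. -/
theorem cross_log {n e : ℝ} (hn : n ≠ 0) (he : e ≠ 0) {X C : ℝ → ℂ} (hX : Continuous X)
    (hC : Continuous C) {s1 Q R1 : ℝ}
    (hXbot : Tendsto (fun s => n * (X s).im) atBot atBot)
    (hCtop : Tendsto (fun t => n * (C t).im) atTop atTop)
    (hC0 : ∀ t ∈ Icc (-1:ℝ) 0, n * (C t).im ≤ Q) (hC1 : R1 ≤ e * (C (-1)).re)
    (hC2 : ∀ t, 0 ≤ t → e * (C t).re < R1)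
    (hX1 : R1 ≤ e * (X s1).re) (hX2 : Q < n * (X s1).im)
    (hX3 : ∀ s ≤ s1, Q < n * (X s).im ∨ e * (X s).re < R1) :
    ∃ s ≤ s1, ∃ t, -1 ≤ t ∧ X s = C t := by
  have c1 : Continuous fun s => n * (X s).im := by fun_prop
  have c2 : Continuous fun s => n * (C s).im := by fun_prop
  -- upper bound for X on (-∞, s1]
  obtain ⟨M, hM⟩ : ∃ M, ∀ s ≤ s1, n * (X s).im ≤ M := by
    obtain ⟨a, ha⟩ := eventually_atBot.1 (hXbot.eventually (eventually_le_atBot (0:ℝ)))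
    obtain ⟨M, hM⟩ := (isCompact_Icc (a := a) (b := s1)).bddAbove_image c1.continuousOn
    refine ⟨max M 0, fun s hs => ?_⟩
    rcases le_total s a with h | h
    · exact (ha s h).trans (le_max_right _ _)
    · exact (hM ⟨s, ⟨h, hs⟩, rfl⟩).trans (le_max_left _ _)
  obtain ⟨b, hb, hb0⟩ := ((hCtop.eventually (eventually_gt_atTop M)).and
    (eventually_ge_atTop (0:ℝ))).exists
  obtain ⟨m, hm⟩ := (isCompact_Icc (a := (-1:ℝ)) (b := b)).bddBelow_image c2.continuousOn
  obtain ⟨a, ha, has⟩ := ((hXbot.eventually (eventually_lt_atBot m)).and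
    (eventually_le_atBot s1)).exists
  obtain ⟨s, hs, t, ht, e1, e2⟩ := crossing (fun s => n * (X s).im) (fun s => e * (X s).re)
    (fun t => n * (C t).im) (fun t => e * (C t).re) c1 (by fun_prop) c2 (by fun_prop) a s1 (-1) b
    has (by linarith) (fun t ht => ha.trans_le (hm ⟨t, ht, rfl⟩))
    (fun s hs => (hM s hs.2).trans_lt hb)
    (fun s hs => by
      rcases hX3 s hs.2 with h | h
      · exact Or.inl ((hC0 (-1) (by simp)).trans_lt h)
      · exact Or.inr (h.trans_le hC1))
    (fun t ht => by
      rcases le_total t 0 with h | h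
      · exact Or.inl ((hC0 t ⟨ht.1, h⟩).trans_lt hX2)
      · exact Or.inr ((hC2 t h).trans_le hX1))
  exact ⟨s, hs.2, t, ht.1, Complex.ext (mul_left_cancel₀ he e2) (mul_left_cancel₀ hn e1)⟩

/-- Uniform choice of escaping paths. -/
theorem uniform_paths {K A : Set ℂ} (hK : IsClosed K) (hKne : K.Nonempty) (hA : IsCompact A)
    {z0 : ℂ} {e : ℝ}
    (he : |e| = 1) (hz0 : z0 ∉ A) (R : ℝ)
    (hP : ∀ z ∈ A, ∀ R : ℝ, ∃ q : ℝ → ℂ, Continuous q ∧ Complex.exp (q 0) = z - z0 ∧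
      (∀ u ∈ Icc (0:ℝ) 1, z0 + Complex.exp (q u) ∉ K) ∧ R ≤ e * (q 1).re) :
    ∃ η > 0, ∃ N : ℝ, ∀ z ∈ A, ∃ q : ℝ → ℂ, Continuous q ∧ Complex.exp (q 0) = z - z0 ∧
      (∀ u ∈ Icc (0:ℝ) 1, η ≤ Metric.infDist (z0 + Complex.exp (q u)) K) ∧ R ≤ e * (q 1).re ∧
      (∀ u ∈ Icc (0:ℝ) 1, |(q u - q 0).im| ≤ N) := by
  refine hA.induction_on (p := fun A => ∃ η > 0, ∃ N : ℝ, ∀ z ∈ A, ∃ q : ℝ → ℂ,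
      Continuous q ∧ Complex.exp (q 0) = z - z0 ∧
      (∀ u ∈ Icc (0:ℝ) 1, η ≤ Metric.infDist (z0 + Complex.exp (q u)) K) ∧ R ≤ e * (q 1).re ∧
      (∀ u ∈ Icc (0:ℝ) 1, |(q u - q 0).im| ≤ N)) ?_ ?_ ?_ ?_
  · exact ⟨1, one_pos, 0, by simp⟩
  · rintro s t hst ⟨η, hη, N, h⟩
    exact ⟨η, hη, N, fun z hz => h z (hst hz)⟩
  · rintro s t ⟨η, hη, N, h⟩ ⟨η', hη', N', h'⟩
    refine ⟨min η η', lt_min hη hη', max N N', ?_⟩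
    rintro z (hz | hz)
    · obtain ⟨q, a1, a2, a3, a4, a5⟩ := h z hz
      exact ⟨q, a1, a2, fun u hu => (min_le_left _ _).trans (a3 u hu), a4,
        fun u hu => (a5 u hu).trans (le_max_left _ _)⟩
    · obtain ⟨q, a1, a2, a3, a4, a5⟩ := h' z hz
      exact ⟨q, a1, a2, fun u hu => (min_le_right _ _).trans (a3 u hu), a4,
        fun u hu => (a5 u hu).trans (le_max_right _ _)⟩
  · intro w hw
    obtain ⟨q, hq, hq0, hqK, hqR⟩ := hP w hw (R + 1)
    have hwz : w - z0 ≠ 0 := by rw [← hq0]; exact Complex.exp_ne_zero _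
    have cq : Continuous fun u => Metric.infDist (z0 + Complex.exp (q u)) K :=
      (Metric.continuous_infDist_pt K).comp (by fun_prop)
    obtain ⟨u0, hu0, hmin⟩ := (isCompact_Icc (a := (0:ℝ)) (b := 1)).exists_isMinOn ⟨0, by simp⟩
      cq.continuousOn
    set η := Metric.infDist (z0 + Complex.exp (q u0)) K with hη
    have hηp : 0 < η := (hK.notMem_iff_infDist_pos hKne).1 (hqK u0 hu0)
    obtain ⟨M, hM⟩ := (isCompact_Icc (a := (0:ℝ)) (b := 1)).bddAbove_image
      (f := fun u => ‖Complex.exp (q u)‖) (by apply Continuous.continuousOn; fun_prop)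
    obtain ⟨N, hN⟩ := (isCompact_Icc (a := (0:ℝ)) (b := 1)).bddAbove_image
      (f := fun u => |(q u - q 0).im|) (by apply Continuous.continuousOn; fun_prop)
    have cl : ContinuousAt (fun w' => Complex.log ((w' - z0) / (w - z0))) w := by
      apply ContinuousAt.clog (by fun_prop)
      rw [div_self hwz]; exact Complex.one_mem_slitPlane
    have l0 : Complex.log ((w - z0) / (w - z0)) = 0 := by rw [div_self hwz, Complex.log_one]
    have ev1 : ∀ᶠ w' in 𝓝 w, ‖Complex.log ((w' - z0) / (w - z0))‖ < 1 := by
      have := cl.norm.eventually_lt (continuousAt_const (y := (1:ℝ))) (by simp [l0])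
      exact this
    have ev2 : ∀ᶠ w' in 𝓝 w, |M| * ‖(w' - z0) / (w - z0) - 1‖ < η / 2 := by
      have c : ContinuousAt (fun w' => |M| * ‖(w' - z0) / (w - z0) - 1‖) w := by fun_prop
      have := c.eventually_lt (continuousAt_const (y := (η / 2))) (by rw [div_self hwz]; simpa using hηp)
      exact this
    have ev3 : ∀ᶠ w' in 𝓝 w, w' - z0 ≠ 0 :=
      (show ContinuousAt (fun w' => w' - z0) w by fun_prop).eventually_ne hwz
    refine ⟨{w' | ‖Complex.log ((w' - z0) / (w - z0))‖ < 1 ∧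
      |M| * ‖(w' - z0) / (w - z0) - 1‖ < η / 2 ∧ w' - z0 ≠ 0},
      mem_nhdsWithin_of_mem_nhds (ev1.and (ev2.and ev3)), η / 2, by linarith, N, ?_⟩
    rintro w' ⟨h1, h2, h3⟩
    set lam := Complex.log ((w' - z0) / (w - z0)) with hlam
    have hexp : Complex.exp lam = (w' - z0) / (w - z0) := Complex.exp_log (div_ne_zero h3 hwz)
    refine ⟨fun u => q u + lam, by fun_prop, ?_, ?_, ?_, ?_⟩
    · rw [Complex.exp_add, hexp, hq0, mul_div_cancel₀ _ hwz]
    · intro u hu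
      have h5 : η ≤ Metric.infDist (z0 + Complex.exp (q u)) K := hmin hu
      have h6 : ‖Complex.exp (q u)‖ ≤ |M| := (hM ⟨u, hu, rfl⟩).trans (le_abs_self M)
      have h4 : dist (z0 + Complex.exp (q u)) (z0 + Complex.exp (q u + lam)) ≤ η / 2 := by
        rw [dist_add_left, dist_comm, dist_eq_norm, Complex.exp_add, hexp]
        have : Complex.exp (q u) * ((w' - z0) / (w - z0)) - Complex.exp (q u) =
          Complex.exp (q u) * ((w' - z0) / (w - z0) - 1) := by ring
        rw [this, norm_mul]
        exact (mul_le_mul_of_nonneg_right h6 (norm_nonneg _)).trans h2.le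
      have := Metric.infDist_le_infDist_add_dist (s := K) (x := z0 + Complex.exp (q u))
        (y := z0 + Complex.exp (q u + lam))
      linarith
    · have h5 : |e * lam.re| ≤ 1 := by
        rw [abs_mul, he, one_mul]
        exact (Complex.abs_re_le_norm _).trans h1.le
      rw [Complex.add_re, mul_add]
      linarith [(abs_le.1 h5).1]
    · intro u hu
      have := hN ⟨u, hu, rfl⟩
      simpa using this
end PlaneSetup

theorem orbit_stays {ψ : ℝ → ℂ → ℂ} {Γ : ℝ → ℂ} (flow : IsPlaneFlow ψ)
    (inv : ∀ t, 0 ≤ t → ∀ s, ψ t (Γ s) = Γ (s + t)) {Ω : Set ℂ} (hΩ : IsOpen Ω)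
    (hΩK : Disjoint Ω (range Γ)) (hc : IsClosed (Ω ∪ range Γ)) {z : ℂ} (hz : z ∈ Ω) {t : ℝ}
    (ht : 0 ≤ t) : ψ t z ∈ Ω := by
  have hK : ∀ t, 0 ≤ t → ψ t z ∉ range Γ := by
    rintro t ht ⟨s, hs⟩
    have h1 := inv t ht (s - t)
    rw [sub_add_cancel, hs] at h1
    have := flow.inj t ht h1
    exact disjoint_left.1 hΩK hz ⟨_, this⟩
  have cψ : Continuous fun t => ψ t z := flow.cont.comp (by fun_prop : Continuous fun t : ℝ => (t, z))
  have hp : IsPreconnected ((fun t => ψ t z) '' Ici 0) := isPreconnected_Ici.image _ cψ.continuousOn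
  have := hp.subset_left_of_subset_union hΩ hc.isOpen_compl
    (disjoint_left.2 fun x h1 h2 => h2 (Or.inl h1)) (by
      rintro _ ⟨s, hs, rfl⟩
      by_cases h : ψ s z ∈ Ω
      · exact Or.inl h
      · refine Or.inr ?_
        rintro (h1 | h1)
        · exact h h1
        · exact hK s hs h1) ⟨z, (⟨0, self_mem_Ici, flow.zero z⟩ : ∃ t, t ∈ Ici (0:ℝ) ∧ ψ t z = z), hz⟩
  exact this ⟨t, ht, rfl⟩

theorem core_cross {n e : ℝ} (hn : n ≠ 0) (he : e ≠ 0) {A Y Qx Qc Lc : ℝ → ℂ} {lam : ℂ}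
    (cA : Continuous A) (cY : Continuous Y) (cQx : Continuous Qx) (cQc : Continuous Qc)
    (cLc : Continuous Lc) {t1 Q R1 : ℝ} (ht1 : 0 ≤ t1) (hY0 : Y 0 = A 0 + lam) (hQx0 : Qx 0 = Y t1)
    (hLc0 : Lc 0 = Qc 0) (hAbot : Tendsto (fun s => n * (A s).im) atBot atBot)
    (hLtop : Tendsto (fun t => n * (Lc t).im) atTop atTop)
    (hA : ∀ s ≤ 0, e * (A s).re < R1)
    (hseg : ∀ v ∈ Icc (0:ℝ) 1, Q < n * (A 0 + v * lam).im)
    (hY : ∀ s ∈ Icc 0 t1, Q < n * (Y s).im)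
    (hQx : ∀ u ∈ Icc (0:ℝ) 1, Q < n * (Qx u).im) (hQx1 : R1 ≤ e * (Qx 1).re)
    (hQc : ∀ u ∈ Icc (0:ℝ) 1, n * (Qc u).im ≤ Q) (hQc1 : R1 ≤ e * (Qc 1).re)
    (hLc : ∀ t, 0 ≤ t → e * (Lc t).re < R1) :
    (∃ s ≤ 0, ∃ u ∈ Icc (0:ℝ) 1, A s = Qc u) ∨ (∃ s ≤ 0, ∃ t ≥ 0, A s = Lc t) ∨
    (∃ v ∈ Icc (0:ℝ) 1, ∃ t ≥ 0, A 0 + v * lam = Lc t) ∨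
    (∃ s ∈ Icc 0 t1, ∃ t ≥ 0, Y s = Lc t) ∨ (∃ u ∈ Icc (0:ℝ) 1, ∃ t ≥ 0, Qx u = Lc t) := by
  classical
  set X : ℝ → ℂ := fun s => if s ≤ 0 then A s else if s ≤ 1 then A 0 + s * lam else
    if s ≤ 1 + t1 then Y (s - 1) else Qx (s - 1 - t1) with hX
  set C : ℝ → ℂ := fun t => if t ≤ 0 then Qc (-t) else Lc t with hC
  have cX : Continuous X := by
    refine Continuous.if_le cA (Continuous.if_le (by fun_prop) (Continuous.if_le (by fun_prop)
      (by fun_prop) continuous_id continuous_const ?_) continuous_id continuous_const ?_)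
      continuous_id continuous_const ?_
    · intro x hx; subst hx
      rw [show 1 + t1 - 1 - t1 = 0 by ring, hQx0]; congr 1; ring
    · intro x hx; subst hx
      rw [if_pos (by linarith)]; simp [hY0]
    · intro x hx; subst hx
      rw [if_pos (by linarith)]; simp
  have cC : Continuous C := by
    refine Continuous.if_le (by fun_prop) cLc continuous_id continuous_const ?_
    intro x hx; subst hx
    simp [hLc0]
  have hXs : ∀ s ≤ t1 + 2, (s ≤ 0 ∧ X s = A s) ∨ (∃ v ∈ Icc (0:ℝ) 1, X s = A 0 + v * lam) ∨
      (∃ r ∈ Icc 0 t1, X s = Y r) ∨ (∃ u ∈ Icc (0:ℝ) 1, X s = Qx u) := by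
    intro s hs
    by_cases h0 : s ≤ 0
    · exact Or.inl ⟨h0, by simp [hX, h0]⟩
    by_cases h1 : s ≤ 1
    · exact Or.inr (Or.inl ⟨s, ⟨by linarith, h1⟩, by simp [hX, h0, h1]⟩)
    by_cases h2 : s ≤ 1 + t1
    · exact Or.inr (Or.inr (Or.inl ⟨s - 1, ⟨by linarith, by linarith⟩, by simp [hX, h0, h1, h2]⟩))
    · exact Or.inr (Or.inr (Or.inr ⟨s - 1 - t1, ⟨by linarith, by linarith⟩,
        by simp [hX, h0, h1, h2]⟩))
  have hCs : ∀ t, -1 ≤ t → (∃ u ∈ Icc (0:ℝ) 1, C t = Qc u) ∨ (0 ≤ t ∧ C t = Lc t) := by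
    intro t ht
    by_cases h : t ≤ 0
    · exact Or.inl ⟨-t, ⟨by linarith, by linarith⟩, by simp [hC, h]⟩
    · exact Or.inr ⟨by linarith, by simp [hC, h]⟩
  have hX1 : X (t1 + 2) = Qx 1 := by
    simp only [hX]
    rw [if_neg (by linarith), if_neg (by linarith), if_neg (by linarith)]
    congr 1; ring
  have hC1 : C (-1) = Qc 1 := by simp [hC]
  have hC0 : ∀ t, 0 ≤ t → C t = Lc t := by
    intro t ht
    rcases ht.eq_or_lt with h | h
    · subst h; simp [hC, hLc0]
    · simp [hC, not_le.2 h]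
  obtain ⟨s, hs, t, ht, hst⟩ := cross_log hn he cX cC (s1 := t1 + 2) (Q := Q) (R1 := R1)
    (hAbot.congr' (by
      filter_upwards [eventually_le_atBot (0:ℝ)] with s hs
      simp [hX, hs]))
    (hLtop.congr' (by
      filter_upwards [eventually_ge_atTop (0:ℝ)] with s hs
      rw [hC0 s hs]))
    (by
      intro t ht
      have h : C t = Qc (-t) := by simp [hC, ht.2]
      rw [h]; exact hQc _ ⟨by linarith [ht.2], by linarith [ht.1]⟩)
    (by rw [hC1]; exact hQc1) (fun t ht => by rw [hC0 t ht]; exact hLc t ht)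
    (by rw [hX1]; exact hQx1) (by rw [hX1]; exact hQx 1 (by simp))
    (by
      intro s hs
      rcases hXs s hs with ⟨h, e⟩ | ⟨v, hv, e⟩ | ⟨v, hv, e⟩ | ⟨v, hv, e⟩ <;> rw [e]
      · exact Or.inr (hA s h)
      · exact Or.inl (hseg v hv)
      · exact Or.inl (hY v hv)
      · exact Or.inl (hQx v hv))
  rcases hCs t ht with ⟨u, hu, e2⟩ | ⟨ht0, e2⟩
  · rcases hXs s hs with ⟨h, e⟩ | ⟨v, hv, e⟩ | ⟨v, hv, e⟩ | ⟨v, hv, e⟩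
    · exact Or.inl ⟨s, h, u, hu, by rw [← e, hst, e2]⟩
    · have h1 := hseg v hv
      rw [← e, hst, e2] at h1
      exact absurd (hQc u hu) (not_le.2 h1)
    · have h1 := hY v hv
      rw [← e, hst, e2] at h1
      exact absurd (hQc u hu) (not_le.2 h1)
    · have h1 := hQx v hv
      rw [← e, hst, e2] at h1
      exact absurd (hQc u hu) (not_le.2 h1)
  · right
    rcases hXs s hs with ⟨h, e⟩ | ⟨v, hv, e⟩ | ⟨v, hv, e⟩ | ⟨v, hv, e⟩
    · exact Or.inl ⟨s, h, t, ht0, by rw [← e, hst, e2]⟩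
    · exact Or.inr (Or.inl ⟨v, hv, t, ht0, by rw [← e, hst, e2]⟩)
    · exact Or.inr (Or.inr (Or.inl ⟨v, hv, t, ht0, by rw [← e, hst, e2]⟩))
    · exact Or.inr (Or.inr (Or.inr ⟨v, hv, t, ht0, by rw [← e, hst, e2]⟩))

section Key
variable {ψ : ℝ → ℂ → ℂ} {Γ : ℝ → ℂ} {σ : ℝ} {z0 : ℂ} {LΓ : ℝ → ℂ} {n : ℤ}

theorem IsSetup.perL_int (S : IsSetup ψ Γ σ z0 LΓ n) (t : ℝ) (m : ℤ) :
    LΓ (t + m * σ) = LΓ t + m * (n * (2 * Real.pi * Complex.I)) := by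
  induction m using Int.induction_on with
  | zero => simp
  | succ i ih =>
    have := S.perL (t + (i:ℤ) * σ)
    push_cast at this ih ⊢
    rw [show t + ((i:ℝ) + 1) * σ = t + i * σ + σ by ring, this, ih]; ring
  | pred i ih =>
    have := S.perL (t + (-(i:ℤ) - 1 : ℤ) * σ)
    push_cast at this ih ⊢
    rw [show t + (-(i:ℝ) - 1) * σ + σ = t + -i * σ by ring, ih] at this
    linear_combination -this

theorem IsSetup.bot (S : IsSetup ψ Γ σ z0 LΓ n) (a : ℝ) :
    Tendsto (fun s => (n:ℝ) * (LΓ (a + s)).im) atBot atBot := by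
  have hσ := S.loop.pos
  have hπ := Real.pi_pos
  have hn2 : (0:ℝ) < n ^ 2 := by
    have : (n:ℝ) ≠ 0 := Int.cast_ne_zero.2 S.hn
    positivity
  obtain ⟨M, hM⟩ := (isCompact_Icc (a := (0:ℝ)) (b := σ)).bddAbove_image
    (f := fun s => (n:ℝ) * (LΓ s).im)
    (by have := S.contL; apply Continuous.continuousOn; fun_prop)
  have hb : ∀ s, (n:ℝ) * (LΓ (a + s)).im ≤ M + 2 * Real.pi * n ^ 2 * ((a + s) / σ) := by
    intro s
    obtain ⟨r, hr, m, hm⟩ := exists_mod hσ (a + s)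
    rw [hm, S.perL_int]
    have e1 : (LΓ r + m * (n * (2 * Real.pi * Complex.I))).im = (LΓ r).im + m * (n * (2 * Real.pi)) := by
      simp
    rw [e1]
    have h1 : (n:ℝ) * (LΓ r).im ≤ M := hM ⟨r, ⟨hr.1, hr.2.le⟩, rfl⟩
    have h2 : (m:ℝ) ≤ (r + m * σ) / σ := by
      rw [le_div_iff₀ hσ]; linarith [hr.1]
    nlinarith [mul_le_mul_of_nonneg_left h2 (by positivity : (0:ℝ) ≤ 2 * Real.pi * n ^ 2)]
  refine tendsto_atBot_mono hb ?_
  apply tendsto_atBot_add_const_left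
  apply Tendsto.const_mul_atBot (by positivity)
  apply Tendsto.atBot_div_const hσ
  exact tendsto_atBot_add_const_left _ _ tendsto_id

theorem re_bound {K : Set ℂ} (hK : IsCompact K) {z0 : ℂ} {e ε : ℝ} (he : |e| = 1)
    (hε : ε < Metric.infDist z0 K) (hKne : K.Nonempty) (hε0 : 0 ≤ ε) :
    ∃ R1 : ℝ, ∀ ζ : ℂ, Metric.infDist (z0 + Complex.exp ζ) K ≤ ε → e * ζ.re < R1 := by
  have hcomp : IsCompact {z | Metric.infDist z K ≤ ε} := by
    have := hK.cthickening (r := ε)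
    convert this using 1
    ext z
    rw [Metric.mem_cthickening_iff, ENNReal.le_ofReal_iff_toReal_le (Metric.infEDist_ne_top hKne) hε0]
    rfl
  have hcl : ContinuousOn (fun z => |Real.log ‖z - z0‖|) {z | Metric.infDist z K ≤ ε} := by
    apply ContinuousOn.abs
    apply ContinuousOn.log (by fun_prop)
    intro z hz h
    rw [norm_eq_zero, sub_eq_zero] at h
    subst h
    exact absurd hz (not_le.2 hε)
  obtain ⟨M, hM⟩ := hcomp.bddAbove_image hcl
  refine ⟨M + 1, fun ζ hζ => ?_⟩
  have h1 := hM ⟨_, hζ, rfl⟩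
  simp only [add_sub_cancel_left, Complex.norm_exp, Real.log_exp] at h1
  have h2 : e * ζ.re ≤ |ζ.re| := by
    calc e * ζ.re ≤ |e * ζ.re| := le_abs_self _
      _ = |ζ.re| := by rw [abs_mul, he, one_mul]
  linarith

theorem seg_lemma (S : IsSetup ψ Γ σ z0 LΓ n) (s : ℝ) {r : ℝ} (hr : 0 < r) :
    ∃ d > 0, ∀ y, dist y (Γ s) < d → ∃ lam : ℂ, Complex.exp (LΓ s + lam) = y - z0 ∧
      (∀ v ∈ Icc (0:ℝ) 1, |n * (v * lam).im| ≤ 1) ∧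
      ∀ v ∈ Icc (0:ℝ) 1, dist (z0 + Complex.exp (LΓ s + v * lam)) (Γ s) < r := by
  have hw : Γ s - z0 ≠ 0 := fun e => S.hz0 ⟨s, sub_eq_zero.1 e⟩
  have hn : (0:ℝ) < |(n:ℝ)| := abs_pos.2 (Int.cast_ne_zero.2 S.hn)
  have hce : ContinuousAt (fun μ : ℂ => z0 + Complex.exp (LΓ s + μ)) 0 := by fun_prop
  obtain ⟨ρ, hρ, hρ2⟩ := Metric.continuousAt_iff.1 hce r hr
  have cl : ContinuousAt (fun w' => Complex.log ((w' - z0) / (Γ s - z0))) (Γ s) := by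
    apply ContinuousAt.clog (by fun_prop)
    rw [div_self hw]; exact Complex.one_mem_slitPlane
  have l0 : Complex.log ((Γ s - z0) / (Γ s - z0)) = 0 := by rw [div_self hw, Complex.log_one]
  have ev1 : ∀ᶠ w' in 𝓝 (Γ s), ‖Complex.log ((w' - z0) / (Γ s - z0))‖ < min ρ (1 / |(n:ℝ)|) := by
    have := cl.norm.eventually_lt (continuousAt_const (y := min ρ (1 / |(n:ℝ)|)))
      (by rw [l0, norm_zero]; exact lt_min hρ (by positivity))
    exact this
  have ev3 : ∀ᶠ w' in 𝓝 (Γ s), w' - z0 ≠ 0 :=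
    (show ContinuousAt (fun w' => w' - z0) (Γ s) by fun_prop).eventually_ne hw
  obtain ⟨d, hd, hd2⟩ := Metric.eventually_nhds_iff.1 (ev1.and ev3)
  refine ⟨d, hd, fun y hy => ?_⟩
  obtain ⟨h1, h2⟩ := hd2 hy
  set lam := Complex.log ((y - z0) / (Γ s - z0))
  have hvl : ∀ v ∈ Icc (0:ℝ) 1, ‖(v:ℂ) * lam‖ ≤ ‖lam‖ := by
    intro v hv
    rw [norm_mul, Complex.norm_real, Real.norm_of_nonneg hv.1]
    exact mul_le_of_le_one_left (norm_nonneg _) hv.2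
  refine ⟨lam, ?_, fun v hv => ?_, fun v hv => ?_⟩
  · rw [Complex.exp_add, S.expL, Complex.exp_log (div_ne_zero h2 hw), mul_div_cancel₀ _ hw]
  · have h3 := (Complex.abs_im_le_norm (v * lam)).trans (hvl v hv)
    have h4 := h3.trans (h1.le.trans (min_le_right _ _))
    rw [abs_mul]
    rw [le_div_iff₀ hn] at h4; linarith
  · have := hρ2 (x := v * lam) (by
      rw [dist_zero_right]; exact ((hvl v hv).trans_lt h1).trans_le (min_le_left _ _))
    simpa [S.expL] using this
end Key

theorem IsSetup.key {ψ : ℝ → ℂ → ℂ} {Γ : ℝ → ℂ} {σ : ℝ} {z0 : ℂ} {LΓ : ℝ → ℂ} {n : ℤ}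
    (S : IsSetup ψ Γ σ z0 LΓ n) {Ω : Set ℂ} (hΩ : IsOpen Ω)
    (hΩK : Disjoint Ω (range Γ)) (hcl : IsClosed (Ω ∪ range Γ)) {e : ℝ} (he : |e| = 1)
    (hP : ∀ z ∈ Ω, z ≠ z0 → ∀ R : ℝ, ∃ q : ℝ → ℂ, Continuous q ∧ Complex.exp (q 0) = z - z0 ∧
      (∀ u ∈ Icc (0:ℝ) 1, z0 + Complex.exp (q u) ∉ range Γ) ∧ R ≤ e * (q 1).re)
    (hc : ∀ η > 0, ∃ c0 ∈ Ω, ∀ t ≥ 0, Metric.infDist (ψ t c0) (range Γ) < η) :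
    ∀ ε > 0, ∃ δ > 0, ∀ z ∈ Ω, Metric.infDist z (range Γ) < δ →
      ∀ t ≥ 0, Metric.infDist (ψ t z) (range Γ) < ε := by
  intro ε' hε'
  set K := range Γ with hKdef
  have hKc : IsCompact K := S.loop.isCompact
  have hKne : K.Nonempty := range_nonempty Γ
  have hr0 := S.infDist_pos
  obtain ⟨η0, hη0, B1, hgrow⟩ := S.growth'
  set ε := min ε' (min (η0 / 2) (Metric.infDist z0 K / 2)) with hεdef
  have hε : 0 < ε := lt_min hε' (lt_min (by linarith) (by linarith))
  have hεε' : ε ≤ ε' := min_le_left _ _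
  have hεη : ε < η0 := lt_of_le_of_lt ((min_le_right _ _).trans (min_le_left _ _)) (by linarith)
  have hεr : ε < Metric.infDist z0 K :=
    lt_of_le_of_lt ((min_le_right _ _).trans (min_le_right _ _)) (by linarith)
  have hπ := Real.pi_pos
  have hσ := S.loop.pos
  have hnR : (n:ℝ) ≠ 0 := Int.cast_ne_zero.2 S.hn
  have hn2 : (0:ℝ) < n ^ 2 := by positivity
  have he0 : e ≠ 0 := by rintro rfl; simp at he
  obtain ⟨R1, hR1⟩ := re_bound hKc he hεr hKne hε.le
  have stays : ∀ z ∈ Ω, ∀ t, 0 ≤ t → ψ t z ∈ Ω := fun z hz t ht =>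
    orbit_stays S.flow S.inv hΩ hΩK hcl hz ht
  have offK : ∀ z ∈ Ω, z ∉ K := fun z hz => disjoint_left.1 hΩK hz
  have cdist : Continuous fun z => Metric.infDist z K := Metric.continuous_infDist_pt K
  -- the level set
  have hA : IsCompact {z | z ∈ Ω ∧ Metric.infDist z K = ε} := by
    have h1 : {z | z ∈ Ω ∧ Metric.infDist z K = ε} = (Ω ∪ K) ∩ {z | Metric.infDist z K = ε} := by
      ext z
      constructor
      · rintro ⟨h1, h2⟩; exact ⟨Or.inl h1, h2⟩
      · rintro ⟨h1 | h1, h2⟩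
        · exact ⟨h1, h2⟩
        · have h3 := Metric.infDist_zero_of_mem h1
          have h4 : Metric.infDist z K = ε := h2
          linarith
    refine (hKc.cthickening (r := ε)).of_isClosed_subset ?_ ?_
    · rw [h1]; exact hcl.inter (isClosed_eq cdist continuous_const)
    · rintro z ⟨-, h2⟩
      rw [Metric.mem_cthickening_iff,
        ENNReal.le_ofReal_iff_toReal_le (Metric.infEDist_ne_top hKne) hε.le]
      exact h2.le
  have hne0 : ∀ z, Metric.infDist z K ≤ ε → z ≠ z0 := by
    rintro z h rfl; exact absurd h (not_le.2 hεr)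
  obtain ⟨η1, hη1, N, hpaths⟩ := uniform_paths hKc.isClosed hKne hA (z0 := z0) he
    (fun h => hne0 z0 h.2.le rfl) R1 (fun z hz => hP z hz.1 (hne0 z hz.2.le))
  obtain ⟨c0, hc0, hcη⟩ := hc (min η1 ε) (lt_min hη1 hε)
  have hcε : ∀ t ≥ 0, Metric.infDist (ψ t c0) K < ε := fun t ht => (hcη t ht).trans_le (min_le_right _ _)
  have hcη1 : ∀ t ≥ 0, Metric.infDist (ψ t c0) K < η1 :=
    fun t ht => (hcη t ht).trans_le (min_le_left _ _)
  have hc0z : c0 ≠ z0 := hne0 _ (by have := (hcε 0 le_rfl).le; rwa [S.flow.zero] at this)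
  obtain ⟨qc, cqc, hqc0, hqcK, hqcR⟩ := hP c0 hc0 hc0z R1
  have cψ : ∀ z, Continuous fun t => ψ t z := fun z =>
    S.flow.cont.comp (by fun_prop : Continuous fun t : ℝ => (t, z))
  obtain ⟨Lc, cLc, hLc, hLc0⟩ := exists_log_lift (fun t : ℝ => ψ (max t 0) c0 - z0)
    (((cψ c0).comp (by fun_prop : Continuous fun t : ℝ => max t 0)).sub continuous_const)
    (fun t h => hne0 _ (hcε _ (le_max_right t 0)).le (sub_eq_zero.1 h)) 0 (qc 0)
    (by simp only [max_self, S.flow.zero, hqc0])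
  have hLc' : ∀ t, 0 ≤ t → Complex.exp (Lc t) = ψ t c0 - z0 := fun t ht => by
    rw [hLc, max_eq_left ht]
  obtain ⟨Q, hQ⟩ := (isCompact_Icc (a := (0:ℝ)) (b := 1)).bddAbove_image
    (f := fun u => (n:ℝ) * (qc u).im) (by apply Continuous.continuousOn; fun_prop)
  have hLtop : Tendsto (fun t => (n:ℝ) * (Lc t).im) atTop atTop := by
    have hb : ∀ t, 0 ≤ t → (n:ℝ) * (Lc 0).im + ((Real.pi * n ^ 2) * (t / σ - 1) - B1) ≤ n * (Lc t).im := by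
      intro t ht
      have := hgrow c0 t (fun s hs => (hcε s hs.1).trans hεη) Lc cLc.continuousOn
        (fun s hs => hLc' s hs.1) ht
      rw [Complex.sub_im, mul_sub] at this; linarith
    refine tendsto_atTop_mono' _ (by filter_upwards [eventually_ge_atTop (0:ℝ)] with t ht using hb t ht) ?_
    apply tendsto_atTop_add_const_left
    apply tendsto_atTop_add_const_right
    apply Tendsto.const_mul_atTop (by positivity)
    apply tendsto_atTop_add_const_right
    exact tendsto_id.atTop_div_const hσ
  -- choice of s*
  obtain ⟨k, hk⟩ := exists_nat_ge ((Q + B1 + Real.pi * n ^ 2 + |(n:ℝ)| * N + 2 - n * (LΓ 0).im) /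
    (2 * Real.pi * n ^ 2))
  set s' : ℝ := ((k + 1 : ℕ) : ℝ) * σ with hs'
  have hs'σ : σ ≤ s' := by
    rw [hs']; push_cast; nlinarith [(Nat.cast_nonneg k : (0:ℝ) ≤ k)]
  have hLs : Q + B1 + Real.pi * n ^ 2 + |(n:ℝ)| * N + 2 ≤ n * (LΓ s').im := by
    have h1 := S.perL_int 0 ((k + 1 : ℕ) : ℤ)
    rw [zero_add, Int.cast_natCast] at h1
    rw [hs', h1]
    have e1 : (LΓ 0 + ((k + 1 : ℕ) : ℤ) * (n * (2 * Real.pi * Complex.I))).im =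
        (LΓ 0).im + ((k + 1 : ℕ) : ℝ) * (n * (2 * Real.pi)) := by
      rw [Int.cast_natCast, Complex.add_im]
      congr 1
      rw [← Complex.ofReal_natCast, ← Complex.ofReal_intCast, Complex.im_ofReal_mul,
        Complex.im_ofReal_mul]
      simp
    rw [e1]
    rw [div_le_iff₀ (by positivity)] at hk
    push_cast
    nlinarith [mul_pos (mul_pos two_pos hπ) hn2]
  -- T*
  obtain ⟨T, hT⟩ := eventually_atTop.1 (hLtop.eventually (eventually_gt_atTop ((n:ℝ) * (LΓ s').im + 1)))
  obtain ⟨d1, hd1, hd1'⟩ : ∃ d1 > 0, ∀ t ∈ Icc 0 T, d1 ≤ Metric.infDist (ψ t c0) K := by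
    rcases (Icc 0 T).eq_empty_or_nonempty with h | h
    · exact ⟨1, one_pos, by rw [h]; simp⟩
    · obtain ⟨u0, hu0, hmin⟩ := (isCompact_Icc (a := (0:ℝ)) (b := T)).exists_isMinOn h
        (cdist.comp (cψ c0)).continuousOn
      refine ⟨_, ?_, fun t ht => hmin ht⟩
      exact (hKc.isClosed.notMem_iff_infDist_pos hKne).1 (offK _ (stays _ hc0 _ hu0.1))
  obtain ⟨δ2, hδ2, hseg⟩ := seg_lemma S s' (r := min d1 ε) (lt_min hd1 hε)
  obtain ⟨δ, hδ, htube⟩ := S.flow.tube hKc s' (r := min δ2 ε) (lt_min hδ2 hε)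
  refine ⟨δ, hδ, fun x hx hxd => ?_⟩
  obtain ⟨θ, hθ, hxθ⟩ := S.near hxd
  set a := s' - θ with ha
  have ha0 : 0 ≤ a := by linarith [hθ.2]
  have has : a ≤ s' := by linarith [hθ.1]
  set y0 := ψ a x with hy0
  have hy0Ω : y0 ∈ Ω := stays x hx a ha0
  have hearly : ∀ t ∈ Icc 0 s', Metric.infDist (ψ t x) K < min δ2 ε := by
    intro t ht
    have h1 := htube _ (mem_range_self θ) x hxθ t ht
    rw [S.inv t ht.1] at h1
    exact (Metric.infDist_le_dist_of_mem (mem_range_self _)).trans_lt h1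
  have hy0d : dist y0 (Γ s') < δ2 := by
    have h1 := htube _ (mem_range_self θ) x hxθ a ⟨ha0, has⟩
    rw [S.inv a ha0, show θ + a = s' by rw [ha]; ring] at h1
    exact h1.trans_le (min_le_left _ _)
  have hy0ε : Metric.infDist y0 K < ε := (hearly a ⟨ha0, has⟩).trans_le (min_le_right _ _)
  suffices hmain : ∀ t ≥ 0, Metric.infDist (ψ t y0) K < ε by
    intro t ht
    rcases le_total t a with h | h
    · exact ((hearly t ⟨ht, h.trans has⟩).trans_le (min_le_right _ _)).trans_le hεε'
    · have := hmain (t - a) (by linarith)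
      rw [hy0, ← S.flow.add _ _ (by linarith) ha0, sub_add_cancel] at this
      exact this.trans_le hεε'
  by_contra hcon
  push Not at hcon
  obtain ⟨t2, ht2, ht2ε⟩ := hcon
  have cy : Continuous fun t => Metric.infDist (ψ t y0) K := cdist.comp (cψ y0)
  -- first hitting time
  obtain ⟨t1, ht1, hmin⟩ : ∃ t1 ∈ Icc 0 t2 ∩ {t | ε ≤ Metric.infDist (ψ t y0) K},
      ∀ t ∈ Icc 0 t2 ∩ {t | ε ≤ Metric.infDist (ψ t y0) K}, t1 ≤ t :=
    (isCompact_Icc.inter_right (isClosed_le continuous_const cy)).exists_isLeast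
      ⟨t2, ⟨ht2, le_rfl⟩, ht2ε⟩
  have hlt : ∀ t ∈ Ico 0 t1, Metric.infDist (ψ t y0) K < ε := by
    intro t ht
    by_contra h
    exact absurd (hmin t ⟨⟨ht.1, ht.2.le.trans ht1.1.2⟩, not_lt.1 h⟩) (not_le.2 ht.2)
  have ht1pos : 0 < t1 := by
    rcases ht1.1.1.eq_or_lt with h | h
    · exfalso
      have h3 := ht1.2
      rw [← h] at h3
      have h4 : ε ≤ Metric.infDist (ψ 0 y0) K := h3
      rw [S.flow.zero] at h4
      linarith
    · exact h
  have hle : ∀ t ∈ Icc 0 t1, Metric.infDist (ψ t y0) K ≤ ε := by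
    have h1 : IsClosed {t | Metric.infDist (ψ t y0) K ≤ ε} := isClosed_le cy continuous_const
    have h2 := h1.closure_subset_iff.2 (fun t (ht : t ∈ Ico 0 t1) => (hlt t ht).le)
    rw [closure_Ico ht1pos.ne] at h2
    exact h2
  have heq : Metric.infDist (ψ t1 y0) K = ε := le_antisymm (hle t1 ⟨ht1pos.le, le_rfl⟩) ht1.2
  obtain ⟨lam, hlam1, hlam2, hlam3⟩ := hseg y0 hy0d
  have hneY : ∀ t ∈ Icc 0 t1, ψ t y0 - z0 ≠ 0 := fun t ht h => hne0 _ (hle t ht) (sub_eq_zero.1 h)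
  obtain ⟨Y, cY, hYe, hY0⟩ := exists_log_lift (fun t : ℝ => ψ (max 0 (min t t1)) y0 - z0)
    (((cψ y0).comp (by fun_prop : Continuous fun t : ℝ => max 0 (min t t1))).sub continuous_const)
    (fun t => hneY _ ⟨le_max_left _ _, max_le ht1pos.le (min_le_right _ _)⟩) 0 (LΓ s' + lam)
    (by simp only [min_eq_left ht1pos.le, max_self, S.flow.zero, hlam1])
  have hYe' : ∀ t ∈ Icc 0 t1, Complex.exp (Y t) = ψ t y0 - z0 := fun t ht => by
    rw [hYe, min_eq_left ht.2, max_eq_right ht.1]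
  obtain ⟨q, cq, hq0, hqK, hqR, hqN⟩ := hpaths (ψ t1 y0) ⟨stays _ hy0Ω _ ht1pos.le, heq⟩
  have hNn : 0 ≤ N := (abs_nonneg _).trans (hqN 0 (by simp))
  set Δ := Y t1 - q 0 with hΔ
  have hΔ1 : Complex.exp Δ = 1 := by
    rw [hΔ, Complex.exp_sub, hq0, hYe' t1 ⟨ht1pos.le, le_rfl⟩, div_self]
    exact hneY t1 ⟨ht1pos.le, le_rfl⟩
  have hΔre : Δ.re = 0 := by
    obtain ⟨m, hm⟩ := Complex.exp_eq_one_iff.1 hΔ1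
    rw [hm]; simp
  have hYlow : ∀ s ∈ Icc 0 t1, (n:ℝ) * (LΓ s').im - 1 - Real.pi * n ^ 2 - B1 ≤ n * (Y s).im := by
    intro s hs
    have h1 := hgrow y0 s (fun t ht => (hle t ⟨ht.1, ht.2.trans hs.2⟩).trans_lt hεη) Y
      cY.continuousOn (fun t ht => hYe' t ⟨ht.1, ht.2.trans hs.2⟩) hs.1
    rw [hY0, Complex.sub_im, mul_sub, Complex.add_im] at h1
    have h2 := hlam2 1 (by simp)
    simp only [Complex.ofReal_one, one_mul] at h2
    have h3 := (abs_le.1 h2).1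
    have h4 : 0 ≤ Real.pi * n ^ 2 * (s / σ) := by
      have := div_nonneg hs.1 hσ.le
      positivity
    nlinarith
  have hNn' : 0 ≤ |(n:ℝ)| * N := by positivity
  have hpt : ∀ s ∈ Icc 0 t1, ∀ t ≥ 0, ψ s y0 ≠ ψ t c0 := by
    intro s hs t ht h
    have h1 : ψ t1 y0 = ψ (t1 - s + t) c0 := by
      rw [S.flow.add _ _ (by linarith [hs.2]) ht, ← h, ← S.flow.add _ _ (by linarith [hs.2]) hs.1,
        sub_add_cancel]
    have h2 := hcε (t1 - s + t) (by linarith [hs.2])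
    rw [← h1] at h2
    linarith
  have hexpz : ∀ t ≥ 0, z0 + Complex.exp (Lc t) = ψ t c0 := fun t ht => by
    rw [hLc' t ht]; ring
  have hexpΓ : ∀ s, z0 + Complex.exp (LΓ s) = Γ s := fun s => by rw [S.expL]; ring
  have hsegQ : ∀ v ∈ Icc (0:ℝ) 1, (n:ℝ) * (LΓ s').im - 1 ≤ n * (LΓ (s' + 0) + v * lam).im ∧
      n * (LΓ (s' + 0) + v * lam).im ≤ (n:ℝ) * (LΓ s').im + 1 := by
    intro v hv
    have h2 := abs_le.1 (hlam2 v hv)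
    rw [add_zero, Complex.add_im, mul_add]
    constructor <;> linarith
  have hB : 0 ≤ Real.pi * n ^ 2 + B1 := by
    have h1 := hgrow y0 0 (fun t ht => (hle t ⟨ht.1, ht.2.trans ht1pos.le⟩).trans_lt hεη) Y
      cY.continuousOn (fun t ht => hYe' t ⟨ht.1, ht.2.trans ht1pos.le⟩) le_rfl
    rw [sub_self, Complex.zero_im, mul_zero, zero_div] at h1
    linarith
  have := core_cross hnR he0 (A := fun s => LΓ (s' + s)) (Y := Y) (Qx := fun u => q u + Δ) (Qc := qc)
    (Lc := Lc) (lam := lam) (S.contL.comp (by fun_prop)) cY (by fun_prop) cqc cLc (t1 := t1) (Q := Q)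
    (R1 := R1) ht1pos.le (by rw [hY0, add_zero]) (by rw [hΔ]; ring) hLc0 (S.bot s') hLtop
    (fun s _ => hR1 _ (by rw [hexpΓ, Metric.infDist_zero_of_mem (mem_range_self _)]; exact hε.le))
    (fun v hv => by have := (hsegQ v hv).1; linarith)
    (fun s hs => by have := hYlow s hs; linarith)
    (fun u hu => by
      have h1 := hYlow t1 ⟨ht1pos.le, le_rfl⟩
      have h2 := hqN u hu
      have h3 : (q u + Δ).im = (Y t1).im + (q u - q 0).im := by rw [hΔ]; simp; ring
      have h4 : |(n:ℝ) * (q u - q 0).im| ≤ |(n:ℝ)| * N := by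
        rw [abs_mul]; exact mul_le_mul_of_nonneg_left h2 (abs_nonneg _)
      have h5 := (abs_le.1 h4).1
      rw [h3, mul_add]; linarith)
    (by rw [Complex.add_re, hΔre, add_zero]; exact hqR)
    (fun u hu => hQ ⟨u, hu, rfl⟩) hqcR
    (fun t ht => hR1 _ (by rw [hexpz t ht]; exact (hcε t ht).le))
  rcases this with ⟨s, -, u, hu, h⟩ | ⟨s, -, t, ht, h⟩ | ⟨v, hv, t, ht, h⟩ | ⟨s, hs, t, ht, h⟩ |
    ⟨u, hu, t, ht, h⟩
  · apply hqcK u hu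
    rw [← h, hexpΓ]; exact mem_range_self _
  · apply offK _ (stays _ hc0 t ht)
    rw [← hexpz t ht, ← h, hexpΓ]; exact mem_range_self _
  · have hval : z0 + Complex.exp (LΓ s' + v * lam) = ψ t c0 := by
      rw [← hexpz t ht, ← h, add_zero]
    have htT : t ≤ T := by
      by_contra hh
      have h1 := hT t (not_le.1 hh).le
      rw [← h] at h1
      linarith [(hsegQ v hv).2]
    have h2 := hlam3 v hv
    rw [hval] at h2
    have h3 := (Metric.infDist_le_dist_of_mem (mem_range_self s')).trans_lt
      (h2.trans_le (min_le_left _ _))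
    exact absurd h3 (not_lt.2 (hd1' t ⟨ht, htT⟩))
  · apply hpt s hs t ht
    have h1 := hYe' s hs
    rw [h, hLc' t ht] at h1
    exact (sub_left_injective h1).symm
  · have h1 := hqK u hu
    have h2 : Complex.exp (q u) = Complex.exp (Lc t) := by
      rw [← h, Complex.exp_add, hΔ1, mul_one]
    rw [h2, hexpz t ht] at h1
    exact absurd (hcη1 t ht) (not_lt.2 h1)

theorem intC_open {K : Set ℂ} (hK : IsClosed K) : IsOpen (intC K) := by
  rw [isOpen_iff_mem_nhds]
  intro z hz
  have hop := hK.isOpen_compl.connectedComponentIn (x := z)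
  filter_upwards [hop.mem_nhds (mem_connectedComponentIn hz.1)] with y hy
  refine ⟨connectedComponentIn_subset _ _ hy, ?_⟩
  rw [← connectedComponentIn_eq hy]; exact hz.2

theorem extC_open {K : Set ℂ} (hK : IsClosed K) : IsOpen (extC K) := by
  rw [isOpen_iff_mem_nhds]
  intro z hz
  have hop := hK.isOpen_compl.connectedComponentIn (x := z)
  filter_upwards [hop.mem_nhds (mem_connectedComponentIn hz.1)] with y hy
  refine ⟨connectedComponentIn_subset _ _ hy, ?_⟩
  rw [← connectedComponentIn_eq hy]; exact hz.2

theorem int_or_ext {K : Set ℂ} {z : ℂ} (hz : z ∉ K) : z ∈ intC K ∨ z ∈ extC K := by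
  by_cases h : IsBounded (connectedComponentIn Kᶜ z)
  · exact Or.inl ⟨hz, h⟩
  · exact Or.inr ⟨hz, h⟩

theorem intC_closed {K : Set ℂ} (hK : IsClosed K) : IsClosed (intC K ∪ K) := by
  have : intC K ∪ K = (extC K)ᶜ := by
    ext z
    constructor
    · rintro (h | h) h2
      · exact h2.2 h.2
      · exact h2.1 h
    · intro h
      by_cases hz : z ∈ K
      · exact Or.inr hz
      · exact Or.inl ((int_or_ext hz).resolve_right h)
  rw [this]; exact (extC_open hK).isClosed_compl

theorem extC_closed {K : Set ℂ} (hK : IsClosed K) : IsClosed (extC K ∪ K) := by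
  have : extC K ∪ K = (intC K)ᶜ := by
    ext z
    constructor
    · rintro (h | h) h2
      · exact h.2 h2.2
      · exact h2.1 h
    · intro h
      by_cases hz : z ∈ K
      · exact Or.inr hz
      · exact Or.inl ((int_or_ext hz).resolve_left h)
  rw [this]; exact (intC_open hK).isClosed_compl

theorem intC_disjoint (K : Set ℂ) : Disjoint (intC K) K := disjoint_left.2 fun _ h => h.1
theorem extC_disjoint (K : Set ℂ) : Disjoint (extC K) K := disjoint_left.2 fun _ h => h.1

theorem ext_paths {K : Set ℂ} (hK : IsClosed K) {z0 : ℂ} (hz0 : z0 ∈ intC K) {z : ℂ}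
    (hz : z ∈ extC K) (R : ℝ) : ∃ q : ℝ → ℂ, Continuous q ∧ Complex.exp (q 0) = z - z0 ∧
      (∀ u ∈ Icc (0:ℝ) 1, z0 + Complex.exp (q u) ∉ K) ∧ R ≤ 1 * (q 1).re := by
  obtain ⟨z', hz', hfar⟩ : ∃ z' ∈ connectedComponentIn Kᶜ z, Real.exp R ≤ ‖z' - z0‖ := by
    by_contra hcon
    push Not at hcon
    apply hz.2
    refine (Metric.isBounded_ball (x := z0) (r := Real.exp R)).subset fun y hy => ?_
    rw [Metric.mem_ball, dist_eq_norm]; exact hcon y hy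
  obtain ⟨Z, cZ, Z0, Z1, hZ⟩ := component_path hK hz'
  obtain ⟨q, cq, hq⟩ := exists_log_lift' (fun u => Z u - z0) (by fun_prop) (fun u h => by
    have h1 := hZ u
    rw [sub_eq_zero.1 h] at h1
    apply hz.2
    rw [connectedComponentIn_eq h1]; exact hz0.2)
  refine ⟨q, cq, by rw [hq, Z0], fun u _ => ?_, ?_⟩
  · rw [hq, add_sub_cancel]; exact connectedComponentIn_subset _ _ (hZ u)
  · have h1 := congrArg norm (hq 1)
    simp only [Complex.norm_exp, Z1] at h1
    rw [← h1, Real.exp_le_exp] at hfar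
    linarith

theorem int_paths {Γ : ℝ → ℂ} {σ : ℝ} (hΓ : IsLoop Γ σ) {z0 : ℂ} (hz0 : z0 ∈ intC (range Γ)) {z : ℂ}
    (hz : z ∈ intC (range Γ)) (hne : z ≠ z0) (R : ℝ) :
    ∃ q : ℝ → ℂ, Continuous q ∧ Complex.exp (q 0) = z - z0 ∧
      (∀ u ∈ Icc (0:ℝ) 1, z0 + Complex.exp (q u) ∉ range Γ) ∧ R ≤ (-1) * (q 1).re := by
  obtain ⟨Z, cZ, Z0, Z1, hZ⟩ := component_path hΓ.isCompact.isClosed (hΓ.int_connected hz hz0)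
  set ρ := min (Real.exp (-R)) (‖z - z0‖ / 2) with hρ
  have hzp : 0 < ‖z - z0‖ := norm_pos_iff.2 (sub_ne_zero.2 hne)
  have hρp : 0 < ρ := lt_min (Real.exp_pos _) (by linarith)
  have hρz : ρ < ‖z - z0‖ := (min_le_right _ _).trans_lt (by linarith)
  have cf : Continuous fun v => ‖Z v - z0‖ := by fun_prop
  have ivt : ∀ v, 0 ≤ v → ‖Z v - z0‖ ≤ ρ → ∃ w ∈ Icc 0 v, ‖Z w - z0‖ = ρ := by
    intro v hv h
    exact intermediate_value_Icc' hv cf.continuousOn ⟨h, by rw [Z0]; exact hρz.le⟩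
  obtain ⟨w, hw, hwρ⟩ := ivt 1 zero_le_one (by rw [Z1]; simpa using hρp.le)
  obtain ⟨u1, hu1, hmin⟩ := (isCompact_Icc.inter_right (isClosed_eq cf continuous_const :
    IsClosed {v | ‖Z v - z0‖ = ρ})).exists_isLeast ⟨w, hw, hwρ⟩
  have hu1' : ‖Z u1 - z0‖ = ρ := hu1.2
  have hnz : ∀ v ∈ Icc 0 u1, Z v - z0 ≠ 0 := by
    intro v hv h
    obtain ⟨w', hw', hw'ρ⟩ := ivt v hv.1 (by rw [h, norm_zero]; exact hρp.le)
    have h1 := hmin ⟨⟨hw'.1, hw'.2.trans (hv.2.trans hu1.1.2)⟩, hw'ρ⟩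
    have h2 : v = u1 := le_antisymm hv.2 (h1.trans hw'.2)
    rw [← h2, h, norm_zero] at hu1'
    linarith
  obtain ⟨q, cq, hq⟩ := exists_log_lift' (fun u => Z (max 0 (min u u1)) - z0) (by fun_prop)
    (fun u => hnz _ ⟨le_max_left _ _, max_le hu1.1.1 (min_le_right _ _)⟩)
  refine ⟨fun u => q (u * u1), by fun_prop, ?_, fun u hu => ?_, ?_⟩
  · simp only [zero_mul]; rw [hq, min_eq_left hu1.1.1, max_self, Z0]
  · simp only; rw [hq, add_sub_cancel]; exact connectedComponentIn_subset _ _ (hZ _)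
  · have h1 := congrArg norm (hq (1 * u1))
    simp only [Complex.norm_exp, one_mul, min_self, max_eq_right hu1.1.1, hu1'] at h1 ⊢
    have h2 : Real.exp (q u1).re ≤ Real.exp (-R) := by rw [h1]; exact min_le_left _ _
    rw [Real.exp_le_exp] at h2
    linarith

/-- Planar stability theorem. -/
theorem planar_stable {ψ : ℝ → ℂ → ℂ} {Γ : ℝ → ℂ} {σ : ℝ} (flow : IsPlaneFlow ψ) (loop : IsLoop Γ σ)
    (inv : ∀ t, 0 ≤ t → ∀ s, ψ t (Γ s) = Γ (s + t))
    (hext : ∀ η > 0, ∃ c0 ∈ extC (range Γ), ∀ t ≥ 0, Metric.infDist (ψ t c0) (range Γ) < η)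
    (hint : ∀ η > 0, ∃ c0 ∈ intC (range Γ), ∀ t ≥ 0, Metric.infDist (ψ t c0) (range Γ) < η) :
    ∀ ε > 0, ∃ δ > 0, ∀ z, Metric.infDist z (range Γ) < δ →
      ∀ t ≥ 0, Metric.infDist (ψ t z) (range Γ) < ε := by
  obtain ⟨z0, hz0⟩ := loop.exists_int
  obtain ⟨L, cL, hL⟩ := loop.exists_log hz0.1
  obtain ⟨n, hn⟩ := wind_int loop hL
  have S : IsSetup ψ Γ σ z0 L n := by
    refine ⟨flow, loop, inv, hz0.1, cL, hL, ?_, fun t => ?_⟩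
    · rintro rfl
      apply loop.wind_ne hz0 cL hL
      simpa [sub_eq_zero] using hn
    · have := loop.log_per cL hL t 0
      rw [zero_add, hn] at this
      rw [← this]; ring
  have hK := loop.isCompact.isClosed
  intro ε hε
  obtain ⟨δ1, hδ1, h1⟩ := S.key (extC_open hK) (extC_disjoint _) (extC_closed hK) (e := 1) (by simp)
    (fun z hz _ R => ext_paths hK hz0 hz R) hext ε hε
  obtain ⟨δ2, hδ2, h2⟩ := S.key (intC_open hK) (intC_disjoint _) (intC_closed hK) (e := -1) (by simp)
    (fun z hz hne R => int_paths loop hz0 hz hne R) hint ε hε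
  refine ⟨min δ1 δ2, lt_min hδ1 hδ2, fun z hz t ht => ?_⟩
  by_cases hzK : z ∈ range Γ
  · obtain ⟨s, rfl⟩ := hzK
    rw [inv t ht, Metric.infDist_zero_of_mem (mem_range_self _)]; exact hε
  · rcases int_or_ext hzK with h | h
    · exact h2 z h (hz.trans_le (min_le_right _ _)) t ht
    · exact h1 z h (hz.trans_le (min_le_left _ _)) t ht

theorem int_closure_point {K : Set ℂ} (hK : IsClosed K) {z : ℂ} (hz : z ∈ intC K) :
    ∃ w ∈ K, w ∈ closure (intC K) := by
  have hne : (frontier (connectedComponentIn Kᶜ z)).Nonempty := by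
    rw [nonempty_iff_ne_empty, Ne, frontier_eq_empty_iff]
    rintro (h | h)
    · have := mem_connectedComponentIn hz.1
      rw [h] at this; exact this
    · have := hz.2
      rw [h] at this
      exact NormedSpace.unbounded_univ ℝ ℂ this
  obtain ⟨w, hw⟩ := hne
  refine ⟨w, component_frontier hK z hw, closure_mono ?_ (frontier_subset_closure hw)⟩
  intro y hy
  refine ⟨connectedComponentIn_subset _ _ hy, ?_⟩
  rw [← connectedComponentIn_eq hy]; exact hz.2

theorem loop_subset_closure_int {ψ : ℝ → ℂ → ℂ} {Γ : ℝ → ℂ} {σ : ℝ} (flow : IsPlaneFlow ψ)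
    (loop : IsLoop Γ σ) (inv : ∀ t, 0 ≤ t → ∀ s, ψ t (Γ s) = Γ (s + t)) :
    range Γ ⊆ closure (intC (range Γ)) := by
  have hK := loop.isCompact.isClosed
  obtain ⟨z, hz⟩ := loop.exists_int
  obtain ⟨_, ⟨s, rfl⟩, hs⟩ := int_closure_point hK hz
  rintro _ ⟨t, rfl⟩
  obtain ⟨r, hr, m, hm⟩ := exists_mod loop.pos (t - s)
  have h1 : Γ t = ψ r (Γ s) := by
    rw [inv r hr.1, show t = s + r + m * σ by linarith, loop.per_int]
  have cψ : Continuous (ψ r) := flow.cont.comp (by fun_prop : Continuous fun z : ℂ => (r, z))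
  rw [h1]
  exact map_mem_closure cψ hs fun y hy =>
    orbit_stays flow inv (intC_open hK) (intC_disjoint _) (intC_closed hK) hy hr.1

theorem int_of_loop {Γ Γ' : ℝ → ℂ} {σ σ' : ℝ} (loop : IsLoop Γ σ) (loop' : IsLoop Γ' σ')
    (hd : Disjoint (range Γ') (range Γ)) (hsub : intC (range Γ') ⊆ intC (range Γ)) :
    range Γ' ⊆ intC (range Γ) := by
  have hK := loop.isCompact.isClosed
  obtain ⟨z, hz⟩ := loop'.exists_int
  obtain ⟨w, hw, hwc⟩ := int_closure_point loop'.isCompact.isClosed hz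
  have h1 : w ∈ intC (range Γ) ∪ range Γ :=
    (intC_closed hK).closure_subset_iff.2 subset_union_left (closure_mono hsub hwc)
  have h2 : w ∈ intC (range Γ) := h1.resolve_right (disjoint_left.1 hd hw)
  exact (isPreconnected_range loop'.cont).subset_left_of_subset_union (intC_open hK) (extC_open hK)
    (disjoint_left.2 fun x a b => b.2 a.2) (fun x hx => int_or_ext (disjoint_left.1 hd hx))
    ⟨w, hw, h2⟩

theorem ext_of_loop {K K' : Set ℂ} (hd : Disjoint K' K) (hsub : intC K ⊆ intC K') :
    K' ⊆ extC K := fun _ hw =>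
  (int_or_ext (disjoint_left.1 hd hw)).resolve_left fun h => (hsub h).1 hw

theorem loops_disjoint {ψ : ℝ → ℂ → ℂ} {Γ Γ' : ℝ → ℂ} {σ σ' : ℝ}
    (loop : IsLoop Γ σ) (inv : ∀ t, 0 ≤ t → ∀ s, ψ t (Γ s) = Γ (s + t)) (loop' : IsLoop Γ' σ')
    (inv' : ∀ t, 0 ≤ t → ∀ s, ψ t (Γ' s) = Γ' (s + t)) (hne : range Γ' ≠ range Γ) :
    Disjoint (range Γ') (range Γ) := by
  rw [disjoint_left]
  rintro _ ⟨s, rfl⟩ ⟨t, hst⟩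
  apply hne
  have aux : ∀ {Γ Γ' : ℝ → ℂ} {σ σ' : ℝ}, IsLoop Γ σ →
      (∀ t, 0 ≤ t → ∀ s, ψ t (Γ s) = Γ (s + t)) →
      (∀ t, 0 ≤ t → ∀ s, ψ t (Γ' s) = Γ' (s + t)) → ∀ s t, Γ t = Γ' s → range Γ ⊆ range Γ' := by
    rintro Γ Γ' σ σ' loop inv inv' s t hst _ ⟨u, rfl⟩
    obtain ⟨r, hr, m, hm⟩ := exists_mod loop.pos (u - t)
    refine ⟨s + r, ?_⟩
    rw [← inv' r hr.1, ← hst, inv r hr.1, show u = t + r + m * σ by linarith, loop.per_int]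
  exact Subset.antisymm (aux (σ' := σ) loop' inv' inv t s hst.symm)
    (aux (σ' := σ') loop inv inv' s t hst)

theorem orbit_eventually_near {f : ℝ → ℂ} (hf : Continuous f) {K : Set ℂ} (hK : IsCompact K)
    (h1 : ∀ y, MapClusterPt y atTop f → y ∈ K) {y0 : ℂ} (hy0K : y0 ∈ K) (h2 : MapClusterPt y0 atTop f)
    {η : ℝ} (hη : 0 < η) : ∀ᶠ t in atTop, Metric.infDist (f t) K < η := by
  have cd : Continuous fun t => Metric.infDist (f t) K := (Metric.continuous_infDist_pt K).comp hf
  by_contra hcon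
  rw [not_eventually] at hcon
  have hfreq : ∃ᶠ t in atTop, Metric.infDist (f t) K < η := by
    have := mapClusterPt_iff_frequently.1 h2 _ (Metric.ball_mem_nhds y0 hη)
    exact this.mono fun t ht => (Metric.infDist_le_dist_of_mem hy0K).trans_lt ht
  have hlev : ∃ᶠ t in atTop, f t ∈ {z | Metric.infDist z K = η} := by
    rw [frequently_atTop]
    intro a
    obtain ⟨b, hb, hb'⟩ := frequently_atTop.1 hfreq a
    obtain ⟨c, hc, hc'⟩ := frequently_atTop.1 hcon b
    obtain ⟨t, ht, e⟩ := intermediate_value_Icc hc cd.continuousOn ⟨hb'.le, not_lt.1 hc'⟩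
    exact ⟨t, hb.trans ht.1, e⟩
  have hcomp : IsCompact {z | Metric.infDist z K = η} := by
    refine (hK.cthickening (r := η)).of_isClosed_subset
      (isClosed_eq (Metric.continuous_infDist_pt K) continuous_const) fun z hz => ?_
    rw [Metric.mem_cthickening_iff,
      ENNReal.le_ofReal_iff_toReal_le (Metric.infEDist_ne_top ⟨y0, hy0K⟩) hη.le]
    exact (show Metric.infDist z K = η from hz).le
  obtain ⟨y, hy, hyc⟩ := hcomp.exists_mapClusterPt_of_frequently hlev
  have h3 := Metric.infDist_zero_of_mem (h1 y hyc)
  have h4 : Metric.infDist y K = η := hy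
  linarith

/-- The quadratic form data in planar coordinates. -/
structure IsCoord {E : Type*} [NormedAddCommGroup E] [NormedSpace ℝ E]
    (P : E →L[ℝ] E →L[ℝ] ℝ) (p : E →L[ℝ] ℂ) (j : ℂ →L[ℝ] E) (CP M c : ℝ) : Prop where
  CPpos : 0 < CP
  Mpos : 0 < M
  cpos : 0 < c
  bound : ∀ v, |P v v| ≤ CP * ‖v‖ ^ 2
  low : ∀ v, -P v v ≤ M * ‖p v‖ ^ 2
  pj : ∀ ξ, p (j ξ) = ξ
  high : ∀ ξ, c * ‖ξ‖ ^ 2 ≤ -P (j ξ) (j ξ)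

theorem exists_coord {E : Type*} [NormedAddCommGroup E] [NormedSpace ℝ E]
    {P : E →L[ℝ] E →L[ℝ] ℝ} {Eplus Eminus : Submodule ℝ E} (h1 : Semiflow.IsH1 P Eplus Eminus)
    [FiniteDimensional ℝ ↥Eminus] (h2 : Module.finrank ℝ ↥Eminus = 2) {Pi : E → E}
    (hPi : Semiflow.IsVProjector P Eminus Pi) :
    ∃ (e : ↥Eminus ≃L[ℝ] ℂ) (p : E →L[ℝ] ℂ) (j : ℂ →L[ℝ] E) (CP M c : ℝ), IsCoord P p j CP M c ∧
      (∀ v, Pi v = (e.symm (p v) : E)) := by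
  obtain ⟨hsymm, -, -, hcompl, hpos, hneg⟩ := h1
  let e : ↥Eminus ≃L[ℝ] ℂ := ContinuousLinearEquiv.ofFinrankEq (by rw [h2, Complex.finrank_real_complex])
  let res : E →L[ℝ] (↥Eminus →L[ℝ] ℝ) :=
    (ContinuousLinearMap.compL ℝ ↥Eminus E ℝ).flip Eminus.subtypeL ∘L P
  have hres : ∀ v (w : ↥Eminus), res v w = P v w := fun v w => rfl
  let B : ↥Eminus →ₗ[ℝ] (↥Eminus →L[ℝ] ℝ) := (res ∘L Eminus.subtypeL : ↥Eminus →L[ℝ] _)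
  have hB : ∀ (u w : ↥Eminus), B u w = P u w := fun u w => rfl
  have hker : LinearMap.ker B = ⊥ := by
    rw [LinearMap.ker_eq_bot']
    intro u hu
    by_contra hne
    have h3 := hneg u u.2 (by simpa using hne)
    rw [← hB, hu] at h3
    simp at h3
  obtain ⟨g, hg⟩ := LinearMap.exists_leftInverse_of_injective B hker
  let G : (↥Eminus →L[ℝ] ℝ) →L[ℝ] ↥Eminus := LinearMap.toContinuousLinearMap g
  let p : E →L[ℝ] ℂ := (e : ↥Eminus →L[ℝ] ℂ) ∘L G ∘L res
  let j : ℂ →L[ℝ] E := Eminus.subtypeL ∘L (e.symm : ℂ →L[ℝ] ↥Eminus)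
  have hp : ∀ v, e.symm (p v) = g (res v) := fun v => by
    simp [p, G]
  have hgB : ∀ u, g (B u) = u := fun u => by
    have := LinearMap.congr_fun hg u
    simpa using this
  have hPiv : ∀ v, Pi v = (e.symm (p v) : E) := by
    intro v
    obtain ⟨m1, m2⟩ := hPi v
    have h3 : res v = B ⟨Pi v, m1⟩ := by
      ext w
      rw [hres, hB, hsymm, m2 w w.2, hsymm]
    rw [hp, h3, hgB]
  have hj : ∀ ξ, j ξ = (e.symm ξ : E) := fun ξ => rfl
  have hjp : ∀ v, j (p v) = Pi v := fun v => by rw [hj, hPiv]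
  have hjm : ∀ ξ, j ξ ∈ Eminus := fun ξ => (e.symm ξ).2
  have hpj : ∀ ξ, p (j ξ) = ξ := by
    intro ξ
    have h3 : res (j ξ) = B (e.symm ξ) := by ext w; rfl
    apply e.symm.injective
    rw [hp, h3, hgB]
  have hV : ∀ v, P (Pi v) (Pi v) ≤ P v v := by
    intro v
    obtain ⟨m1, m2⟩ := hPi v
    set m := Pi v
    set u := v - m with hu
    have horth : ∀ w ∈ Eminus, P w u = 0 := fun w hw => by
      rw [hu, map_sub, m2 w hw, sub_self]
    have hu0 : 0 ≤ P u u := by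
      have htop : u ∈ Eplus ⊔ Eminus := by rw [hcompl.sup_eq_top]; trivial
      obtain ⟨a, ha, b, hb, hab⟩ := Submodule.mem_sup.1 htop
      have h3 := horth b hb
      rw [← hab, map_add] at h3
      have h4 : 0 ≤ P a a := by
        by_cases h : a = 0
        · simp [h]
        · exact (hpos a ha h).le
      have h5 : P b b ≤ 0 := by
        by_cases h : b = 0
        · simp [h]
        · exact (hneg b hb h).le
      have h6 := hsymm a b
      rw [← hab]
      simp only [map_add, ContinuousLinearMap.add_apply]
      linarith
    have h3 := horth m m1
    have h4 := hsymm m u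
    have e1 : v = m + u := by rw [hu]; abel
    rw [e1]
    simp only [map_add, ContinuousLinearMap.add_apply]
    linarith
  have hCP : ∀ v, |P v v| ≤ (‖P‖ + 1) * ‖v‖ ^ 2 := by
    intro v
    have h3 := P.le_opNorm₂ v v
    rw [Real.norm_eq_abs] at h3
    nlinarith [sq_nonneg ‖v‖]
  obtain ⟨c, hc, hc2⟩ : ∃ c > 0, ∀ ξ : ℂ, c * ‖ξ‖ ^ 2 ≤ -P (j ξ) (j ξ) := by
    obtain ⟨ξ0, hξ0, hmin⟩ := (isCompact_sphere (0:ℂ) 1).exists_isMinOn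
      ⟨1, by simp⟩ (f := fun ξ => -P (j ξ) (j ξ)) (by apply Continuous.continuousOn; fun_prop)
    have hξ0n : ξ0 ≠ 0 := by rintro rfl; simp at hξ0
    refine ⟨-P (j ξ0) (j ξ0), ?_, fun ξ => ?_⟩
    · have := hneg (j ξ0) (hjm _) (fun h => hξ0n (by
        have := hpj ξ0; rw [h, map_zero] at this; exact this.symm))
      linarith
    · by_cases hξ : ξ = 0
      · simp [hξ]
      · have hn : 0 < ‖ξ‖ := norm_pos_iff.2 hξ
        have h3 := hmin (show (‖ξ‖⁻¹ • ξ) ∈ Metric.sphere (0:ℂ) 1 by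
          rw [mem_sphere_zero_iff_norm, norm_smul, norm_inv, norm_norm, inv_mul_cancel₀ hn.ne'])
        simp only [mem_ofPred_eq, map_smul, ContinuousLinearMap.smul_apply, smul_eq_mul] at h3
        calc _ ≤ -(‖ξ‖⁻¹ * (‖ξ‖⁻¹ * P (j ξ) (j ξ))) * ‖ξ‖ ^ 2 :=
              mul_le_mul_of_nonneg_right h3 (sq_nonneg _)
          _ = _ := by field_simp
  refine ⟨e, p, j, ‖P‖ + 1, (‖P‖ + 1) * (‖j‖ + 1) ^ 2, c, ⟨by positivity, by positivity, hc, hCP, ?_, hpj, hc2⟩,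
    hPiv⟩
  intro v
  have h3 := hV v
  have h4 := (abs_le.1 (hCP (Pi v))).1
  have h5 : ‖Pi v‖ ≤ (‖j‖ + 1) * ‖p v‖ := by
    rw [← hjp]
    exact (j.le_opNorm _).trans (mul_le_mul_of_nonneg_right (by linarith) (norm_nonneg _))
  have h6 : ‖Pi v‖ ^ 2 ≤ ((‖j‖ + 1) * ‖p v‖) ^ 2 := pow_le_pow_left₀ (norm_nonneg _) h5 2
  have h7 := mul_le_mul_of_nonneg_left h6 (by positivity : 0 ≤ ‖P‖ + 1)
  calc -P v v ≤ (‖P‖ + 1) * ‖Pi v‖ ^ 2 := by linarith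
    _ ≤ _ := h7
    _ = _ := by ring

theorem surj_of_expanding {f : ℂ → ℂ} (hf : Continuous f) {κ : ℝ} (hκ : 0 < κ)
    (hexp : ∀ x y, κ * ‖x - y‖ ≤ ‖f x - f y‖) : Function.Surjective f := by
  intro ζ
  by_contra hζ
  push Not at hζ
  obtain ⟨L, cL, hL⟩ := exists_log_lift' (fun z => f z - ζ) (by fun_prop)
    (fun z h => hζ z (sub_eq_zero.1 h))
  set R : ℝ := (‖ζ - f 0‖ + 1) / κ with hR
  have hRp : 0 < R := by positivity
  let cir : ℝ → ℂ := fun θ => R * Complex.exp (θ * Complex.I)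
  have ccir : Continuous cir := by simp only [cir]; fun_prop
  have ncir : ∀ θ, ‖cir θ‖ = R := fun θ => by
    simp only [cir, norm_mul, Complex.norm_exp_ofReal_mul_I, mul_one, Complex.norm_real,
      Real.norm_of_nonneg hRp.le]
  have cirne : ∀ θ, cir θ ≠ 0 := fun θ h => by
    have := ncir θ; rw [h, norm_zero] at this; linarith
  let μ : ℝ → ℝ := fun l => min (max l 0) 1
  let μ' : ℝ → ℝ := fun l => min (max (-l) 0) 1
  let G : ℝ × ℝ → ℂ := fun x => f (cir x.2) - (f (-(μ x.1 : ℂ) * cir x.2) + μ' x.1 * (ζ - f 0))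
  have cμ : Continuous μ := by simp only [μ]; fun_prop
  have cμ' : Continuous μ' := by simp only [μ']; fun_prop
  have cG : Continuous G := by
    simp only [G]
    have : Continuous fun x : ℝ × ℝ => (μ x.1 : ℂ) := Complex.continuous_ofReal.comp (by fun_prop)
    have : Continuous fun x : ℝ × ℝ => (μ' x.1 : ℂ) := Complex.continuous_ofReal.comp (by fun_prop)
    fun_prop
  have G0 : ∀ x, G x ≠ 0 := by
    rintro ⟨l, θ⟩ h
    simp only [G] at h
    rcases le_total 0 l with hl | hl
    · have h1 : μ' l = 0 := by simp [μ', hl]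
      rw [h1, Complex.ofReal_zero, zero_mul, add_zero] at h
      have h2 := hexp (cir θ) (-(μ l : ℂ) * cir θ)
      rw [h, norm_zero] at h2
      have h3 : cir θ - -(μ l : ℂ) * cir θ = ((1 + μ l : ℝ) : ℂ) * cir θ := by push_cast; ring
      have h4 : 0 ≤ μ l := le_min (le_max_right _ _) zero_le_one
      rw [h3, norm_mul, ncir, Complex.norm_real, Real.norm_of_nonneg (by linarith)] at h2
      have : 0 < κ * ((1 + μ l) * R) := by positivity
      linarith
    · have h1 : μ l = 0 := by simp [μ, hl]
      rw [h1, Complex.ofReal_zero, neg_zero, zero_mul] at h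
      have h2 := hexp (cir θ) 0
      rw [sub_zero, ncir] at h2
      have h3 : f (cir θ) - f 0 = μ' l * (ζ - f 0) := by linear_combination h
      have h4 : 0 ≤ μ' l := le_min (le_max_right _ _) zero_le_one
      have h5 : μ' l ≤ 1 := min_le_right _ _
      rw [h3, norm_mul, Complex.norm_real, Real.norm_of_nonneg h4, hR] at h2
      have h6 : κ * ((‖ζ - f 0‖ + 1) / κ) = ‖ζ - f 0‖ + 1 := by field_simp
      rw [h6] at h2
      nlinarith [norm_nonneg (ζ - f 0)]
  obtain ⟨ℒ, cℒ, hℒ⟩ := exists_log_lift' G cG G0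
  have per : ∀ θ, cir (θ + 2 * Real.pi) = cir θ := fun θ => by
    simp only [cir]; push_cast
    rw [add_mul, Complex.exp_add, Complex.exp_two_pi_mul_I, mul_one]
  have anti : ∀ θ, cir (θ + Real.pi) = -cir θ := fun θ => by
    simp only [cir]; push_cast
    rw [add_mul, Complex.exp_add, Complex.exp_pi_mul_I]; ring
  -- winding constant
  have hw := const_of_exp_eq_one (s := (univ : Set (ℝ × ℝ))) isPreconnected_univ
    (g := fun x => ℒ (x.1, x.2 + 2 * Real.pi) - ℒ x) (by fun_prop) (fun x _ => by
      rw [Complex.exp_sub, hℒ, hℒ]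
      have : G (x.1, x.2 + 2 * Real.pi) = G x := by simp only [G, per]
      rw [this, div_self (G0 x)]) (mem_univ (1, 0)) (mem_univ (-1, 0))
  have hL1 := const_of_exp_eq_one (s := (univ : Set ℝ)) isPreconnected_univ
    (g := fun θ => ℒ (-1, θ) - L (cir θ)) (by fun_prop) (fun θ _ => by
      rw [Complex.exp_sub, hℒ, hL]
      have : G (-1, θ) = f (cir θ) - ζ := by simp [G, μ, μ']
      rw [this, div_self (sub_ne_zero.2 (hζ _))]) (mem_univ (0 + 2 * Real.pi)) (mem_univ 0)
  simp only [per] at hL1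
  have hm : ∀ θ, Complex.exp (ℒ (1, θ + Real.pi) - ℒ (1, θ)) = -1 := fun θ => by
    rw [Complex.exp_sub, hℒ, hℒ]
    have : G (1, θ + Real.pi) = - G (1, θ) := by simp [G, μ, μ', anti]
    rw [this, neg_div, div_self (G0 _)]
  have hm2 := const_of_exp_eq_one (s := (univ : Set ℝ)) isPreconnected_univ
    (g := fun θ => ℒ (1, θ + Real.pi) - ℒ (1, θ) - Real.pi * Complex.I) (by fun_prop) (fun θ _ => by
      rw [Complex.exp_sub, hm, Complex.exp_pi_mul_I, div_self]; norm_num) (mem_univ Real.pi) (mem_univ 0)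
  simp only [zero_add, ← two_mul] at hm2 hw hL1
  have h5 := hm 0
  rw [zero_add] at h5
  have h6 : ℒ (1, Real.pi) - ℒ (1, 0) = 0 := by
    linear_combination (1/2 : ℂ) * hw - (1/2:ℂ) * hm2 + (1/2 : ℂ) * hL1
  rw [h6, Complex.exp_zero] at h5
  norm_num at h5

section Analytic
variable {E : Type*} [NormedAddCommGroup E] [NormedSpace ℝ E]
variable {H : Type*} [NormedAddCommGroup H] [InnerProductSpace ℝ H]

/-- All standing hypotheses, in planar coordinates. -/
structure IsSys (φ : Semiflow E) (ι : E →L[ℝ] H) (P : E →L[ℝ] E →L[ℝ] ℝ) (p : E →L[ℝ] ℂ)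
    (j : ℂ →L[ℝ] E) (δ τV ν τC τS C CP M c : ℝ) : Prop where
  coord : IsCoord P p j CP M c
  inj : Function.Injective ι
  δpos : 0 < δ
  τVnn : 0 ≤ τV
  νpos : 0 < ν
  h3 : ∀ v₁ v₂ : E, ∀ l r : ℝ, 0 ≤ l → l ≤ r → τV ≤ r - l →
      Real.exp (2 * ν * r) *
          P (φ.toFun r v₁ - φ.toFun r v₂) (φ.toFun r v₁ - φ.toFun r v₂) -
        Real.exp (2 * ν * l) *
          P (φ.toFun l v₁ - φ.toFun l v₂) (φ.toFun l v₁ - φ.toFun l v₂) ≤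
      -δ * ∫ s in l..r, Real.exp (2 * ν * s) * ‖ι (φ.toFun s v₁) - ι (φ.toFun s v₂)‖ ^ 2
  τCpos : 0 < τC
  com : ∀ B : Set E, IsBounded B → IsCompact (closure (φ.toFun τC '' B))
  τSnn : 0 ≤ τS
  Cpos : 0 < C
  smooth : ∀ v₁ v₂ : E, ‖φ.toFun τS v₁ - φ.toFun τS v₂‖ ≤ C * ‖ι v₁ - ι v₂‖

/-- A trajectory defined from time `a` on. -/
def TrajFrom (φ : Semiflow E) (a : ℝ) (v : ℝ → E) : Prop :=
  ∀ t, 0 ≤ t → ∀ s, a ≤ s → v (t + s) = φ.toFun t (v s)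

theorem complete_trajFrom {φ : Semiflow E} {v : ℝ → E} (h : φ.IsCompleteTrajectory v) (a : ℝ) :
    TrajFrom φ a v := fun t ht s _ => h.2 t ht s

theorem traj_continuousOn {φ : Semiflow E} {v : ℝ → E} {a : ℝ} (h : TrajFrom φ a v) :
    ContinuousOn v (Ici a) := by
  have h1 : ContinuousOn (fun t => φ.toFun (t - a) (v a)) (Ici a) := by
    have := φ.continuousOn'.comp (f := fun t : ℝ => (t - a, v a)) (s := Ici a) (by fun_prop)
      (fun t ht => ⟨by simpa using ht, mem_univ _⟩)
    exact this
  refine h1.congr fun t ht => ?_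
  show v t = φ.toFun (t - a) (v a)
  rw [← h (t - a) (sub_nonneg.2 ht) a le_rfl, sub_add_cancel]

theorem flow_tube (φ : Semiflow E) {K : Set (ℝ × E)} (hK : IsCompact K) (hK0 : K ⊆ Ici 0 ×ˢ univ)
    {r : ℝ} (hr : 0 < r) : ∃ η > 0, ∀ a x, (a, x) ∈ K → ∀ y, ‖y - x‖ < η →
      ‖φ.toFun a y - φ.toFun a x‖ < r := by
  have hc : Continuous fun q : ℝ × E => φ.toFun (max q.1 0) q.2 := by
    rw [← continuousOn_univ]
    exact φ.continuousOn'.comp (f := fun q : ℝ × E => (max q.1 0, q.2)) (by fun_prop)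
      (fun q _ => ⟨mem_Ici.2 (le_max_right q.1 0), mem_univ _⟩)
  have := hK.uniformContinuousAt_of_continuousAt
    (fun q : ℝ × E => φ.toFun (max q.1 0) q.2) (fun a _ => hc.continuousAt) (Metric.dist_mem_uniformity hr)
  obtain ⟨η, hη, h⟩ := Metric.mem_uniformity_dist.1 this
  refine ⟨η, hη, fun a x hx y hy => ?_⟩
  have h1 := @h (a, x) (a, y) (by
    rw [Prod.dist_eq]; simp only [dist_self]; rw [dist_comm, dist_eq_norm]; exact max_lt hη hy) hx
  have h2 : (0:ℝ) ≤ a := (hK0 hx).1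
  simp only [mem_ofPred_eq, max_eq_left h2] at h1
  rwa [dist_comm, dist_eq_norm] at h1

variable {φ : Semiflow E} {ι : E →L[ℝ] H} {P : E →L[ℝ] E →L[ℝ] ℝ} {p : E →L[ℝ] ℂ}
    {j : ℂ →L[ℝ] E} {δ τV ν τC τS C CP M c : ℝ}

/-- (H3) for trajectories. -/
theorem IsSys.h3_traj (S : IsSys φ ι P p j δ τV ν τC τS C CP M c) {a : ℝ} {v1 v2 : ℝ → E}
    (h1 : TrajFrom φ a v1) (h2 : TrajFrom φ a v2) {l r : ℝ} (hal : a ≤ l) (hlr : l ≤ r)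
    (hτ : τV ≤ r - l) :
    Real.exp (2 * ν * r) * P (v1 r - v2 r) (v1 r - v2 r) -
      Real.exp (2 * ν * l) * P (v1 l - v2 l) (v1 l - v2 l) ≤
      -δ * ∫ s in l..r, Real.exp (2 * ν * s) * ‖ι (v1 s - v2 s)‖ ^ 2 := by
  have h := S.h3 (v1 l) (v2 l) 0 (r - l) le_rfl (by linarith) (by linarith)
  rw [← h1 _ (by linarith) l hal, ← h2 _ (by linarith) l hal, ← h1 _ le_rfl l hal,
    ← h2 _ le_rfl l hal, sub_add_cancel, zero_add, mul_zero, Real.exp_zero, one_mul] at h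
  have h4 : ∫ s in l..r, Real.exp (2 * ν * s) * ‖ι (v1 s - v2 s)‖ ^ 2 =
      Real.exp (2 * ν * l) * ∫ s in (0:ℝ)..(r - l),
        Real.exp (2 * ν * s) * ‖ι (φ.toFun s (v1 l)) - ι (φ.toFun s (v2 l))‖ ^ 2 := by
    rw [← intervalIntegral.integral_const_mul]
    have := intervalIntegral.integral_comp_add_right (a := 0) (b := r - l)
      (fun s => Real.exp (2 * ν * s) * ‖ι (v1 s - v2 s)‖ ^ 2) l
    rw [zero_add, sub_add_cancel] at this
    rw [← this]
    apply intervalIntegral.integral_congr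
    intro s hs
    rw [uIcc_of_le (by linarith)] at hs
    simp only
    rw [h1 s hs.1 l hal, h2 s hs.1 l hal, map_sub, mul_add, Real.exp_add]
    ring
  rw [h4]
  have h5 : Real.exp (2 * ν * r) = Real.exp (2 * ν * l) * Real.exp (2 * ν * (r - l)) := by
    rw [← Real.exp_add]; congr 1; ring
  rw [h5]
  have := mul_le_mul_of_nonneg_left h (Real.exp_pos (2 * ν * l)).le
  nlinarith

/-- smoothing for trajectories -/
theorem IsSys.smooth_traj (S : IsSys φ ι P p j δ τV ν τC τS C CP M c) {a : ℝ} {v1 v2 : ℝ → E}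
    (h1 : TrajFrom φ a v1) (h2 : TrajFrom φ a v2) {l : ℝ} (hal : a ≤ l) :
    ‖v1 (τS + l) - v2 (τS + l)‖ ≤ C * ‖ι (v1 l - v2 l)‖ := by
  rw [h1 _ S.τSnn _ hal, h2 _ S.τSnn _ hal, map_sub]; exact S.smooth _ _

theorem diff_integrable {v1 v2 : ℝ → E} (h1 : φ.IsAmenableTrajectory ι ν v1)
    (h2 : φ.IsAmenableTrajectory ι ν v2) :
    IntegrableOn (fun s : ℝ => Real.exp (2 * ν * s) * ‖ι (v1 s - v2 s)‖ ^ 2) (Iic 0) := by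
  have c1 := h1.1.1
  have c2 := h2.1.1
  refine Integrable.mono' ((h1.2.const_mul 2).add (h2.2.const_mul 2)) ?_ ?_
  · apply Continuous.aestronglyMeasurable; fun_prop
  · refine Eventually.of_forall fun s => ?_
    rw [Real.norm_of_nonneg (by positivity)]
    simp only [Pi.add_apply]
    have h3 : ‖ι (v1 s - v2 s)‖ ≤ ‖ι (v1 s)‖ + ‖ι (v2 s)‖ := by rw [map_sub]; exact norm_sub_le _ _
    have h4 : ‖ι (v1 s - v2 s)‖ ^ 2 ≤ 2 * ‖ι (v1 s)‖ ^ 2 + 2 * ‖ι (v2 s)‖ ^ 2 := by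
      nlinarith [norm_nonneg (ι (v1 s - v2 s)), sq_nonneg (‖ι (v1 s)‖ - ‖ι (v2 s)‖)]
    nlinarith [Real.exp_pos (2 * ν * s)]

/-- Smallness of an integrable function somewhere near `-∞`. -/
theorem exists_small {f : ℝ → ℝ} (hf : IntegrableOn f (Iic 0)) {η : ℝ} (hη : 0 < η) (b : ℝ) :
    ∃ l ≤ b, f l < η := by
  by_contra hcon
  push Not at hcon
  have h1 : IntegrableOn f (Iic (min b 0)) := hf.mono_set (Iic_subset_Iic.2 (min_le_right _ _))
  have h2 : IntegrableOn (fun _ : ℝ => η) (Iic (min b 0)) := by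
    refine Integrable.mono h1 aestronglyMeasurable_const ?_
    refine (ae_restrict_iff' measurableSet_Iic).2 (Eventually.of_forall fun s hs => ?_)
    have := hcon s (le_trans hs (min_le_left _ _))
    rw [Real.norm_of_nonneg hη.le, Real.norm_of_nonneg (hη.le.trans this)]
    exact this
  rw [integrableOn_const_iff] at h2
  simp [hη.ne'] at h2

theorem IsSys.main_est (S : IsSys φ ι P p j δ τV ν τC τS C CP M c) {v1 v2 : ℝ → E}
    (h1 : φ.IsAmenableTrajectory ι ν v1) (h2 : φ.IsAmenableTrajectory ι ν v2) {s : ℝ} (hs : s ≤ 0) :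
    δ * ∫ r in s..0, Real.exp (2 * ν * r) * ‖ι (v1 r - v2 r)‖ ^ 2 ≤ M * ‖p (v1 0 - v2 0)‖ ^ 2 := by
  have c1 := h1.1.1
  have c2 := h2.1.1
  have hlow := S.coord.low (v1 0 - v2 0)
  refine le_trans ?_ hlow
  apply le_of_forall_pos_le_add
  intro η hη
  set K0 := Real.exp (2 * ν * τS) * CP * C ^ 2 with hK0
  have hK0p : 0 < K0 := by
    have := S.coord.CPpos
    have := S.Cpos
    positivity
  obtain ⟨l, hl, hlη⟩ := exists_small (diff_integrable h1 h2) (div_pos hη hK0p) (min s (-τV) - τS)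
  have hls : τS + l ≤ s := by linarith [min_le_left s (-τV)]
  have hlV : τS + l ≤ -τV := by linarith [min_le_right s (-τV)]
  have t1 := complete_trajFrom h1.1 l
  have t2 := complete_trajFrom h2.1 l
  have hsm := S.smooth_traj t1 t2 le_rfl
  have h3 := S.h3_traj t1 t2 (l := τS + l) (r := 0) (by linarith [S.τSnn]) (by linarith)
    (by linarith)
  rw [mul_zero, Real.exp_zero, one_mul] at h3
  have h4 := S.coord.bound (v1 (τS + l) - v2 (τS + l))
  have h5 : Real.exp (2 * ν * (τS + l)) * P (v1 (τS + l) - v2 (τS + l)) (v1 (τS + l) - v2 (τS + l)) ≤ η := by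
    have h6 : ‖v1 (τS + l) - v2 (τS + l)‖ ^ 2 ≤ C ^ 2 * ‖ι (v1 l - v2 l)‖ ^ 2 := by
      rw [← mul_pow]; exact pow_le_pow_left₀ (norm_nonneg _) hsm 2
    have h7 : P (v1 (τS + l) - v2 (τS + l)) (v1 (τS + l) - v2 (τS + l)) ≤
        CP * (C ^ 2 * ‖ι (v1 l - v2 l)‖ ^ 2) :=
      (le_abs_self _).trans (h4.trans (mul_le_mul_of_nonneg_left h6 S.coord.CPpos.le))
    calc _ ≤ Real.exp (2 * ν * (τS + l)) * (CP * (C ^ 2 * ‖ι (v1 l - v2 l)‖ ^ 2)) :=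
          mul_le_mul_of_nonneg_left h7 (Real.exp_pos _).le
      _ = K0 * (Real.exp (2 * ν * l) * ‖ι (v1 l - v2 l)‖ ^ 2) := by
          rw [mul_add, Real.exp_add, hK0]; ring
      _ ≤ K0 * (η / K0) := mul_le_mul_of_nonneg_left hlη.le hK0p.le
      _ = η := by field_simp
  have h8 : ∫ r in s..0, Real.exp (2 * ν * r) * ‖ι (v1 r - v2 r)‖ ^ 2 ≤
      ∫ r in (τS + l)..0, Real.exp (2 * ν * r) * ‖ι (v1 r - v2 r)‖ ^ 2 := by
    apply intervalIntegral.integral_mono_interval hls hs le_rfl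
    · exact Eventually.of_forall fun r => by positivity
    · apply Continuous.intervalIntegrable; fun_prop
  have h9 := mul_le_mul_of_nonneg_left h8 S.δpos.le
  linarith

/-- Mean value: some small value on a unit interval. -/
theorem exists_le_of_integral {g : ℝ → ℝ} {a A : ℝ} (hg : ContinuousOn g (Icc a (a + 1)))
    (h : ∫ r in a..(a + 1), g r ≤ A) : ∃ r ∈ Icc a (a + 1), g r ≤ A := by
  by_contra hcon
  push Not at hcon
  have h1 : a ≤ a + 1 := by linarith
  have hi : IntervalIntegrable g volume a (a + 1) := by
    apply ContinuousOn.intervalIntegrable; rwa [uIcc_of_le h1]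
  have h2 : ∫ r in a..(a + 1), A < ∫ r in a..(a + 1), g r := by
    apply intervalIntegral.integral_lt_integral_of_continuousOn_of_le_of_exists_lt (by linarith)
      continuousOn_const hg (fun r hr => (hcon r ⟨hr.1.le, hr.2⟩).le)
      ⟨a, ⟨le_rfl, h1⟩, hcon a ⟨le_rfl, h1⟩⟩
  simp at h2
  linarith
end Analytic

section Analytic2
variable {E : Type*} [NormedAddCommGroup E] [NormedSpace ℝ E]
variable {H : Type*} [NormedAddCommGroup H] [InnerProductSpace ℝ H]
variable {φ : Semiflow E} {ι : E →L[ℝ] H} {P : E →L[ℝ] E →L[ℝ] ℝ} {p : E →L[ℝ] ℂ}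
    {j : ℂ →L[ℝ] E} {δ τV ν τC τS C CP M c : ℝ}

theorem amen_shift {v : ℝ → E} (h : φ.IsAmenableTrajectory ι ν v) (t : ℝ) :
    φ.IsAmenableTrajectory ι ν (fun s => v (s + t)) := by
  have hc := h.1.1
  refine ⟨⟨by fun_prop, fun r hr s => ?_⟩, ?_⟩
  · show v (r + s + t) = φ.toFun r (v (s + t))
    rw [add_assoc]; exact h.1.2 r hr _
  · have h1 : IntegrableOn (fun s : ℝ => Real.exp (2 * ν * s) * ‖ι (v s)‖ ^ 2) (Iic t) := by
      have h2 : IntegrableOn (fun s : ℝ => Real.exp (2 * ν * s) * ‖ι (v s)‖ ^ 2) (Icc 0 t) := by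
        apply Continuous.integrableOn_Icc; fun_prop
      refine (h.2.union h2).mono_set ?_
      intro s hs
      rcases le_total s 0 with h0 | h0
      · exact Or.inl h0
      · exact Or.inr ⟨h0, hs⟩
    have h3 := ((measurePreserving_add_right volume t).integrableOn_comp_preimage
      (measurableEmbedding_addRight t) (f := fun s : ℝ => Real.exp (2 * ν * s) * ‖ι (v s)‖ ^ 2)
      (s := Iic t)).2 h1
    have h4 : (fun x => x + t) ⁻¹' Iic t = Iic (0:ℝ) := by ext x; simp
    rw [h4] at h3
    refine (h3.const_mul (Real.exp (-(2 * ν * t)))).congr (Eventually.of_forall fun s => ?_)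
    simp only [Function.comp]
    rw [← mul_assoc, ← Real.exp_add]
    congr 2; ring

theorem IsSys.unique (S : IsSys φ ι P p j δ τV ν τC τS C CP M c) {v1 v2 : ℝ → E}
    (h1 : φ.IsAmenableTrajectory ι ν v1) (h2 : φ.IsAmenableTrajectory ι ν v2)
    (h : p (v1 0) = p (v2 0)) {s : ℝ} (hs : s ≤ 0) : v1 s = v2 s := by
  have c1 := h1.1.1
  have c2 := h2.1.1
  by_contra hne
  have hm := S.main_est h1 h2 (s := s - 1) (by linarith)
  rw [map_sub, h, sub_self, norm_zero] at hm
  have hi : ∫ r in (s - 1)..0, (0:ℝ) <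
      ∫ r in (s - 1)..0, Real.exp (2 * ν * r) * ‖ι (v1 r - v2 r)‖ ^ 2 := by
    apply intervalIntegral.integral_lt_integral_of_continuousOn_of_le_of_exists_lt (by linarith)
      continuousOn_const (by fun_prop) (fun r _ => by positivity)
    refine ⟨s, ⟨by linarith, hs⟩, ?_⟩
    have : ι (v1 s - v2 s) ≠ 0 := fun h0 => hne (sub_eq_zero.1 (S.inj (by rw [h0, map_zero])))
    have := norm_pos_iff.2 this
    positivity
  simp only [intervalIntegral.integral_zero] at hi
  nlinarith [S.δpos]

theorem amen_traj_mem {v : ℝ → E} (h : φ.IsAmenableTrajectory ι ν v) (t : ℝ) :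
    v t ∈ φ.amenableSet ι ν := ⟨_, amen_shift h t, by simp⟩

theorem amen_flow {a : E} (ha : a ∈ φ.amenableSet ι ν) {t : ℝ} (ht : 0 ≤ t) :
    φ.toFun t a ∈ φ.amenableSet ι ν := by
  obtain ⟨v, hv, rfl⟩ := ha
  rw [← hv.1.2 t ht 0]; exact amen_traj_mem hv _

theorem IsSys.p_inj (S : IsSys φ ι P p j δ τV ν τC τS C CP M c) {a b : E}
    (ha : a ∈ φ.amenableSet ι ν) (hb : b ∈ φ.amenableSet ι ν) (h : p a = p b) : a = b := by
  obtain ⟨v, hv, rfl⟩ := ha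
  obtain ⟨w, hw, rfl⟩ := hb
  exact S.unique hv hw h le_rfl

theorem IsSys.flow_inj (S : IsSys φ ι P p j δ τV ν τC τS C CP M c) {a b : E}
    (ha : a ∈ φ.amenableSet ι ν) (hb : b ∈ φ.amenableSet ι ν) {t : ℝ} (ht : 0 ≤ t)
    (h : φ.toFun t a = φ.toFun t b) : a = b := by
  obtain ⟨v, hv, rfl⟩ := ha
  obtain ⟨w, hw, rfl⟩ := hb
  rw [← hv.1.2 t ht 0, ← hw.1.2 t ht 0, add_zero] at h
  have := S.unique (amen_shift hv t) (amen_shift hw t) (by simp [h]) (s := -t) (by linarith)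
  simpa using this

/-- Averaging followed by smoothing. -/
theorem IsSys.avg (S : IsSys φ ι P p j δ τV ν τC τS C CP M c) {a b A : ℝ} {v1 v2 : ℝ → E}
    (h1 : TrajFrom φ a v1) (h2 : TrajFrom φ a v2) (hab : a ≤ b) (hb : b + 1 ≤ 0)
    (hA : δ * ∫ r in a..0, Real.exp (2 * ν * r) * ‖ι (v1 r - v2 r)‖ ^ 2 ≤ A) :
    ∃ t ∈ Icc (b + τS) (b + τS + 1),
      ‖v1 t - v2 t‖ ^ 2 ≤ C ^ 2 * Real.exp (-(2 * ν * b)) * (A / δ) := by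
  have c1 := traj_continuousOn h1
  have c2 := traj_continuousOn h2
  have hg : ContinuousOn (fun r => Real.exp (2 * ν * r) * ‖ι (v1 r - v2 r)‖ ^ 2) (Ici a) := by
    fun_prop
  have hle : ∫ r in b..(b + 1), Real.exp (2 * ν * r) * ‖ι (v1 r - v2 r)‖ ^ 2 ≤ A / δ := by
    refine le_trans ?_ ((le_div_iff₀' S.δpos).2 hA)
    apply intervalIntegral.integral_mono_interval hab (by linarith) hb
    · exact Eventually.of_forall fun r => by positivity
    · apply ContinuousOn.intervalIntegrable
      rw [uIcc_of_le (by linarith)]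
      exact hg.mono Icc_subset_Ici_self
  obtain ⟨r, hr, hrA⟩ := exists_le_of_integral
    (hg.mono (fun x hx => mem_Ici.2 (hab.trans hx.1))) hle
  refine ⟨τS + r, ⟨by linarith [hr.1], by linarith [hr.2]⟩, ?_⟩
  have h3 := S.smooth_traj h1 h2 (l := r) (hab.trans hr.1)
  have h4 : ‖v1 (τS + r) - v2 (τS + r)‖ ^ 2 ≤ C ^ 2 * ‖ι (v1 r - v2 r)‖ ^ 2 := by
    rw [← mul_pow]; exact pow_le_pow_left₀ (norm_nonneg _) h3 2
  refine h4.trans ?_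
  rw [mul_assoc]
  refine mul_le_mul_of_nonneg_left ?_ (by positivity)
  have h5 : Real.exp (2 * ν * b) * ‖ι (v1 r - v2 r)‖ ^ 2 ≤ A / δ := by
    refine le_trans (mul_le_mul_of_nonneg_right (Real.exp_le_exp.2 ?_) (by positivity)) hrA
    have := S.νpos
    nlinarith [hr.1]
  have h6 := mul_le_mul_of_nonneg_left h5 (Real.exp_pos (-(2 * ν * b))).le
  rwa [← mul_assoc, ← Real.exp_add, neg_add_cancel, Real.exp_zero, one_mul] at h6

theorem IsSys.p_cont (S : IsSys φ ι P p j δ τV ν τC τS C CP M c) {v1 : ℝ → E}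
    (h1 : φ.IsAmenableTrajectory ι ν v1) {ε : ℝ} (hε : 0 < ε) :
    ∃ d > 0, ∀ v2, φ.IsAmenableTrajectory ι ν v2 → ‖p (v2 0) - p (v1 0)‖ < d →
      ‖v2 0 - v1 0‖ < ε := by
  have c1 := h1.1.1
  have hK : IsCompact ((fun t : ℝ => (t, v1 (-t))) '' Icc 0 1) :=
    isCompact_Icc.image (by fun_prop)
  obtain ⟨η, hη, hηt⟩ := flow_tube φ hK (by
    rintro _ ⟨t, ht, rfl⟩; exact ⟨ht.1, mem_univ _⟩) hε
  set K := C ^ 2 * Real.exp (-(2 * ν * (-1 - τS))) * (M / δ) with hKd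
  have hKp : 0 < K := by
    have := S.Cpos
    have := S.coord.Mpos
    have := S.δpos
    positivity
  refine ⟨η / Real.sqrt K, by positivity, fun v2 h2 hd => ?_⟩
  have hτ := S.τSnn
  have hm := S.main_est h2 h1 (s := -1 - τS) (by linarith)
  obtain ⟨t, ht, hle⟩ := S.avg (complete_trajFrom h2.1 _) (complete_trajFrom h1.1 _)
    (b := -1 - τS) le_rfl (by linarith) hm
  rw [sub_add_cancel] at ht
  have ht0 : t ≤ 0 := by linarith [ht.2]
  have h3 : ‖v2 t - v1 t‖ < η := by
    refine lt_of_pow_lt_pow_left₀ 2 hη.le (lt_of_le_of_lt hle ?_)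
    have h4 : C ^ 2 * Real.exp (-(2 * ν * (-1 - τS))) * (M * ‖p (v2 0 - v1 0)‖ ^ 2 / δ) =
        K * ‖p (v2 0) - p (v1 0)‖ ^ 2 := by rw [hKd, map_sub]; ring
    rw [h4]
    have h5 : ‖p (v2 0) - p (v1 0)‖ ^ 2 < (η / Real.sqrt K) ^ 2 :=
      pow_lt_pow_left₀ hd (norm_nonneg _) two_ne_zero
    rw [div_pow, Real.sq_sqrt hKp.le] at h5
    rwa [lt_div_iff₀ hKp, mul_comm] at h5
  have h6 := hηt (-t) (v1 t) ⟨-t, ⟨by linarith, by linarith [ht.1]⟩, by simp⟩ (v2 t) h3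
  rw [← h1.1.2 _ (by linarith), ← h2.1.2 _ (by linarith), neg_add_cancel] at h6
  exact h6
end Analytic2

section Analytic3
variable {E : Type*} [NormedAddCommGroup E] [NormedSpace ℝ E]
variable {H : Type*} [NormedAddCommGroup H] [InnerProductSpace ℝ H]
variable {φ : Semiflow E} {ι : E →L[ℝ] H} {P : E →L[ℝ] E →L[ℝ] ℝ} {p : E →L[ℝ] ℂ}
    {j : ℂ →L[ℝ] E} {δ τV ν τC τS C CP M c : ℝ}

theorem flow_continuous_time (φ : Semiflow E) {t : ℝ} (ht : 0 ≤ t) : Continuous (φ.toFun t) := by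
  rw [← continuousOn_univ]
  exact φ.continuousOn'.comp (f := fun x : E => (t, x)) (by fun_prop)
      (fun q _ => ⟨mem_Ici.2 ht, mem_univ _⟩)

theorem IsSys.approx (S : IsSys φ ι P p j δ τV ν τC τS C CP M c) {w : ℝ → E}
    (hw : φ.IsAmenableTrajectory ι ν w) (ζ : ℂ) (k : ℕ) :
    ∃ v : ℝ → E, TrajFrom φ (-k) v ∧ p (v 0) = ζ ∧
      ∀ s, -(k:ℝ) ≤ s → s ≤ 0 → δ * ∫ r in s..0, Real.exp (2 * ν * r) * ‖ι (v r - w r)‖ ^ 2 ≤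
        M * ‖ζ - p (w 0)‖ ^ 2 := by
  set T : ℝ := k + τV with hT
  have hk : (0:ℝ) ≤ k := Nat.cast_nonneg k
  have hT0 : 0 ≤ T := by have := S.τVnn; linarith
  have hMp := S.coord.Mpos
  have hcp := S.coord.cpos
  have hδ := S.δpos
  obtain ⟨ξ, hξ⟩ := surj_of_expanding (f := fun ξ : ℂ => p (φ.toFun T (w (-T) + j ξ)))
    (κ := Real.sqrt (c / (Real.exp (2 * ν * T) * M)))
    (p.continuous.comp ((flow_continuous_time φ hT0).comp (by fun_prop))) (by positivity) (by
      intro x y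
      refine (pow_le_pow_iff_left₀ (by positivity) (norm_nonneg _) two_ne_zero).1 ?_
      rw [mul_pow, Real.sq_sqrt (by positivity)]
      have h := S.h3 (w (-T) + j x) (w (-T) + j y) 0 T le_rfl hT0 (by linarith)
      have hint : 0 ≤ ∫ s in (0:ℝ)..T, Real.exp (2 * ν * s) *
          ‖ι (φ.toFun s (w (-T) + j x)) - ι (φ.toFun s (w (-T) + j y))‖ ^ 2 :=
        intervalIntegral.integral_nonneg hT0 fun s _ => by positivity
      rw [φ.map_zero', φ.map_zero', mul_zero, Real.exp_zero, one_mul, add_sub_add_left_eq_sub,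
        ← map_sub] at h
      have h1 := S.coord.high (x - y)
      have h2 := S.coord.low (φ.toFun T (w (-T) + j x) - φ.toFun T (w (-T) + j y))
      rw [map_sub p] at h2
      have h3 := mul_le_mul_of_nonneg_left h2 (Real.exp_pos (2 * ν * T)).le
      rw [div_mul_eq_mul_div, div_le_iff₀ (by positivity)]
      nlinarith) ζ
  simp only at hξ
  have htr : TrajFrom φ (-T) (fun t => φ.toFun (t + T) (w (-T) + j ξ)) := by
    intro t ht s hs
    show φ.toFun (t + s + T) _ = φ.toFun t (φ.toFun (s + T) _)
    rw [← φ.map_add' t (s + T) ht (by linarith), add_assoc]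
  have htw := complete_trajFrom hw.1 (-T)
  refine ⟨fun t => φ.toFun (t + T) (w (-T) + j ξ), fun t ht s hs => htr t ht s (by
    linarith [S.τVnn]), by simpa using hξ, fun s hs hs0 => ?_⟩
  have h3 := S.h3_traj htr htw (l := -T) (r := 0) le_rfl (by linarith) (by linarith)
  have hlow := S.coord.low (φ.toFun (0 + T) (w (-T) + j ξ) - w 0)
  rw [map_sub p, zero_add, hξ] at hlow
  simp only [mul_zero, Real.exp_zero, one_mul, zero_add, neg_add_cancel, φ.map_zero',
    add_sub_cancel_left] at h3
  have hh := S.coord.high ξ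
  have hneg : Real.exp (2 * ν * -T) * P (j ξ) (j ξ) ≤ 0 :=
    mul_nonpos_of_nonneg_of_nonpos (Real.exp_pos _).le (by nlinarith [sq_nonneg ‖ξ‖])
  have c1 := traj_continuousOn htr
  have c2 := traj_continuousOn htw
  have hmono : ∫ r in s..0, Real.exp (2 * ν * r) * ‖ι (φ.toFun (r + T) (w (-T) + j ξ) - w r)‖ ^ 2 ≤
      ∫ r in (-T)..0, Real.exp (2 * ν * r) * ‖ι (φ.toFun (r + T) (w (-T) + j ξ) - w r)‖ ^ 2 := by
    apply intervalIntegral.integral_mono_interval (by linarith [S.τVnn]) hs0 le_rfl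
    · exact Eventually.of_forall fun r => by positivity
    · apply ContinuousOn.intervalIntegrable
      rw [uIcc_of_le (by linarith)]
      have : ContinuousOn (fun r => Real.exp (2 * ν * r) *
        ‖ι (φ.toFun (r + T) (w (-T) + j ξ) - w r)‖ ^ 2) (Ici (-T)) := by fun_prop
      exact this.mono Icc_subset_Ici_self
  have := mul_le_mul_of_nonneg_left hmono hδ.le
  linarith

theorem IsSys.approx_compact (S : IsSys φ ι P p j δ τV ν τC τS C CP M c) {w : ℝ → E}
    (hw : φ.IsAmenableTrajectory ι ν w) {A : ℝ} {v : ℕ → ℝ → E} (hv : ∀ k : ℕ, TrajFrom φ (-(k:ℝ)) (v k))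
    (hA : ∀ k : ℕ, ∀ s : ℝ, -(k:ℝ) ≤ s → s ≤ 0 →
      δ * ∫ r in s..0, Real.exp (2 * ν * r) * ‖ι (v k r - w r)‖ ^ 2 ≤ A) (t : ℝ) :
    ∃ K : Set E, IsCompact K ∧ ∀ᶠ k in atTop, v k t ∈ K := by
  have c1 := hw.1.1
  have hτC := S.τCpos
  have hτS := S.τSnn
  set b := min t 0 - τC - τS - 1 with hb
  have hbt : b ≤ t - τC - τS - 1 := by linarith [min_le_left t 0]
  have hb0 : b + 1 ≤ 0 := by linarith [min_le_right t 0]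
  obtain ⟨R, hR⟩ := ((isCompact_Icc (a := b + τS) (b := b + τS + 1)).image c1).isBounded.exists_norm_le
  set A1 := C ^ 2 * Real.exp (-(2 * ν * b)) * (A / δ)
  set B := Metric.closedBall (0:E) (Real.sqrt A1 + R)
  set K := (fun q : ℝ × E => φ.toFun q.1 q.2) ''
    (Icc 0 (t - b - τS - τC) ×ˢ closure (φ.toFun τC '' B))
  refine ⟨K, ?_, ?_⟩
  · apply (isCompact_Icc.prod (S.com B Metric.isBounded_closedBall)).image_of_continuousOn
    exact φ.continuousOn'.mono fun q hq => ⟨hq.1.1, mem_univ _⟩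
  · obtain ⟨N, hN⟩ := exists_nat_ge (-b)
    filter_upwards [eventually_ge_atTop N] with k hk
    have hk' : -(k:ℝ) ≤ b := by
      have : (N:ℝ) ≤ k := by exact_mod_cast hk
      linarith
    have tk : TrajFrom φ b (v k) := fun t ht s hs => hv k t ht s (hk'.trans hs)
    obtain ⟨s, hs, hle⟩ := S.avg tk (complete_trajFrom hw.1 b) le_rfl hb0
      (hA k b hk' (by linarith))
    have h1 : ‖v k s - w s‖ ≤ Real.sqrt A1 := Real.le_sqrt_of_sq_le hle
    have h2 : ‖w s‖ ≤ R := hR _ ⟨s, hs, rfl⟩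
    have h3 : v k s ∈ B := by
      rw [mem_closedBall_zero_iff]
      calc ‖v k s‖ = ‖(v k s - w s) + w s‖ := by rw [sub_add_cancel]
        _ ≤ _ := (norm_add_le _ _).trans (add_le_add h1 h2)
    refine ⟨(t - s - τC, φ.toFun τC (v k s)), ⟨⟨?_, ?_⟩, subset_closure ⟨_, h3, rfl⟩⟩, ?_⟩
    · show 0 ≤ t - s - τC
      linarith [hs.2]
    · show t - s - τC ≤ _
      linarith [hs.1]
    · show φ.toFun (t - s - τC) (φ.toFun τC (v k s)) = v k t
      rw [← tk τC hτC.le s (by linarith [hs.1]), ← tk _ (by linarith [hs.2]) _ (by linarith [hs.1])]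
      congr 1; ring

theorem IsSys.p_surj (S : IsSys φ ι P p j δ τV ν τC τS C CP M c)
    (hne : (φ.amenableSet ι ν).Nonempty) (ζ : ℂ) : ∃ a ∈ φ.amenableSet ι ν, p a = ζ := by
  obtain ⟨_, w, hw, rfl⟩ := hne
  have c1 := hw.1.1
  choose v hv hζ hA using S.approx hw ζ
  set A := M * ‖ζ - p (w 0)‖ ^ 2
  set F : Ultrafilter ℕ := hyperfilter ℕ
  have hF : (F : Filter ℕ) ≤ atTop := Nat.hyperfilter_le_atTop
  have hlim : ∀ t, ∃ x, Tendsto (fun k => v k t) F (𝓝 x) := by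
    intro t
    obtain ⟨K, hK, hev⟩ := S.approx_compact hw hv hA t
    obtain ⟨x, -, hx⟩ := hK.ultrafilter_le_nhds (F.map (fun k => v k t)) (by
      rw [le_principal_iff]; exact hF hev)
    exact ⟨x, hx⟩
  choose u hu using hlim
  have htail : ∀ a : ℝ, ∀ᶠ k : ℕ in F, -(k:ℝ) ≤ a := by
    intro a
    apply hF
    obtain ⟨N, hN⟩ := exists_nat_ge (-a)
    filter_upwards [eventually_ge_atTop N] with k hk
    have : (N:ℝ) ≤ k := by exact_mod_cast hk
    linarith
  have htr : ∀ t, 0 ≤ t → ∀ s, u (t + s) = φ.toFun t (u s) := by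
    intro t ht s
    refine tendsto_nhds_unique (hu (t + s)) ?_
    refine (((flow_continuous_time φ ht).tendsto (u s)).comp (hu s)).congr' ?_
    filter_upwards [htail s] with k hk
    exact (hv k t ht s hk).symm
  have hcont : Continuous u := by
    rw [continuous_iff_continuousAt]
    intro t
    exact (traj_continuousOn (a := t - 1) (fun t ht s _ => htr t ht s)).continuousAt
      (Ici_mem_nhds (by linarith))
  have hζu : p (u 0) = ζ := by
    refine tendsto_nhds_unique ((p.continuous.tendsto _).comp (hu 0)) ?_
    refine tendsto_const_nhds.congr fun k => (hζ k).symm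
  have hν := S.νpos
  have hδ := S.δpos
  have hJ1 : IntegrableOn (fun s : ℝ => Real.exp (2 * ν * s)) (Iic 0) :=
    integrableOn_exp_mul_Iic (by linarith) 0
  refine ⟨u 0, ⟨u, ⟨⟨hcont, htr⟩, ?_⟩, rfl⟩, hζu⟩
  have hinterval : ∀ {f : ℝ → ℝ}, IntegrableOn f (Iic 0) → (∀ s, 0 ≤ f s) → ∀ s ≤ 0,
      ∫ r in s..0, f r ≤ ∫ r in Iic 0, f r := by
    intro f hf h0 s hs
    rw [intervalIntegral.integral_of_le hs]
    exact setIntegral_mono_set hf (Eventually.of_forall h0)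
      (Eventually.of_forall fun x hx => hx.2)
  refine integrableOn_Iic_of_intervalIntegral_norm_bounded (l := atBot) (a := fun s : ℝ => s)
    (3 * (‖ι‖ ^ 2 * (∫ r in Iic 0, Real.exp (2 * ν * r)) + A / δ +
      ∫ r in Iic 0, Real.exp (2 * ν * r) * ‖ι (w r)‖ ^ 2)) 0 ?_ tendsto_id ?_
  · intro s
    have : Continuous (fun s : ℝ => Real.exp (2 * ν * s) * ‖ι (u s)‖ ^ 2) := by fun_prop
    exact this.integrableOn_Ioc
  · filter_upwards [eventually_le_atBot (0:ℝ)] with s hs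
    obtain ⟨η, hη, htube⟩ := flow_tube φ (K := Icc 0 (-s) ×ˢ {u s})
      (isCompact_Icc.prod isCompact_singleton) (fun q hq => ⟨hq.1.1, mem_univ _⟩) one_pos
    obtain ⟨k, hk1, hk2⟩ := ((htail s).and
      ((hu s).eventually (Metric.ball_mem_nhds _ hη))).exists
    have hclose : ∀ r ∈ Icc s 0, ‖v k r - u r‖ ≤ 1 := by
      intro r hr
      have := htube (r - s) (u s) ⟨⟨by simpa using hr.1, by simpa using hr.2⟩, rfl⟩ (v k s)
        (by rw [← dist_eq_norm]; exact hk2)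
      rw [← htr _ (by linarith [hr.1]), ← hv k _ (by linarith [hr.1]) s hk1, sub_add_cancel] at this
      exact this.le
    have ck : ContinuousOn (v k) (Icc s 0) := (traj_continuousOn (hv k)).mono
      (fun r hr => mem_Ici.2 (hk1.trans hr.1))
    have i1 : IntervalIntegrable (fun r => ‖ι‖ ^ 2 * Real.exp (2 * ν * r)) volume s 0 := by
      apply Continuous.intervalIntegrable; fun_prop
    have i2 : IntervalIntegrable (fun r => Real.exp (2 * ν * r) * ‖ι (v k r - w r)‖ ^ 2) volume s 0 := by
      apply ContinuousOn.intervalIntegrable; rw [uIcc_of_le hs]; fun_prop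
    have i3 : IntervalIntegrable (fun r => Real.exp (2 * ν * r) * ‖ι (w r)‖ ^ 2) volume s 0 := by
      apply Continuous.intervalIntegrable; fun_prop
    have hpt : ∀ r ∈ Icc s 0, ‖Real.exp (2 * ν * r) * ‖ι (u r)‖ ^ 2‖ ≤
        3 * (‖ι‖ ^ 2 * Real.exp (2 * ν * r) + Real.exp (2 * ν * r) * ‖ι (v k r - w r)‖ ^ 2 +
          Real.exp (2 * ν * r) * ‖ι (w r)‖ ^ 2) := by
      intro r hr
      rw [Real.norm_of_nonneg (by positivity)]
      have h1 : ‖ι (v k r - u r)‖ ≤ ‖ι‖ := by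
        refine (ι.le_opNorm _).trans ?_
        have := mul_le_mul_of_nonneg_left (hclose r hr) (norm_nonneg ι)
        linarith
      have h2 : ‖ι (u r)‖ ≤ ‖ι‖ + ‖ι (v k r - w r)‖ + ‖ι (w r)‖ := by
        have : ι (u r) = -ι (v k r - u r) + ι (v k r - w r) + ι (w r) := by
          simp only [map_sub]; abel
        rw [this]
        refine (norm_add₃_le).trans ?_
        rw [norm_neg]; linarith
      have h3 : ‖ι (u r)‖ ^ 2 ≤ 3 * (‖ι‖ ^ 2 + ‖ι (v k r - w r)‖ ^ 2 + ‖ι (w r)‖ ^ 2) := by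
        refine (pow_le_pow_left₀ (norm_nonneg _) h2 2).trans ?_
        nlinarith [sq_nonneg (‖ι‖ - ‖ι (v k r - w r)‖), sq_nonneg (‖ι‖ - ‖ι (w r)‖),
          sq_nonneg (‖ι (v k r - w r)‖ - ‖ι (w r)‖)]
      nlinarith [Real.exp_pos (2 * ν * r)]
    calc ∫ r in s..0, ‖Real.exp (2 * ν * r) * ‖ι (u r)‖ ^ 2‖ ≤
        ∫ r in s..0, 3 * (‖ι‖ ^ 2 * Real.exp (2 * ν * r) +
          Real.exp (2 * ν * r) * ‖ι (v k r - w r)‖ ^ 2 +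
          Real.exp (2 * ν * r) * ‖ι (w r)‖ ^ 2) := by
          apply intervalIntegral.integral_mono_on hs
          · apply Continuous.intervalIntegrable; fun_prop
          · exact ((i1.add i2).add i3).const_mul 3
          · exact hpt
      _ = 3 * (‖ι‖ ^ 2 * (∫ r in s..0, Real.exp (2 * ν * r)) +
          (∫ r in s..0, Real.exp (2 * ν * r) * ‖ι (v k r - w r)‖ ^ 2) +
          ∫ r in s..0, Real.exp (2 * ν * r) * ‖ι (w r)‖ ^ 2) := by
          rw [intervalIntegral.integral_const_mul, intervalIntegral.integral_add (i1.add i2) i3,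
            intervalIntegral.integral_add i1 i2, intervalIntegral.integral_const_mul]
      _ ≤ _ := by
          have e1 := hinterval hJ1 (fun s => (Real.exp_pos _).le) s hs
          have e2 := hinterval hw.2 (fun s => by positivity) s hs
          have e3 := (le_div_iff₀' hδ).2 (hA k s hk1 hs)
          have e4 := mul_le_mul_of_nonneg_left e1 (sq_nonneg ‖ι‖)
          linarith
end Analytic3

section Transfer
variable {E : Type*} [NormedAddCommGroup E] [NormedSpace ℝ E]
variable {H : Type*} [NormedAddCommGroup H] [InnerProductSpace ℝ H]
variable {φ : Semiflow E} {ι : E →L[ℝ] H} {P : E →L[ℝ] E →L[ℝ] ℝ} {p : E →L[ℝ] ℂ}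
    {j : ℂ →L[ℝ] E} {δ τV ν τC τS C CP M c : ℝ}

/-- A continuous inverse of `p` on the amenable set. -/
structure IsModel (φ : Semiflow E) (ι : E →L[ℝ] H) (ν : ℝ) (p : E →L[ℝ] ℂ) (q : ℂ → E) : Prop where
  cont : Continuous q
  mem : ∀ z, q z ∈ φ.amenableSet ι ν
  pq : ∀ z, p (q z) = z
  qp : ∀ a ∈ φ.amenableSet ι ν, q (p a) = a

theorem IsSys.exists_model (S : IsSys φ ι P p j δ τV ν τC τS C CP M c)
    (hne : (φ.amenableSet ι ν).Nonempty) : ∃ q, IsModel φ ι ν p q := by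
  choose q hq hpq using S.p_surj hne
  refine ⟨q, ?_, hq, hpq, fun a ha => S.p_inj (hq _) ha (hpq _)⟩
  rw [Metric.continuous_iff]
  intro z ε hε
  obtain ⟨v, hv, hvz⟩ := hq z
  obtain ⟨d, hd, h⟩ := S.p_cont hv hε
  refine ⟨d, hd, fun y hy => ?_⟩
  obtain ⟨u, hu, huy⟩ := hq y
  have := h u hu (by rw [hvz, huy, hpq, hpq, ← dist_eq_norm]; exact hy)
  rwa [hvz, huy, ← dist_eq_norm] at this

/-- The semiflow read in the plane. -/
noncomputable def planeFlow (φ : Semiflow E) (p : E →L[ℝ] ℂ) (q : ℂ → E) (t : ℝ) (z : ℂ) : ℂ :=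
  p (φ.toFun (max t 0) (q z))

theorem planeFlow_apply {q : ℂ → E} (hm : IsModel φ ι ν p q) {t : ℝ} (ht : 0 ≤ t) {a : E}
    (ha : a ∈ φ.amenableSet ι ν) : planeFlow φ p q t (p a) = p (φ.toFun t a) := by
  rw [planeFlow, max_eq_left ht, hm.qp a ha]

theorem IsSys.isPlaneFlow (S : IsSys φ ι P p j δ τV ν τC τS C CP M c) {q : ℂ → E}
    (hm : IsModel φ ι ν p q) : IsPlaneFlow (planeFlow φ p q) := by
  have hap : ∀ {t : ℝ}, 0 ≤ t → ∀ z, planeFlow φ p q t z = p (φ.toFun t (q z)) := by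
    intro t ht z
    rw [planeFlow, max_eq_left ht]
  refine ⟨fun z => ?_, fun t s ht hs z => ?_, ?_, fun t ht z z' h => ?_⟩
  · rw [hap le_rfl, φ.map_zero', hm.pq]
  · rw [hap hs, planeFlow_apply hm ht (amen_flow (hm.mem z) hs), hap (add_nonneg ht hs),
      φ.map_add' t s ht hs]
  · have hc : Continuous fun r : ℝ × E => φ.toFun (max r.1 0) r.2 := by
      rw [← continuousOn_univ]
      exact φ.continuousOn'.comp (f := fun q : ℝ × E => (max q.1 0, q.2)) (by fun_prop)
        (fun q _ => ⟨mem_Ici.2 (le_max_right q.1 0), mem_univ _⟩)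
    have hq := hm.cont
    exact p.continuous.comp (hc.comp (by fun_prop : Continuous fun r : ℝ × ℂ => (r.1, q r.2)))
  · rw [hap ht, hap ht] at h
    have h1 := S.p_inj (amen_flow (hm.mem z) ht) (amen_flow (hm.mem z') ht) h
    have h2 := S.flow_inj (hm.mem z) (hm.mem z') ht h1
    rw [← hm.pq z, h2, hm.pq]

/-- A periodic orbit is the range of a complete periodic trajectory. -/
theorem periodic_traj {γ : Set E} (hγ : φ.IsPeriodicOrbit γ) :
    ∃ (v : ℝ → E) (σ : ℝ), φ.IsCompleteTrajectory v ∧ 0 < σ ∧ (∀ t, v (t + σ) = v t) ∧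
      range v = γ ∧ ∃ t, v t ≠ v 0 := by
  obtain ⟨v0, ⟨hns, σ, hσ, hper⟩, rfl⟩ := hγ
  have hn : ∀ (m : ℕ) (t : ℝ), 0 ≤ t → φ.toFun (t + m * σ) v0 = φ.toFun t v0 := by
    intro m
    induction m with
    | zero => intro t _; simp
    | succ m ih =>
      intro t ht
      have h0 : 0 ≤ t + m * σ := by positivity
      rw [show t + ((m + 1 : ℕ) : ℝ) * σ = (t + m * σ) + σ by push_cast; ring,
        φ.map_add' _ _ h0 hσ.le]
      show φ.toFun _ (φ.toFun σ v0) = _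
      rw [hper, ih t ht]
  have hN : ∀ t : ℝ, 0 ≤ t + (⌈|t| / σ⌉₊ : ℝ) * σ := by
    intro t
    have h1 := Nat.le_ceil (|t| / σ)
    rw [div_le_iff₀ hσ] at h1
    linarith [neg_abs_le t]
  set v : ℝ → E := fun t => φ.toFun (t + (⌈|t| / σ⌉₊ : ℝ) * σ) v0 with hv
  have hv1 : ∀ (t : ℝ) (m : ℕ), 0 ≤ t + m * σ → v t = φ.toFun (t + m * σ) v0 := by
    intro t m hm
    have a1 := hn m _ (hN t)
    have a2 := hn ⌈|t| / σ⌉₊ _ hm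
    rw [hv]
    simp only
    rw [← a1, ← a2]
    congr 1; ring
  have hv0 : ∀ t, 0 ≤ t → v t = φ.toFun t v0 := by
    intro t ht
    have := hv1 t 0 (by simpa using ht)
    simpa using this
  have htr : ∀ t, 0 ≤ t → ∀ s, v (t + s) = φ.toFun t (v s) := by
    intro t ht s
    have hs := hN s
    rw [hv1 s _ hs, hv1 (t + s) ⌈|s| / σ⌉₊ (by linarith), add_assoc, φ.map_add' _ _ ht hs]
  refine ⟨v, σ, ⟨?_, htr⟩, hσ, ?_, ?_, ?_⟩
  · rw [continuous_iff_continuousAt]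
    intro t
    exact (traj_continuousOn (a := t - 1) (fun t ht s _ => htr t ht s)).continuousAt
      (Ici_mem_nhds (by linarith))
  · intro t
    have h := hN t
    have e : t + σ + (⌈|t| / σ⌉₊ : ℝ) * σ = t + ((⌈|t| / σ⌉₊ + 1 : ℕ) : ℝ) * σ := by
      push_cast; ring
    rw [hv1 (t + σ) ⌈|t| / σ⌉₊ (by linarith), e, hv1 t (⌈|t| / σ⌉₊ + 1) (by rw [← e]; linarith)]
  · ext x
    constructor
    · rintro ⟨t, rfl⟩
      exact ⟨_, hN t, rfl⟩
    · rintro ⟨t, ht, rfl⟩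
      exact ⟨t, hv0 t ht⟩
  · by_contra hcon
    push Not at hcon
    apply hns
    intro t ht
    rw [← hv0 t ht, hcon t, hv0 0 le_rfl, φ.map_zero']

theorem periodic_compact {v : ℝ → E} {σ : ℝ} (hc : Continuous v) (hσ : 0 < σ)
    (hper : ∀ t, v (t + σ) = v t) : IsCompact (range v) := by
  have : range v = v '' Icc 0 σ := by
    have h := (show Function.Periodic v σ from hper).image_Icc hσ 0
    rw [zero_add] at h
    exact h.symm
  rw [this]
  exact isCompact_Icc.image hc

theorem periodic_amenable (hν : 0 < ν) {v : ℝ → E} {σ : ℝ} (hv : φ.IsCompleteTrajectory v)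
    (hσ : 0 < σ) (hper : ∀ t, v (t + σ) = v t) : φ.IsAmenableTrajectory ι ν v := by
  refine ⟨hv, ?_⟩
  have hc := hv.1
  obtain ⟨R, hR⟩ := (periodic_compact (v := fun t => ι (v t)) (by fun_prop) hσ
    (fun t => by rw [hper])).isBounded.exists_norm_le
  refine Integrable.mono' ((integrableOn_exp_mul_Iic (a := 2 * ν) (by linarith) 0).const_mul (R ^ 2))
    ?_ (Eventually.of_forall fun s => ?_)
  · apply Continuous.aestronglyMeasurable; fun_prop
  · rw [Real.norm_of_nonneg (by positivity), mul_comm]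
    exact mul_le_mul_of_nonneg_right (pow_le_pow_left₀ (norm_nonneg _) (hR _ ⟨s, rfl⟩) 2)
      (Real.exp_pos _).le

theorem IsSys.periodic_loop (S : IsSys φ ι P p j δ τV ν τC τS C CP M c) {q : ℂ → E}
    (hm : IsModel φ ι ν p q) {γ : Set E} (hγ : φ.IsPeriodicOrbit γ) :
    γ ⊆ φ.amenableSet ι ν ∧ IsCompact γ ∧ ∃ (Γ : ℝ → ℂ) (σ : ℝ), IsLoop Γ σ ∧
      (∀ t, 0 ≤ t → ∀ s, planeFlow φ p q t (Γ s) = Γ (s + t)) ∧ range Γ = p '' γ := by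
  obtain ⟨v, σ, hv, hσ, hper, rfl, t0, ht0⟩ := periodic_traj hγ
  have ham : φ.IsAmenableTrajectory ι ν v := periodic_amenable S.νpos hv hσ hper
  have hmem : ∀ t, v t ∈ φ.amenableSet ι ν := amen_traj_mem ham
  refine ⟨by rintro _ ⟨t, rfl⟩; exact hmem t, periodic_compact hv.1 hσ hper, ?_⟩
  let G : AddSubgroup ℝ :=
    { carrier := {τ | ∀ t, v (t + τ) = v t}
      zero_mem' := fun t => by rw [add_zero]
      add_mem' := fun {a b} ha hb t => by rw [← add_assoc, hb, ha]
      neg_mem' := fun {a} ha t => by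
        have := ha (t + -a)
        rw [neg_add_cancel_right] at this
        exact this.symm }
  have hGmem : ∀ τ, τ ∈ G ↔ ∀ t, v (t + τ) = v t := fun τ => Iff.rfl
  have hc := hv.1
  have hGc : IsClosed (G : Set ℝ) := by
    have : (G : Set ℝ) = ⋂ t, {τ | v (t + τ) = v t} := by
      ext τ; simp [hGmem]
    rw [this]
    exact isClosed_iInter fun t => isClosed_eq (by fun_prop) (by fun_prop)
  have hσG : σ ∈ G := hper
  have key : ∃ a : ℝ, 0 < a ∧ ∀ τ, τ ∈ G ↔ ∃ n : ℤ, τ = n * a := by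
    rcases AddSubgroup.dense_or_cyclic G with hd | ⟨a, ha⟩
    · exfalso
      have : (G : Set ℝ) = univ := by rw [← hGc.closure_eq]; exact hd.closure_eq
      have h1 : t0 ∈ (G : Set ℝ) := by rw [this]; exact mem_univ _
      apply ht0
      have := (hGmem t0).1 h1 0
      rwa [zero_add] at this
    · have ha' : ∀ τ, τ ∈ G ↔ ∃ n : ℤ, n • a = τ := by
        intro τ; rw [ha]; exact AddSubgroup.mem_closure_singleton
      have ha0 : a ≠ 0 := by
        rintro rfl
        obtain ⟨n, hn⟩ := (ha' σ).1 hσG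
        simp at hn; linarith
      rcases lt_or_gt_of_ne ha0 with h | h
      · refine ⟨-a, by linarith, fun τ => ?_⟩
        rw [ha' τ]
        constructor
        · rintro ⟨n, rfl⟩; exact ⟨-n, by simp⟩
        · rintro ⟨n, rfl⟩; exact ⟨-n, by simp⟩
      · refine ⟨a, h, fun τ => ?_⟩
        rw [ha' τ]
        constructor
        · rintro ⟨n, rfl⟩; exact ⟨n, by simp⟩
        · rintro ⟨n, rfl⟩; exact ⟨n, by simp⟩
  obtain ⟨a, ha, haG⟩ := key
  refine ⟨fun t => p (v t), a, ⟨by fun_prop, ha, fun t => ?_, fun s t hst => ?_⟩, ?_, ?_⟩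
  · have := (hGmem a).1 ((haG a).2 ⟨1, by simp⟩) t
    simp only [this]
  · have hG : s - t ∈ G := by
      rw [hGmem]
      have hle : ∀ r ≤ 0, v (r + s) = v (r + t) := fun r hr =>
        S.unique (amen_shift ham s) (amen_shift ham t) (by simpa using hst) hr
      have hall : ∀ r, v (r + s) = v (r + t) := by
        intro r
        rcases le_total r 0 with hr | hr
        · exact hle r hr
        · rw [hv.2 r hr, hv.2 r hr]
          have := hle 0 le_rfl
          rw [zero_add, zero_add] at this
          rw [this]
      intro r
      have := hall (r - t)
      rw [sub_add_cancel] at this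
      rw [← this]; congr 1; ring
    obtain ⟨n, hn⟩ := (haG _).1 hG
    exact ⟨n, by linarith⟩
  · intro t ht s
    rw [planeFlow_apply hm ht (hmem s), ← hv.2 t ht, add_comm]
  · rw [← range_comp]; rfl

end Transfer

section Final
variable {E : Type*} [NormedAddCommGroup E] [NormedSpace ℝ E]
variable {H : Type*} [NormedAddCommGroup H] [InnerProductSpace ℝ H]
variable {φ : Semiflow E} {ι : E →L[ℝ] H} {P : E →L[ℝ] E →L[ℝ] ℝ} {p : E →L[ℝ] ℂ}
    {j : ℂ →L[ℝ] E} {δ τV ν τC τS C CP M c : ℝ}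

theorem mem_interiorRegion_iff {Eminus : Submodule ℝ E} (e : ↥Eminus ≃L[ℝ] ℂ) {Pi : E → E}
    (hPi : ∀ v, Pi v = (e.symm (p v) : E)) (γ : Set E) (a : E) :
    a ∈ φ.interiorRegion ι ν Eminus Pi γ ↔
      a ∈ φ.amenableSet ι ν ∧ p a ∈ intC (p '' γ) := by
  set h : ℂ → E := fun z => (e.symm z : E) with hh
  have hemb : IsEmbedding h := IsEmbedding.subtypeVal.comp e.symm.toHomeomorph.isEmbedding
  have hinj := hemb.injective
  have hrange : range h = (Eminus : Set E) := by
    ext x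
    constructor
    · rintro ⟨z, rfl⟩; exact (e.symm z).2
    · intro hx; exact ⟨e ⟨x, hx⟩, by simp [hh]⟩
  have himg : Pi '' γ = h '' (p '' γ) := by
    rw [image_image]
    exact image_congr fun v _ => hPi v
  have hset : (Eminus : Set E) \ (Pi '' γ) = h '' (p '' γ)ᶜ := by
    rw [himg, ← hrange, image_compl_eq_range_sdiff_image hinj]
  have hcc : ∀ z ∈ (p '' γ)ᶜ, connectedComponentIn (h '' (p '' γ)ᶜ) (h z) =
      h '' connectedComponentIn (p '' γ)ᶜ z := by
    intro z hz
    apply Subset.antisymm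
    · have hsub : connectedComponentIn (h '' (p '' γ)ᶜ) (h z) ⊆ h '' (p '' γ)ᶜ :=
        connectedComponentIn_subset _ _
      have h1 : connectedComponentIn (h '' (p '' γ)ᶜ) (h z) =
          h '' (h ⁻¹' connectedComponentIn (h '' (p '' γ)ᶜ) (h z)) := by
        rw [image_preimage_eq_of_subset (hsub.trans (image_subset_range _ _))]
      have h2 : IsPreconnected (h ⁻¹' connectedComponentIn (h '' (p '' γ)ᶜ) (h z)) := by
        rw [← hemb.isInducing.isPreconnected_image, ← h1]
        exact isPreconnected_connectedComponentIn
      rw [h1]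
      refine image_mono (h2.subset_connectedComponentIn
        (mem_connectedComponentIn (mem_image_of_mem _ hz)) ?_)
      intro x hx
      obtain ⟨y, hy, hyx⟩ := hsub hx
      rwa [← hinj hyx]
    · refine (isPreconnected_connectedComponentIn.image h hemb.continuous.continuousOn).subset_connectedComponentIn
        (mem_image_of_mem _ (mem_connectedComponentIn hz)) (image_mono (connectedComponentIn_subset _ _))
  have hbd : ∀ B : Set ℂ, IsBounded (h '' B) ↔ IsBounded B := by
    intro B
    have hanti : ∃ K, AntilipschitzWith K h := by
      have := (isometry_subtype_coe (s := (Eminus : Set E))).antilipschitz.comp e.symm.antilipschitz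
      exact ⟨_, this⟩
    obtain ⟨K, hanti⟩ := hanti
    constructor
    · intro hB
      have := hanti.isBounded_preimage hB
      rwa [preimage_image_eq _ hinj] at this
    · intro hB
      have := (Eminus.subtypeL.comp (e.symm : ℂ →L[ℝ] ↥Eminus)).lipschitz.isBounded_image hB
      exact this
  have hPa : Pi a = h (p a) := hPi a
  unfold Semiflow.interiorRegion intC
  simp only [mem_ofPred_eq]
  rw [hset, hPa, hinj.mem_set_image]
  constructor
  · rintro ⟨h1, h2, h3⟩
    rw [hcc _ h2, hbd] at h3
    exact ⟨h1, h2, h3⟩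
  · rintro ⟨h1, h2, h3⟩
    refine ⟨h1, h2, ?_⟩
    rwa [hcc _ h2, hbd]

theorem infDist_p_lt {γ : Set E} (hγ : IsCompact γ) (hne : γ.Nonempty) {x : E} {η : ℝ}
    (hη : 0 < η) (hx : Metric.infDist x γ < η / (‖p‖ + 1)) : Metric.infDist (p x) (p '' γ) < η := by
  obtain ⟨y, hy, hxy⟩ := hγ.exists_infDist_eq_dist hne x
  rw [hxy] at hx
  have h1 : Metric.infDist (p x) (p '' γ) ≤ dist (p x) (p y) :=
    Metric.infDist_le_dist_of_mem (mem_image_of_mem _ hy)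
  refine h1.trans_lt ?_
  have hp : 0 ≤ ‖p‖ := norm_nonneg p
  rw [lt_div_iff₀ (by linarith)] at hx
  rw [dist_eq_norm, ← map_sub]
  have := p.le_opNorm (x - y)
  rw [dist_eq_norm] at hx
  nlinarith [norm_nonneg (x - y)]

theorem limit_case {γ : Set E} (hγ : IsCompact γ) (hne : γ.Nonempty) {g : ℕ → Set E}
    (hg : ∀ k, IsCompact (g k)) (hgne : ∀ k, (g k).Nonempty)
    (hlim : Tendsto (fun k => Metric.hausdorffDist (g k) γ) atTop (𝓝 0)) {η : ℝ} (hη : 0 < η) :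
    ∃ k, ∀ z ∈ p '' (g k), Metric.infDist z (p '' γ) < η := by
  have hp : 0 ≤ ‖p‖ := norm_nonneg p
  have hη' : 0 < η / (‖p‖ + 1) := by positivity
  obtain ⟨k, hk⟩ := (hlim.eventually (gt_mem_nhds hη')).exists
  refine ⟨k, ?_⟩
  rintro _ ⟨x, hx, rfl⟩
  apply infDist_p_lt hγ hne hη
  refine lt_of_le_of_lt (Metric.infDist_le_hausdorffDist_of_mem hx ?_) hk
  exact Metric.hausdorffEDist_ne_top_of_nonempty_of_bounded (hgne k) hne (hg k).isBounded
    hγ.isBounded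

theorem IsSys.omega_case (S : IsSys φ ι P p j δ τV ν τC τS C CP M c) {q : ℂ → E}
    (hm : IsModel φ ι ν p q) {γ : Set E} (hγc : IsCompact γ) (hne : γ.Nonempty) {Γ : ℝ → ℂ}
    (inv : ∀ t, 0 ≤ t → ∀ s, planeFlow φ p q t (Γ s) = Γ (s + t)) (hΓ : range Γ = p '' γ)
    {Ω : Set ℂ} (hΩ : IsOpen Ω) (hd : Disjoint Ω (range Γ)) (hcl : IsClosed (Ω ∪ range Γ))
    {v0 : E} (hv0 : v0 ∈ φ.amenableSet ι ν) (hv0Ω : p v0 ∈ Ω) (hω : φ.omegaLimit v0 = γ)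
    (hsub : γ ⊆ φ.amenableSet ι ν) {η : ℝ} (hη : 0 < η) :
    ∃ c0 ∈ Ω, ∀ t ≥ 0, Metric.infDist (planeFlow φ p q t c0) (range Γ) < η := by
  have flow := S.isPlaneFlow hm
  set f : ℝ → ℂ := fun t => planeFlow φ p q t (p v0) with hf
  have hfc : Continuous f := flow.cont.comp (by fun_prop : Continuous fun t : ℝ => (t, p v0))
  have hf0 : ∀ t, 0 ≤ t → f t = p (φ.toFun t v0) := fun t ht => planeFlow_apply hm ht hv0
  have hωm : ∀ x, x ∈ γ ↔ ∀ s, 0 ≤ s → x ∈ closure {w | ∃ t : ℝ, s ≤ t ∧ φ.toFun t v0 = w} := by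
    intro x
    rw [← hω, Semiflow.omegaLimit]
    simp only [mem_iInter, mem_Ici]
  have hK : IsCompact (range Γ) := by rw [hΓ]; exact hγc.image p.continuous
  have h1 : ∀ y, MapClusterPt y atTop f → y ∈ range Γ := by
    intro y hy
    rw [hΓ]
    refine ⟨q y, ?_, hm.pq y⟩
    rw [hωm]
    intro s hs
    rw [mem_closure_iff_nhds]
    intro U hU
    have hfr := mapClusterPt_iff_frequently.1 hy (q ⁻¹' U) (hm.cont.continuousAt hU)
    obtain ⟨t, ht, htU⟩ := (frequently_atTop.1 hfr) s
    refine ⟨φ.toFun t v0, ?_, t, ht, rfl⟩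
    have h2 : q (f t) ∈ U := htU
    rwa [hf0 t (hs.trans ht), hm.qp _ (amen_flow hv0 (hs.trans ht))] at h2
  obtain ⟨x0, hx0⟩ := hne
  have h2 : MapClusterPt (p x0) atTop f := by
    rw [mapClusterPt_iff_frequently]
    intro U hU
    rw [frequently_atTop]
    intro a
    have h3 := (hωm x0).1 hx0 (max a 0) (le_max_right _ _)
    rw [mem_closure_iff_nhds] at h3
    obtain ⟨_, hwU, t, ht, rfl⟩ := h3 (p ⁻¹' U) (p.continuous.continuousAt hU)
    refine ⟨t, (le_max_left _ _).trans ht, ?_⟩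
    rw [hf0 t ((le_max_right _ _).trans ht)]
    exact hwU
  have hev := orbit_eventually_near hfc hK h1 (y0 := p x0)
    (by rw [hΓ]; exact mem_image_of_mem _ hx0) h2 hη
  obtain ⟨T, hT⟩ := eventually_atTop.1 hev
  have hT0 : 0 ≤ max T 0 := le_max_right _ _
  refine ⟨f (max T 0), orbit_stays flow inv hΩ hd hcl hv0Ω hT0, fun t ht => ?_⟩
  have h4 : planeFlow φ p q t (f (max T 0)) = f (t + max T 0) := (flow.add t _ ht hT0 _).symm
  rw [h4]
  exact hT _ (by linarith [le_max_left T 0])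

theorem IsSys.main (S : IsSys φ ι P p j δ τV ν τC τS C CP M c)
    {Eminus : Submodule ℝ E} (e : ↥Eminus ≃L[ℝ] ℂ) {Pi : E → E}
    (hPi : ∀ v, Pi v = (e.symm (p v) : E)) (hne : (φ.amenableSet ι ν).Nonempty)
    {γ : Set E} (hγ : φ.IsPeriodicOrbit γ)
    (hext : φ.IsExternallyStable ι ν Eminus Pi γ)
    (hint : φ.IsInternallyStable ι ν Eminus Pi γ) : φ.IsAmenableStable ι ν γ := by
  obtain ⟨q, hm⟩ := S.exists_model hne
  have flow := S.isPlaneFlow hm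
  obtain ⟨hsub, hγc, Γ, σ, loop, inv, hΓ⟩ := S.periodic_loop hm hγ
  have hnon : ∀ γ, φ.IsPeriodicOrbit γ → γ.Nonempty := by
    rintro _ ⟨v0, -, rfl⟩; exact ⟨_, 0, le_rfl, rfl⟩
  have hγne := hnon γ hγ
  have hKc : IsClosed (range Γ) := loop.isCompact.isClosed
  have hle : ∀ γ1 γ2, φ.orbitLE ι ν Eminus Pi γ1 γ2 → intC (p '' γ1) ⊆ intC (p '' γ2) := by
    intro γ1 γ2 h z hz
    have h1 := h ((mem_interiorRegion_iff e hPi γ1 (q z)).2 ⟨hm.mem z, by rwa [hm.pq]⟩)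
    have h2 := ((mem_interiorRegion_iff e hPi γ2 (q z)).1 h1).2
    rwa [hm.pq] at h2
  have himg : ∀ γ', φ.IsPeriodicOrbit γ' → γ' ≠ γ → p '' γ' ≠ p '' γ := by
    intro γ' h' hne' heq
    apply hne'
    have hs := (S.periodic_loop hm h').1
    have hq : ∀ A : Set E, A ⊆ φ.amenableSet ι ν → q '' (p '' A) = A := by
      intro A hA
      rw [image_image]
      have : (fun x => q (p x)) '' A = (fun x => x) '' A := image_congr fun x hx => hm.qp x (hA hx)
      rw [this, image_id']
    rw [← hq γ' hs, heq, hq γ hsub]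
  have hextP : ∀ η > 0, ∃ c0 ∈ extC (range Γ), ∀ t ≥ 0,
      Metric.infDist (planeFlow φ p q t c0) (range Γ) < η := by
    intro η hη
    rcases hext with ⟨g, hg, hgne, hgle, hlim⟩ | ⟨v0, ⟨hv0, hv0c⟩, hω⟩
    · obtain ⟨k, hk⟩ := limit_case (p := p) hγc hγne (fun k => (S.periodic_loop hm (hg k)).2.1)
        (fun k => hnon _ (hg k)) hlim hη
      obtain ⟨-, -, Γ', σ', loop', inv', hΓ'⟩ := S.periodic_loop hm (hg k)
      have hd := loops_disjoint loop inv loop' inv' (by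
        rw [hΓ, hΓ']; exact himg _ (hg k) (hgne k))
      have hs := hle _ _ (hgle k)
      rw [← hΓ, ← hΓ'] at hs
      rw [← hΓ, ← hΓ'] at hk
      refine ⟨Γ' 0, ext_of_loop hd hs ⟨0, rfl⟩, fun t ht => ?_⟩
      rw [inv' t ht]
      exact hk _ ⟨_, rfl⟩
    · have hpv : p v0 ∈ extC (range Γ) := by
        have hnot : p v0 ∉ closure (intC (range Γ)) := by
          intro hcl
          apply hv0c
          have h1 : q (p v0) ∈ closure (q '' intC (range Γ)) :=
            image_closure_subset_closure_image hm.cont (mem_image_of_mem _ hcl)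
          rw [hm.qp _ hv0] at h1
          refine closure_mono ?_ h1
          rintro _ ⟨z, hz, rfl⟩
          rw [mem_interiorRegion_iff e hPi, hm.pq, ← hΓ]
          exact ⟨hm.mem z, hz⟩
        have hnK : p v0 ∉ range Γ := fun h => hnot (loop_subset_closure_int flow loop inv h)
        exact (int_or_ext hnK).resolve_left fun h => hnot (subset_closure h)
      exact S.omega_case hm hγc hγne inv hΓ (extC_open hKc) (extC_disjoint _) (extC_closed hKc)
        hv0 hpv hω hsub hη
  have hintP : ∀ η > 0, ∃ c0 ∈ intC (range Γ), ∀ t ≥ 0,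
      Metric.infDist (planeFlow φ p q t c0) (range Γ) < η := by
    intro η hη
    rcases hint with ⟨g, hg, hgne, hgle, hlim⟩ | ⟨v0, hv0, hω⟩
    · obtain ⟨k, hk⟩ := limit_case (p := p) hγc hγne (fun k => (S.periodic_loop hm (hg k)).2.1)
        (fun k => hnon _ (hg k)) hlim hη
      obtain ⟨-, -, Γ', σ', loop', inv', hΓ'⟩ := S.periodic_loop hm (hg k)
      have hd := loops_disjoint loop inv loop' inv' (by
        rw [hΓ, hΓ']; exact himg _ (hg k) (hgne k))
      have hs := hle _ _ (hgle k)
      rw [← hΓ, ← hΓ'] at hs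
      rw [← hΓ, ← hΓ'] at hk
      refine ⟨Γ' 0, int_of_loop loop loop' hd hs ⟨0, rfl⟩, fun t ht => ?_⟩
      rw [inv' t ht]
      exact hk _ ⟨_, rfl⟩
    · rw [mem_interiorRegion_iff e hPi, ← hΓ] at hv0
      exact S.omega_case hm hγc hγne inv hΓ (intC_open hKc) (intC_disjoint _) (intC_closed hKc)
        hv0.1 hv0.2 hω hsub hη
  have hst := planar_stable flow loop inv hextP hintP
  intro ε hε
  have hUopen : IsOpen (setNbhd γ ε) := by
    have : setNbhd γ ε = ⋃ w ∈ γ, Metric.ball w ε := by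
      ext x; simp [setNbhd, dist_eq_norm]
    rw [this]
    exact isOpen_biUnion fun w _ => Metric.isOpen_ball
  have hKU : range Γ ⊆ q ⁻¹' setNbhd γ ε := by
    rw [hΓ]
    rintro _ ⟨x, hx, rfl⟩
    show q (p x) ∈ setNbhd γ ε
    rw [hm.qp x (hsub hx)]
    exact ⟨x, hx, by simpa using hε⟩
  obtain ⟨ε', hε', hth⟩ := loop.isCompact.exists_thickening_subset_open
    (hUopen.preimage hm.cont) hKU
  obtain ⟨d, hd, hdst⟩ := hst ε' hε'
  have hp : 0 ≤ ‖p‖ := norm_nonneg p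
  refine ⟨d / (‖p‖ + 1), by positivity, ?_⟩
  rintro v ⟨⟨w, hw, hvw⟩, hv⟩ t ht
  have h1 : Metric.infDist (p v) (range Γ) < d := by
    rw [hΓ]
    apply infDist_p_lt hγc hγne hd
    exact (Metric.infDist_le_dist_of_mem hw).trans_lt (by rwa [dist_eq_norm])
  have h2 := hdst _ h1 t ht
  rw [planeFlow_apply hm ht hv] at h2
  have h3 : p (φ.toFun t v) ∈ Metric.thickening ε' (range Γ) := by
    rw [Metric.mem_thickening_iff_infEDist_lt]
    have hfin := Metric.infEDist_ne_top (x := p (φ.toFun t v)) (range_nonempty Γ)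
    rw [← ENNReal.ofReal_toReal hfin]
    exact (ENNReal.ofReal_lt_ofReal_iff hε').2 h2
  have h4 := hth h3
  have h5 : q (p (φ.toFun t v)) ∈ setNbhd γ ε := h4
  rwa [hm.qp _ (amen_flow hv ht)] at h5

end Final

/-- Lemma 6: a periodic orbit which is both externally and internally stable is
amenable stable. -/
theorem amenableStable_of_ext_int_stable
    {E : Type*} [NormedAddCommGroup E] [NormedSpace ℝ E]
    {H : Type*} [NormedAddCommGroup H] [InnerProductSpace ℝ H]
    (ι : E →L[ℝ] H) (hι : Function.Injective ι)
    (φ : Semiflow E)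
    (P : E →L[ℝ] E →L[ℝ] ℝ) (Eplus Eminus : Submodule ℝ E)
    (hH1 : Semiflow.IsH1 P Eplus Eminus)
    [FiniteDimensional ℝ ↥Eminus] (hH2 : Module.finrank ℝ ↥Eminus = 2)
    (δ τV ν : ℝ) (hH3 : φ.IsH3 ι P δ τV ν)
    (hCOM : φ.IsCOM) (hS : φ.IsSmoothing ι)
    (hne : (φ.amenableSet ι ν).Nonempty)
    (Pi : E → E) (hPi : Semiflow.IsVProjector P Eminus Pi)
    (γ : Set E) (hγ : φ.IsPeriodicOrbit γ) (hsub : γ ⊆ φ.amenableSet ι ν)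
    (hext : φ.IsExternallyStable ι ν Eminus Pi γ)
    (hint : φ.IsInternallyStable ι ν Eminus Pi γ) :
    φ.IsAmenableStable ι ν γ := by
  obtain ⟨e, p, j, CP, M, c, hc, hPi'⟩ := exists_coord hH1 hH2 hPi
  obtain ⟨hδ, hτ, hν, h3⟩ := hH3
  obtain ⟨τC, hτC, hcom⟩ := hCOM
  obtain ⟨τS, C, hτS, hC, hsm⟩ := hS
  have S : IsSys φ ι P p j δ τV ν τC τS C CP M c :=
    ⟨hc, hι, hδ, hτ, hν, h3, hτC, hcom, hτS, hC, hsm⟩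
  exact S.main e hPi' hne hγ hext hint
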